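/- arXiv:1812.02304 — 18 statements merged into one kernel-verified Lean document; each statement's English description precedes it below -/
import Mathlib

section
/- The Schur complement of the lower-right block of L_{Q(G)} equals (4/3)·L_G; explicitly, with D = [[2I_m, −I_m], [−I_m, 2I_m]] and B = [−B1, −B2], one has (2D_G − A_G) − B·D⁻¹·Bᵀ = 2D_G − A_G − (2/3)·(B1·B1ᵀ + B2·B2ᵀ) − (1/3)·(B1·B2ᵀ + B2·B1ᵀ) = (4/3)·L_G. -/
open Matrix

theorem quad_schur_complement
    {V E : Type} [Fintype V] [Fintype E] [DecidableEq V] [DecidableEq E]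
    [Nonempty V] [Nonempty E]
    (tail head : E → V)
    (hloop : ∀ e, tail e ≠ head e)
    (hsimple : ∀ e f, e ≠ f →
      ¬(tail e = tail f ∧ head e = head f) ∧ ¬(tail e = head f ∧ head e = tail f))
    (B1 B2 : Matrix V E ℝ)
    (hB1 : B1 = Matrix.of fun i e => if i = tail e then (1 : ℝ) else 0)
    (hB2 : B2 = Matrix.of fun i e => if i = head e then (1 : ℝ) else 0)
    (D_G A_G L_G : Matrix V V ℝ)
    (hD : D_G = B1 * B1ᵀ + B2 * B2ᵀ)
    (hA : A_G = B1 * B2ᵀ + B2 * B1ᵀ)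
    (hL : L_G = D_G - A_G)
    (hconn : ∀ x : V → ℝ, L_G.mulVec x = 0 → ∃ c, ∀ i, x i = c)
    :
    ((2 : ℝ) • D_G - A_G -
        Matrix.fromCols (-B1) (-B2) *
          (Matrix.fromBlocks ((2 : ℝ) • (1 : Matrix E E ℝ)) (-(1 : Matrix E E ℝ))
              (-(1 : Matrix E E ℝ)) ((2 : ℝ) • (1 : Matrix E E ℝ)))⁻¹ *
          (Matrix.fromCols (-B1) (-B2))ᵀ =
      (2 : ℝ) • D_G - A_G - (2/3 : ℝ) • (B1 * B1ᵀ + B2 * B2ᵀ) -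
        (1/3 : ℝ) • (B1 * B2ᵀ + B2 * B1ᵀ)) ∧
    (2 : ℝ) • D_G - A_G - (2/3 : ℝ) • (B1 * B1ᵀ + B2 * B2ᵀ) -
        (1/3 : ℝ) • (B1 * B2ᵀ + B2 * B1ᵀ) = (4/3 : ℝ) • L_G := by
  have hinv : (Matrix.fromBlocks ((2 : ℝ) • (1 : Matrix E E ℝ)) (-(1 : Matrix E E ℝ))
      (-(1 : Matrix E E ℝ)) ((2 : ℝ) • (1 : Matrix E E ℝ)))⁻¹ =
      Matrix.fromBlocks ((2/3 : ℝ) • (1 : Matrix E E ℝ)) ((1/3 : ℝ) • (1 : Matrix E E ℝ))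
        ((1/3 : ℝ) • (1 : Matrix E E ℝ)) ((2/3 : ℝ) • (1 : Matrix E E ℝ)) := by
    apply Matrix.inv_eq_right_inv
    rw [Matrix.fromBlocks_multiply, ← Matrix.fromBlocks_one]
    simp only [Matrix.smul_mul, Matrix.one_mul, Matrix.neg_mul]
    congr 1 <;> module
  refine ⟨?_, ?_⟩
  · rw [hinv, Matrix.transpose_fromCols, Matrix.fromCols_mul_fromBlocks,
      Matrix.fromCols_mul_fromRows]
    simp only [Matrix.mul_smul, Matrix.mul_one, Matrix.smul_mul, Matrix.add_mul,
      Matrix.transpose_neg, Matrix.neg_mul, Matrix.mul_neg]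
    module
  · rw [hL, ← hD, ← hA]
    module
end

section
/- The block matrix N indexed by V ⊕ E ⊕ E with blocks N_{V,V} = (3/4)·L_G^#, N_{V,V1} = L_G^#·((1/2)B1 + (1/4)B2), N_{V,V2} = L_G^#·((1/4)B1 + (1/2)B2), N_{V1,V1} = (2/3)I_m + P, N_{V1,V2} = (1/3)I_m + Q, N_{V2,V2} = (2/3)I_m + N', and the blocks below the diagonal the transposes of the corresponding blocks above, is a symmetric {1}-inverse of L_{Q(G)}: N is symmetric and L_{Q(G)}·N·L_{Q(G)} = L_{Q(G)}. -/
open Matrix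

theorem quad_one_inverse
    {V E : Type} [Fintype V] [Fintype E] [DecidableEq V] [DecidableEq E]
    [Nonempty V] [Nonempty E]
    (tail head : E → V)
    (hloop : ∀ e, tail e ≠ head e)
    (hsimple : ∀ e f, e ≠ f →
      ¬(tail e = tail f ∧ head e = head f) ∧ ¬(tail e = head f ∧ head e = tail f))
    (B1 B2 : Matrix V E ℝ)
    (hB1 : B1 = Matrix.of fun i e => if i = tail e then (1 : ℝ) else 0)
    (hB2 : B2 = Matrix.of fun i e => if i = head e then (1 : ℝ) else 0)
    (D_G A_G L_G : Matrix V V ℝ)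
    (hD : D_G = B1 * B1ᵀ + B2 * B2ᵀ)
    (hA : A_G = B1 * B2ᵀ + B2 * B1ᵀ)
    (hL : L_G = D_G - A_G)
    (hconn : ∀ x : V → ℝ, L_G.mulVec x = 0 → ∃ c, ∀ i, x i = c)
    (Lp : Matrix V V ℝ)
    (hLp1 : L_G * Lp * L_G = L_G)
    (hLp2 : Lp * L_G * Lp = Lp)
    (hLp3 : L_G * Lp = Lp * L_G)
    (hLpsymm : Lp.IsSymm)
    (L_Q : Matrix (V ⊕ E ⊕ E) (V ⊕ E ⊕ E) ℝ)
    (hLQ : L_Q = Matrix.fromBlocks ((2 : ℝ) • D_G - A_G)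
      (Matrix.fromCols (-B1) (-B2))
      (Matrix.fromRows (-B1ᵀ) (-B2ᵀ))
      (Matrix.fromBlocks ((2 : ℝ) • (1 : Matrix E E ℝ)) (-(1 : Matrix E E ℝ))
        (-(1 : Matrix E E ℝ)) ((2 : ℝ) • (1 : Matrix E E ℝ))))
    (P Q N' : Matrix E E ℝ)
    (hP : P = ((1/2 : ℝ) • B1ᵀ + (1/4 : ℝ) • B2ᵀ) * Lp * ((2/3 : ℝ) • B1 + (1/3 : ℝ) • B2))
    (hQ : Q = ((1/2 : ℝ) • B1ᵀ + (1/4 : ℝ) • B2ᵀ) * Lp * ((1/3 : ℝ) • B1 + (2/3 : ℝ) • B2))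
    (hN' : N' = ((1/4 : ℝ) • B1ᵀ + (1/2 : ℝ) • B2ᵀ) * Lp * ((1/3 : ℝ) • B1 + (2/3 : ℝ) • B2))
    (N : Matrix (V ⊕ E ⊕ E) (V ⊕ E ⊕ E) ℝ)
    (hN : N = Matrix.fromBlocks ((3/4 : ℝ) • Lp)
      (Matrix.fromCols (Lp * ((1/2 : ℝ) • B1 + (1/4 : ℝ) • B2))
        (Lp * ((1/4 : ℝ) • B1 + (1/2 : ℝ) • B2)))
      (Matrix.fromRows (Lp * ((1/2 : ℝ) • B1 + (1/4 : ℝ) • B2))ᵀ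
        (Lp * ((1/4 : ℝ) • B1 + (1/2 : ℝ) • B2))ᵀ)
      (Matrix.fromBlocks ((2/3 : ℝ) • (1 : Matrix E E ℝ) + P)
        ((1/3 : ℝ) • (1 : Matrix E E ℝ) + Q)
        ((1/3 : ℝ) • (1 : Matrix E E ℝ) + Q)ᵀ
        ((2/3 : ℝ) • (1 : Matrix E E ℝ) + N')))
    :
    N.IsSymm ∧ L_Q * N * L_Q = L_Q := by
  clear hconn hsimple hloop hLp2 hLp3 hB1 hB2
  obtain ⟨C1, hC1⟩ : ∃ C1, C1 = (2/3 : ℝ) • B1 + (1/3 : ℝ) • B2 := ⟨_, rfl⟩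
  obtain ⟨C2, hC2⟩ : ∃ C2, C2 = (1/3 : ℝ) • B1 + (2/3 : ℝ) • B2 := ⟨_, rfl⟩
  have hb1 : B1 = (2 : ℝ) • C1 - C2 := by rw [hC1, hC2]; module
  have hb2 : B2 = (2 : ℝ) • C2 - C1 := by rw [hC1, hC2]; module
  have hM : (2 : ℝ) • D_G - A_G = (4/3 : ℝ) • L_G + ((2 : ℝ) • (C1 * C1ᵀ) - C2 * C1ᵀ - C1 * C2ᵀ
      + (2 : ℝ) • (C2 * C2ᵀ)) := by
    rw [hL, hD, hA, hb1, hb2]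
    simp only [Matrix.transpose_sub, Matrix.transpose_smul, Matrix.mul_sub, Matrix.sub_mul,
      Matrix.smul_mul, Matrix.mul_smul]
    module
  have e1 : (1/2 : ℝ) • B1 + (1/4 : ℝ) • B2 = (3/4 : ℝ) • C1 := by rw [hC1]; module
  have e2 : (1/4 : ℝ) • B1 + (1/2 : ℝ) • B2 = (3/4 : ℝ) • C2 := by rw [hC2]; module
  have e1t : (1/2 : ℝ) • B1ᵀ + (1/4 : ℝ) • B2ᵀ = (3/4 : ℝ) • C1ᵀ := by
    rw [← Matrix.transpose_smul (3/4 : ℝ), ← e1]; simp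
  have e2t : (1/4 : ℝ) • B1ᵀ + (1/2 : ℝ) • B2ᵀ = (3/4 : ℝ) • C2ᵀ := by
    rw [← Matrix.transpose_smul (3/4 : ℝ), ← e2]; simp
  rw [e1t, ← hC1] at hP
  rw [e1t, ← hC2] at hQ
  rw [e2t, ← hC2] at hN'
  rw [e1, e2] at hN
  rw [hM] at hLQ
  have hs : Lpᵀ = Lp := hLpsymm
  have hPs : Pᵀ = P := by rw [hP]; simp [Matrix.mul_assoc, hs]
  have hNs : N'ᵀ = N' := by rw [hN']; simp [Matrix.mul_assoc, hs]
  have hQt : Qᵀ = (3/4 : ℝ) • (C2ᵀ * (Lp * C1)) := by rw [hQ]; simp [Matrix.mul_assoc, hs]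
  constructor
  · rw [hN, Matrix.IsSymm, Matrix.fromBlocks_transpose, Matrix.fromBlocks_transpose,
      Matrix.transpose_fromCols, Matrix.transpose_fromRows]
    simp [hs, hPs, hNs]
  · have key : L_Q * N = Matrix.fromBlocks (L_G * Lp)
        (Matrix.fromCols (L_G * (Lp * C1) - C1) (L_G * (Lp * C2) - C2))
        0 1 := by
      rw [hLQ, hN, Matrix.fromBlocks_multiply, ← Matrix.fromBlocks_one]
      simp only [Matrix.fromCols_mul_fromRows, Matrix.mul_fromCols, Matrix.fromRows_mul,
        Matrix.fromCols_mul_fromBlocks, Matrix.fromBlocks_mul_fromRows, Matrix.fromBlocks_multiply]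
      rw [hb1, hb2]
      simp only [hQt, hP, hQ, hN', hs, Matrix.transpose_sub, Matrix.transpose_add,
        Matrix.transpose_smul, Matrix.transpose_mul, Matrix.transpose_one,
        Matrix.mul_sub, Matrix.sub_mul, Matrix.mul_add, Matrix.add_mul, Matrix.neg_mul,
        Matrix.mul_neg, Matrix.one_mul, Matrix.mul_one,
        Matrix.smul_mul, Matrix.mul_smul, Matrix.mul_assoc]
      have o1 : ∀ i j : E, (1 : Matrix (E ⊕ E) (E ⊕ E) ℝ) (Sum.inl i) (Sum.inl j)
          = (1 : Matrix E E ℝ) i j := by intro i j; simp [Matrix.one_apply]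
      have o2 : ∀ i j : E, (1 : Matrix (E ⊕ E) (E ⊕ E) ℝ) (Sum.inr i) (Sum.inr j)
          = (1 : Matrix E E ℝ) i j := by intro i j; simp [Matrix.one_apply]
      ext i j
      rcases i with i | i | i <;> rcases j with j | j | j <;>
        simp [o1, o2] <;> ring
    have h1 : L_G * (Lp * L_G) = L_G := by rw [← Matrix.mul_assoc]; exact hLp1
    rw [key, hLQ, Matrix.fromBlocks_multiply]
    simp only [Matrix.fromCols_mul_fromRows, Matrix.mul_fromCols, Matrix.fromRows_mul,
        Matrix.fromCols_mul_fromBlocks, Matrix.fromBlocks_mul_fromRows, Matrix.zero_mul,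
        Matrix.one_mul, zero_add]
    rw [hb1, hb2]
    simp only [h1, Matrix.transpose_sub, Matrix.transpose_add,
        Matrix.transpose_smul, Matrix.transpose_mul, Matrix.transpose_one,
        Matrix.mul_sub, Matrix.sub_mul, Matrix.mul_add, Matrix.add_mul, Matrix.neg_mul,
        Matrix.mul_neg, Matrix.one_mul, Matrix.mul_one,
        Matrix.smul_mul, Matrix.mul_smul, Matrix.mul_assoc]
    ext i j
    rcases i with i | i | i <;> rcases j with j | j | j <;>
        simp <;> ring
end

section
/- For all vertices i, j ∈ V, the resistance distance in the quadrilateral graph satisfies r_{ij}(Q(G)) = (3/4)·((L_G^#)_{ii} + (L_G^#)_{jj} − 2·(L_G^#)_{ij}) = (3/4)·r_{ij}(G). -/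
open Matrix

theorem quad_resistance_VV
    {V E : Type} [Fintype V] [Fintype E] [DecidableEq V] [DecidableEq E]
    [Nonempty V] [Nonempty E]
    (tail head : E → V)
    (hloop : ∀ e, tail e ≠ head e)
    (hsimple : ∀ e f, e ≠ f →
      ¬(tail e = tail f ∧ head e = head f) ∧ ¬(tail e = head f ∧ head e = tail f))
    (B1 B2 : Matrix V E ℝ)
    (hB1 : B1 = Matrix.of fun i e => if i = tail e then (1 : ℝ) else 0)
    (hB2 : B2 = Matrix.of fun i e => if i = head e then (1 : ℝ) else 0)
    (D_G A_G L_G : Matrix V V ℝ)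
    (hD : D_G = B1 * B1ᵀ + B2 * B2ᵀ)
    (hA : A_G = B1 * B2ᵀ + B2 * B1ᵀ)
    (hL : L_G = D_G - A_G)
    (hconn : ∀ x : V → ℝ, L_G.mulVec x = 0 → ∃ c, ∀ i, x i = c)
    (Lp : Matrix V V ℝ)
    (hLp1 : L_G * Lp * L_G = L_G)
    (hLp2 : Lp * L_G * Lp = Lp)
    (hLp3 : L_G * Lp = Lp * L_G)
    (hLpsymm : Lp.IsSymm)
    (L_Q : Matrix (V ⊕ E ⊕ E) (V ⊕ E ⊕ E) ℝ)
    (hLQ : L_Q = Matrix.fromBlocks ((2 : ℝ) • D_G - A_G)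
      (Matrix.fromCols (-B1) (-B2))
      (Matrix.fromRows (-B1ᵀ) (-B2ᵀ))
      (Matrix.fromBlocks ((2 : ℝ) • (1 : Matrix E E ℝ)) (-(1 : Matrix E E ℝ))
        (-(1 : Matrix E E ℝ)) ((2 : ℝ) • (1 : Matrix E E ℝ))))
    (i j : V)
    (X : Matrix (V ⊕ E ⊕ E) (V ⊕ E ⊕ E) ℝ)
    (hXsymm : X.IsSymm)
    (hX : L_Q * X * L_Q = L_Q)
    :
    X (Sum.inl i) (Sum.inl i) + X (Sum.inl j) (Sum.inl j) -
        2 * X (Sum.inl i) (Sum.inl j) =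
      (3/4 : ℝ) * (Lp i i + Lp j j - 2 * Lp i j) := by
  have hLs : L_Gᵀ = L_G := by
    subst hL hD hA
    simp only [Matrix.transpose_sub, Matrix.transpose_add, Matrix.transpose_mul,
      Matrix.transpose_transpose]
    abel
  have hQs : L_Qᵀ = L_Q := by
    subst hLQ hD hA
    simp only [Matrix.fromBlocks_transpose, Matrix.transpose_fromCols, Matrix.transpose_fromRows,
      Matrix.transpose_sub, Matrix.transpose_add, Matrix.transpose_mul, Matrix.transpose_smul,
      Matrix.transpose_transpose, Matrix.transpose_neg, Matrix.transpose_one]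
    rw [add_comm (B2 * B1ᵀ)]
  let F1 : Matrix E V ℝ := (2/3 : ℝ) • B1ᵀ + (1/3 : ℝ) • B2ᵀ
  let F2 : Matrix E V ℝ := (1/3 : ℝ) • B1ᵀ + (2/3 : ℝ) • B2ᵀ
  let Z : Matrix (V ⊕ E ⊕ E) V ℝ := Matrix.fromRows 1 (Matrix.fromRows F1 F2)
  let S : Matrix (V ⊕ E ⊕ E) V ℝ := Matrix.fromRows ((4/3 : ℝ) • L_G) 0
  have hZ : L_Q * Z = S := by
    subst hLQ
    simp only [Z, S, Matrix.fromBlocks_mul_fromRows, Matrix.fromCols_mul_fromRows,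
      Matrix.fromRows_mul, F1, F2, Matrix.mul_one, hL, hD, hA, Matrix.mul_add, Matrix.mul_smul,
      Matrix.neg_mul, Matrix.smul_mul, Matrix.one_mul]
    congr 1
    · module
    · ext a b
      rcases a with a | a
      · simp; ring
      · simp; ring
  have hZt : Zᵀ * L_Q = Sᵀ := by
    rw [← hZ, Matrix.transpose_mul, hQs]
  have key : Sᵀ * X * S = Zᵀ * S := by
    calc Sᵀ * X * S = Zᵀ * (L_Q * X * L_Q) * Z := by
          rw [← hZt]; nth_rw 1 [← hZ]; simp only [Matrix.mul_assoc]
      _ = Zᵀ * S := by rw [hX, Matrix.mul_assoc, hZ]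
  have hXb := Matrix.fromBlocks_toBlocks X
  have key2 : L_G * X.toBlocks₁₁ * L_G = (3/4 : ℝ) • L_G := by
    rw [← hXb] at key
    simp only [S, Z, Matrix.transpose_fromRows, Matrix.fromCols_mul_fromBlocks,
      Matrix.fromCols_mul_fromRows, Matrix.transpose_zero, Matrix.zero_mul, Matrix.mul_zero,
      add_zero, Matrix.transpose_smul, hLs, Matrix.transpose_one, Matrix.one_mul,
      Matrix.smul_mul, Matrix.mul_smul, smul_smul] at key
    have h := congrArg (fun M => (9/16 : ℝ) • M) key
    simp only [smul_smul] at h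
    norm_num at h
    exact h
  have key3 : (L_G * Lp) * X.toBlocks₁₁ * (L_G * Lp) = (3/4 : ℝ) • Lp := by
    calc (L_G * Lp) * X.toBlocks₁₁ * (L_G * Lp)
        = Lp * (L_G * X.toBlocks₁₁ * L_G) * Lp := by
          nth_rw 1 [hLp3]; simp only [Matrix.mul_assoc]
      _ = _ := by rw [key2, Matrix.mul_smul, Matrix.smul_mul, hLp2]
  have hPs : (L_G * Lp)ᵀ = L_G * Lp := by
    rw [Matrix.transpose_mul, hLs, hLpsymm.eq, hLp3]
  have hMs : (1 - L_G * Lp)ᵀ = 1 - L_G * Lp := by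
    rw [Matrix.transpose_sub, hPs, Matrix.transpose_one]
  have hM0 : L_G * (1 - L_G * Lp) = 0 := by
    rw [Matrix.mul_sub, Matrix.mul_one, hLp3, ← Matrix.mul_assoc, hLp1, sub_self]
  have hcol : ∀ k k' l, (1 - L_G * Lp) k l = (1 - L_G * Lp) k' l := by
    intro k k' l
    obtain ⟨c, hc⟩ := hconn (fun k => (1 - L_G * Lp) k l) (by
      ext a
      exact congrFun (congrFun hM0 a) l)
    exact (hc k).trans (hc k').symm
  let b : V → ℝ := Pi.single i 1 - Pi.single j 1
  have hMb : (1 - L_G * Lp) *ᵥ b = 0 := by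
    ext k
    have h1 := congrFun (congrFun hMs i) k
    have h2 := congrFun (congrFun hMs j) k
    have h3 := hcol i j k
    rw [Matrix.transpose_apply] at h1 h2
    simp only [b, Matrix.mulVec_sub, Matrix.mulVec_single_one, Pi.sub_apply, Matrix.col_apply,
      Pi.zero_apply]
    linarith
  have hPb : (L_G * Lp) *ᵥ b = b := by
    rw [Matrix.sub_mulVec, Matrix.one_mulVec, sub_eq_zero] at hMb
    exact hMb.symm
  have hbP : b ᵥ* (L_G * Lp) = b := by
    rw [← hPs, Matrix.vecMul_transpose, hPb]
  have fin : b ⬝ᵥ (X.toBlocks₁₁ *ᵥ b) = b ⬝ᵥ (((3/4 : ℝ) • Lp) *ᵥ b) := by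
    rw [← key3, ← Matrix.mulVec_mulVec, hPb, ← Matrix.mulVec_mulVec, Matrix.dotProduct_mulVec b (L_G * Lp), hbP]
  have hx := hXsymm.apply (Sum.inl i) (Sum.inl j)
  have hl := hLpsymm.apply i j
  simp [b, Matrix.mulVec_sub, sub_dotProduct, Matrix.toBlocks₁₁] at fin
  linarith
end

section
/- For every vertex i ∈ V and every edge e ∈ E, the resistance distance in Q(G) between i and the path vertex u_{e1} ∈ V1 satisfies r_{i,u_{e1}}(Q(G)) = (3/4)·(L_G^#)_{ii} + 2/3 + P_{ee} − 2·(L_G^#·((1/2)B1 + (1/4)B2))_{ie}. -/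
open Matrix

theorem quad_resistance_V_V1
    {V E : Type} [Fintype V] [Fintype E] [DecidableEq V] [DecidableEq E]
    [Nonempty V] [Nonempty E]
    (tail head : E → V)
    (hloop : ∀ e, tail e ≠ head e)
    (hsimple : ∀ e f, e ≠ f →
      ¬(tail e = tail f ∧ head e = head f) ∧ ¬(tail e = head f ∧ head e = tail f))
    (B1 B2 : Matrix V E ℝ)
    (hB1 : B1 = Matrix.of fun i e => if i = tail e then (1 : ℝ) else 0)
    (hB2 : B2 = Matrix.of fun i e => if i = head e then (1 : ℝ) else 0)
    (D_G A_G L_G : Matrix V V ℝ)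
    (hD : D_G = B1 * B1ᵀ + B2 * B2ᵀ)
    (hA : A_G = B1 * B2ᵀ + B2 * B1ᵀ)
    (hL : L_G = D_G - A_G)
    (hconn : ∀ x : V → ℝ, L_G.mulVec x = 0 → ∃ c, ∀ i, x i = c)
    (Lp : Matrix V V ℝ)
    (hLp1 : L_G * Lp * L_G = L_G)
    (hLp2 : Lp * L_G * Lp = Lp)
    (hLp3 : L_G * Lp = Lp * L_G)
    (hLpsymm : Lp.IsSymm)
    (L_Q : Matrix (V ⊕ E ⊕ E) (V ⊕ E ⊕ E) ℝ)
    (hLQ : L_Q = Matrix.fromBlocks ((2 : ℝ) • D_G - A_G)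
      (Matrix.fromCols (-B1) (-B2))
      (Matrix.fromRows (-B1ᵀ) (-B2ᵀ))
      (Matrix.fromBlocks ((2 : ℝ) • (1 : Matrix E E ℝ)) (-(1 : Matrix E E ℝ))
        (-(1 : Matrix E E ℝ)) ((2 : ℝ) • (1 : Matrix E E ℝ))))
    (P Q N' : Matrix E E ℝ)
    (hP : P = ((1/2 : ℝ) • B1ᵀ + (1/4 : ℝ) • B2ᵀ) * Lp * ((2/3 : ℝ) • B1 + (1/3 : ℝ) • B2))
    (hQ : Q = ((1/2 : ℝ) • B1ᵀ + (1/4 : ℝ) • B2ᵀ) * Lp * ((1/3 : ℝ) • B1 + (2/3 : ℝ) • B2))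
    (hN' : N' = ((1/4 : ℝ) • B1ᵀ + (1/2 : ℝ) • B2ᵀ) * Lp * ((1/3 : ℝ) • B1 + (2/3 : ℝ) • B2))
    (i : V) (e : E)
    (X : Matrix (V ⊕ E ⊕ E) (V ⊕ E ⊕ E) ℝ)
    (hXsymm : X.IsSymm)
    (hX : L_Q * X * L_Q = L_Q)
    :
    X (Sum.inl i) (Sum.inl i) + X (Sum.inr (Sum.inl e)) (Sum.inr (Sum.inl e)) -
        2 * X (Sum.inl i) (Sum.inr (Sum.inl e)) =
      (3/4 : ℝ) * Lp i i + 2/3 + P e e -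
        2 * (Lp * ((1/2 : ℝ) • B1 + (1/4 : ℝ) • B2)) i e := by
  have h1t : ∀ x : V → ℝ, B1ᵀ *ᵥ x = fun f => x (tail f) := by
    intro x; ext f; simp [hB1, Matrix.mulVec, dotProduct]
  have h2t : ∀ x : V → ℝ, B2ᵀ *ᵥ x = fun f => x (head f) := by
    intro x; ext f; simp [hB2, Matrix.mulVec, dotProduct]
  have hLsum : ∀ x : V → ℝ, ∑ j, (L_G *ᵥ x) j = 0 := by
    intro x
    have s1 : ∀ z : E → ℝ, ∑ j, (B1 *ᵥ z) j = ∑ f, z f := by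
      intro z
      simp only [hB1, Matrix.mulVec, dotProduct, Matrix.of_apply]
      rw [Finset.sum_comm]; simp
    have s2 : ∀ z : E → ℝ, ∑ j, (B2 *ᵥ z) j = ∑ f, z f := by
      intro z
      simp only [hB2, Matrix.mulVec, dotProduct, Matrix.of_apply]
      rw [Finset.sum_comm]; simp
    simp only [hL, hD, hA, Matrix.sub_mulVec, Matrix.add_mulVec, ← Matrix.mulVec_mulVec,
      Pi.sub_apply, Pi.add_apply, Finset.sum_sub_distrib, Finset.sum_add_distrib, s1, s2]
    ring
  have key : ∀ c : V → ℝ, ∑ j, c j = 0 → L_G *ᵥ (Lp *ᵥ c) = c := by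
    intro c hc
    have h0 : L_G *ᵥ (c - L_G *ᵥ (Lp *ᵥ c)) = 0 := by
      rw [Matrix.mulVec_sub, Matrix.mulVec_mulVec c L_G Lp, hLp3, Matrix.mulVec_mulVec,
        ← Matrix.mul_assoc, hLp1, sub_self]
    obtain ⟨k, hk⟩ := hconn _ h0
    have hs : ∑ j, (c - L_G *ᵥ (Lp *ᵥ c)) j = 0 := by
      simp only [Pi.sub_apply, Finset.sum_sub_distrib, hc, hLsum, sub_zero]
    have hk0 : k = 0 := by
      simp only [hk] at hs
      simpa using hs
    ext j
    have := hk j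
    rw [hk0, Pi.sub_apply] at this
    linarith
  let c : V → ℝ := Pi.single i 1 - (2/3 : ℝ) • Pi.single (tail e) 1 - (1/3 : ℝ) • Pi.single (head e) 1
  have hc0 : ∑ j, c j = 0 := by
    simp only [c, Pi.sub_apply, Pi.smul_apply, smul_eq_mul, Finset.sum_sub_distrib,
      ← Finset.mul_sum, Finset.sum_pi_single', Finset.mem_univ, if_true]
    norm_num
  have hkc := key c hc0
  let v : V → ℝ := (3/4 : ℝ) • (Lp *ᵥ c)
  have hv : L_G *ᵥ v = (3/4 : ℝ) • c := by
    simp only [v, Matrix.mulVec_smul, hkc]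
  let p : E → ℝ := (2/3 : ℝ) • (B1ᵀ *ᵥ v) + (1/3 : ℝ) • (B2ᵀ *ᵥ v) - (2/3 : ℝ) • Pi.single e 1
  let q : E → ℝ := (1/3 : ℝ) • (B1ᵀ *ᵥ v) + (2/3 : ℝ) • (B2ᵀ *ᵥ v) - (1/3 : ℝ) • Pi.single e 1
  let y : V ⊕ E ⊕ E → ℝ := Sum.elim v (Sum.elim p q)
  let b : V ⊕ E ⊕ E → ℝ := Sum.elim (Pi.single i 1) (Sum.elim (-Pi.single e 1) 0)
  have hB1e : B1 *ᵥ Pi.single e 1 = Pi.single (tail e) 1 := by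
    ext j; simp [hB1, Pi.single_apply]
  have hB2e : B2 *ᵥ Pi.single e 1 = Pi.single (head e) 1 := by
    ext j; simp [hB2, Pi.single_apply]
  have hy : L_Q *ᵥ y = b := by
    ext (j | f | f)
    · have hvj := congrFun hv j
      simp only [hL, hD, hA, c, Matrix.sub_mulVec, Matrix.add_mulVec, ← Matrix.mulVec_mulVec,
        Pi.sub_apply, Pi.add_apply, Pi.smul_apply, smul_eq_mul] at hvj
      simp only [hLQ, y, b, p, q, Matrix.fromBlocks_mulVec, Matrix.fromCols_mulVec,
        Sum.elim_inl, Sum.elim_comp_inl, Sum.elim_comp_inr, hD, hA, Matrix.sub_mulVec,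
        Matrix.smul_mulVec, Matrix.add_mulVec, Matrix.neg_mulVec, Matrix.mulVec_add,
        Matrix.mulVec_sub, Matrix.mulVec_smul, ← Matrix.mulVec_mulVec, hB1e, hB2e,
        Pi.sub_apply, Pi.add_apply, Pi.smul_apply, Pi.neg_apply, smul_eq_mul]
      linarith
    · simp only [hLQ, y, b, p, q, Matrix.fromBlocks_mulVec, Matrix.fromRows_mulVec,
        Sum.elim_inl, Sum.elim_inr, Sum.elim_comp_inl, Sum.elim_comp_inr,
        Matrix.smul_mulVec, Matrix.neg_mulVec, Matrix.one_mulVec,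
        Pi.sub_apply, Pi.add_apply, Pi.smul_apply, Pi.neg_apply, smul_eq_mul]
      ring
    · simp only [hLQ, y, b, p, q, Matrix.fromBlocks_mulVec, Matrix.fromRows_mulVec,
        Sum.elim_inl, Sum.elim_inr, Sum.elim_comp_inl, Sum.elim_comp_inr,
        Matrix.smul_mulVec, Matrix.neg_mulVec, Matrix.one_mulVec, Pi.zero_apply,
        Pi.sub_apply, Pi.add_apply, Pi.smul_apply, Pi.neg_apply, smul_eq_mul]
      ring
  have hLQs : L_Qᵀ = L_Q := by
    subst hLQ
    rw [Matrix.fromBlocks_transpose, Matrix.fromBlocks_transpose, Matrix.transpose_fromCols,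
      Matrix.transpose_fromRows]
    simp [hD, hA, Matrix.transpose_mul, add_comm]
  have hquad : b ⬝ᵥ (X *ᵥ b) = y ⬝ᵥ b := by
    conv_lhs => rw [← hy]
    conv_rhs => rw [← hy, ← hX]
    rw [← Matrix.mulVec_mulVec, ← Matrix.mulVec_mulVec, Matrix.dotProduct_mulVec y L_Q,
      ← Matrix.mulVec_transpose, hLQs]
  have hb : b = Pi.single (Sum.inl i) 1 - Pi.single (Sum.inr (Sum.inl e)) 1 := by
    ext (j | f | f) <;> simp [b, Pi.single_apply]
  rw [hb] at hquad
  have hXs := hXsymm.apply (Sum.inl i) (Sum.inr (Sum.inl e))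
  simp only [Matrix.mulVec_sub, sub_dotProduct, dotProduct_sub, single_dotProduct,
    dotProduct_single, Matrix.mulVec_single_one, Matrix.col_apply, one_mul, mul_one] at hquad
  have e1 : (Lp * ((1/2 : ℝ) • B1 + (1/4 : ℝ) • B2)) i e
      = 1/2 * Lp i (tail e) + 1/4 * Lp i (head e) := by
    simp [mul_add, Finset.sum_add_distrib, Matrix.mul_apply, hB1, hB2]
    ring
  have e2 : P e e = 1/3 * Lp (tail e) (tail e) + 1/6 * Lp (tail e) (head e)
      + 1/6 * Lp (head e) (tail e) + 1/12 * Lp (head e) (head e) := by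
    simp [hP, mul_add, Finset.sum_add_distrib, Matrix.add_mul, Matrix.mul_apply, hB1, hB2]
    ring
  have hvj : ∀ j, v j = 3/4 * (Lp j i - 2/3 * Lp j (tail e) - 1/3 * Lp j (head e)) := by
    intro j
    simp [v, c, Matrix.mulVec_sub, Matrix.mulVec_smul]
  have t1 := hLpsymm.apply i (tail e)
  have t2 := hLpsymm.apply i (head e)
  have hyi : y (Sum.inl i) = v i := rfl
  have hye : y (Sum.inr (Sum.inl e)) = 2/3 * v (tail e) + 1/3 * v (head e) - 2/3 := by
    simp [y, p, h1t, h2t]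
  rw [hyi, hye, hvj, hvj, hvj, t1, t2] at hquad
  rw [e1, e2]
  linarith
end

section
/- For every vertex i ∈ V and every edge e ∈ E, the resistance distance in Q(G) between i and the path vertex u_{e2} ∈ V2 satisfies r_{i,u_{e2}}(Q(G)) = (3/4)·(L_G^#)_{ii} + 2/3 + N'_{ee} − 2·(L_G^#·((1/4)B1 + (1/2)B2))_{ie}. -/
open Matrix

theorem quad_resistance_V_V2
    {V E : Type} [Fintype V] [Fintype E] [DecidableEq V] [DecidableEq E]
    [Nonempty V] [Nonempty E]
    (tail head : E → V)
    (hloop : ∀ e, tail e ≠ head e)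
    (hsimple : ∀ e f, e ≠ f →
      ¬(tail e = tail f ∧ head e = head f) ∧ ¬(tail e = head f ∧ head e = tail f))
    (B1 B2 : Matrix V E ℝ)
    (hB1 : B1 = Matrix.of fun i e => if i = tail e then (1 : ℝ) else 0)
    (hB2 : B2 = Matrix.of fun i e => if i = head e then (1 : ℝ) else 0)
    (D_G A_G L_G : Matrix V V ℝ)
    (hD : D_G = B1 * B1ᵀ + B2 * B2ᵀ)
    (hA : A_G = B1 * B2ᵀ + B2 * B1ᵀ)
    (hL : L_G = D_G - A_G)
    (hconn : ∀ x : V → ℝ, L_G.mulVec x = 0 → ∃ c, ∀ i, x i = c)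
    (Lp : Matrix V V ℝ)
    (hLp1 : L_G * Lp * L_G = L_G)
    (hLp2 : Lp * L_G * Lp = Lp)
    (hLp3 : L_G * Lp = Lp * L_G)
    (hLpsymm : Lp.IsSymm)
    (L_Q : Matrix (V ⊕ E ⊕ E) (V ⊕ E ⊕ E) ℝ)
    (hLQ : L_Q = Matrix.fromBlocks ((2 : ℝ) • D_G - A_G)
      (Matrix.fromCols (-B1) (-B2))
      (Matrix.fromRows (-B1ᵀ) (-B2ᵀ))
      (Matrix.fromBlocks ((2 : ℝ) • (1 : Matrix E E ℝ)) (-(1 : Matrix E E ℝ))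
        (-(1 : Matrix E E ℝ)) ((2 : ℝ) • (1 : Matrix E E ℝ))))
    (P Q N' : Matrix E E ℝ)
    (hP : P = ((1/2 : ℝ) • B1ᵀ + (1/4 : ℝ) • B2ᵀ) * Lp * ((2/3 : ℝ) • B1 + (1/3 : ℝ) • B2))
    (hQ : Q = ((1/2 : ℝ) • B1ᵀ + (1/4 : ℝ) • B2ᵀ) * Lp * ((1/3 : ℝ) • B1 + (2/3 : ℝ) • B2))
    (hN' : N' = ((1/4 : ℝ) • B1ᵀ + (1/2 : ℝ) • B2ᵀ) * Lp * ((1/3 : ℝ) • B1 + (2/3 : ℝ) • B2))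
    (i : V) (e : E)
    (X : Matrix (V ⊕ E ⊕ E) (V ⊕ E ⊕ E) ℝ)
    (hXsymm : X.IsSymm)
    (hX : L_Q * X * L_Q = L_Q)
    :
    X (Sum.inl i) (Sum.inl i) + X (Sum.inr (Sum.inr e)) (Sum.inr (Sum.inr e)) -
        2 * X (Sum.inl i) (Sum.inr (Sum.inr e)) =
      (3/4 : ℝ) * Lp i i + 2/3 + N' e e -
        2 * (Lp * ((1/4 : ℝ) • B1 + (1/2 : ℝ) • B2)) i e := by
  have hLs : L_Gᵀ = L_G := by
    rw [hL, hD, hA]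
    simp only [transpose_sub, transpose_add, transpose_mul, transpose_transpose]
    rw [add_comm (B2 * B1ᵀ)]
  have hLps : Lpᵀ = Lp := hLpsymm
  -- the projection onto constants
  obtain ⟨M, hM⟩ : ∃ M, M = 1 - L_G * Lp := ⟨_, rfl⟩
  have hMs : Mᵀ = M := by
    rw [hM, transpose_sub, transpose_mul, hLs, hLps, transpose_one, hLp3]
  have hLM : L_G * M = 0 := by
    rw [hM, mul_sub, mul_one, hLp3, ← mul_assoc, hLp1, sub_self]
  have hcol : ∀ k j j', M j k = M j' k := by
    intro k j j'
    obtain ⟨c, hc⟩ := hconn (fun a => M a k) (by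
      funext a
      exact congrFun (congrFun hLM a) k)
    exact (hc j).trans (hc j').symm
  have hrow : ∀ j k k', M j k = M j k' := by
    intro j k k'
    rw [← hMs]
    exact hcol j k k'
  obtain ⟨c, hc⟩ : ∃ c : V → ℝ, c = (1/3 : ℝ) • Pi.single (tail e) 1
      + (2/3 : ℝ) • Pi.single (head e) 1 := ⟨_, rfl⟩
  have hMc : M *ᵥ (Pi.single i 1 - c) = 0 := by
    funext j
    rw [hc]
    simp only [mulVec_sub, mulVec_add, mulVec_smul, mulVec_single_one, Pi.sub_apply,
      Pi.add_apply, Pi.smul_apply, smul_eq_mul, Pi.zero_apply, col_apply]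
    rw [hrow j i (tail e), hrow j (head e) (tail e)]
    ring
  have hproj : L_G *ᵥ (Lp *ᵥ (Pi.single i 1 - c)) = Pi.single i 1 - c := by
    rw [hM, sub_mulVec, one_mulVec, sub_eq_zero] at hMc
    rw [mulVec_mulVec]
    exact hMc.symm
  obtain ⟨z, hz⟩ : ∃ z : V → ℝ, z = (3/4 : ℝ) • (Lp *ᵥ (Pi.single i 1 - c)) := ⟨_, rfl⟩
  have hLz : L_G *ᵥ z = (3/4 : ℝ) • (Pi.single i 1 - c) := by
    rw [hz, mulVec_smul, hproj]
  have hB1t : ∀ x : V → ℝ, B1ᵀ *ᵥ x = fun f => x (tail f) := by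
    intro x
    funext f
    simp [hB1, mulVec, dotProduct]
  have hB2t : ∀ x : V → ℝ, B2ᵀ *ᵥ x = fun f => x (head f) := by
    intro x
    funext f
    simp [hB2, mulVec, dotProduct]
  have hB1e : B1 *ᵥ Pi.single e 1 = Pi.single (tail e) 1 := by
    funext a
    simp [hB1, Pi.single_apply]
  have hB2e : B2 *ᵥ Pi.single e 1 = Pi.single (head e) 1 := by
    funext a
    simp [hB2, Pi.single_apply]
  obtain ⟨t, ht⟩ : ∃ t, t = B1ᵀ *ᵥ z := ⟨_, rfl⟩
  obtain ⟨h, hh⟩ : ∃ h, h = B2ᵀ *ᵥ z := ⟨_, rfl⟩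
  have hDz : D_G *ᵥ z = B1 *ᵥ t + B2 *ᵥ h := by
    rw [hD, add_mulVec, ← mulVec_mulVec, ← mulVec_mulVec, ht, hh]
  have hAz : A_G *ᵥ z = B1 *ᵥ h + B2 *ᵥ t := by
    rw [hA, add_mulVec, ← mulVec_mulVec, ← mulVec_mulVec, ht, hh]
  have hLz2 : (B1 *ᵥ t + B2 *ᵥ h) - (B1 *ᵥ h + B2 *ᵥ t)
      = (3/4 : ℝ) • (Pi.single i 1 - c) := by
    rw [← hLz, hL, sub_mulVec, hDz, hAz]
  obtain ⟨y1, hy1⟩ : ∃ y1 : E → ℝ, y1 = (2/3 : ℝ) • t + (1/3 : ℝ) • h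
      - (1/3 : ℝ) • Pi.single e 1 := ⟨_, rfl⟩
  obtain ⟨y2, hy2⟩ : ∃ y2 : E → ℝ, y2 = (1/3 : ℝ) • t + (2/3 : ℝ) • h
      - (2/3 : ℝ) • Pi.single e 1 := ⟨_, rfl⟩
  obtain ⟨y, hy⟩ : ∃ y : V ⊕ E ⊕ E → ℝ, y = Sum.elim z (Sum.elim y1 y2) := ⟨_, rfl⟩
  obtain ⟨w, hw⟩ : ∃ w : V ⊕ E ⊕ E → ℝ,
    w = Pi.single (Sum.inl i) 1 - Pi.single (Sum.inr (Sum.inr e)) 1 := ⟨_, rfl⟩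
  have hLy : L_Q *ᵥ y = w := by
    rw [hLQ, hy, fromBlocks_mulVec]
    simp only [Sum.elim_comp_inl, Sum.elim_comp_inr]
    rw [fromBlocks_mulVec, fromRows_mulVec, fromCols_mulVec]
    simp only [Sum.elim_comp_inl, Sum.elim_comp_inr, neg_mulVec, smul_mulVec, one_mulVec,
      sub_mulVec, hDz, hAz, ← ht, ← hh]
    funext a
    rcases a with a | a | a
    · have h1 := congrFun hLz2 a
      simp only [hy1, hy2, hw, hc, mulVec_sub, mulVec_add, mulVec_smul, hB1e, hB2e, Sum.elim_inl,
        Pi.sub_apply, Pi.add_apply, Pi.smul_apply, smul_eq_mul, Pi.neg_apply] at h1 ⊢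
      have h2 : (Pi.single (Sum.inl i) 1 : V ⊕ E ⊕ E → ℝ) (Sum.inl a)
          = (Pi.single i 1 : V → ℝ) a := by
        simp [Pi.single_apply]
      have h3 : (Pi.single (Sum.inr (Sum.inr e)) 1 : V ⊕ E ⊕ E → ℝ) (Sum.inl a) = 0 := by
        simp [Pi.single_apply]
      rw [h2, h3]
      linarith
    · simp [hy1, hy2, hw, Pi.single_apply]
      split_ifs <;> ring
    · simp [hy1, hy2, hw, Pi.single_apply]
      split_ifs <;> ring
  have hLQs : L_Qᵀ = L_Q := by
    rw [hLQ, fromBlocks_transpose, fromBlocks_transpose, transpose_fromRows, transpose_fromCols]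
    have hDs : D_Gᵀ = D_G := by rw [hD]; simp
    have hAs : A_Gᵀ = A_G := by rw [hA]; simp [add_comm]
    simp [hDs, hAs]
  have key : w ⬝ᵥ (X *ᵥ w) = y ⬝ᵥ w := by
    have h1 : w ⬝ᵥ (X *ᵥ w) = y ⬝ᵥ ((L_Q * X * L_Q) *ᵥ y) := by
      rw [← mulVec_mulVec, ← mulVec_mulVec, hLy, dotProduct_mulVec y, ← mulVec_transpose,
        hLQs, hLy]
    rw [h1, hX, hLy]
  have hl : w ⬝ᵥ (X *ᵥ w) = X (Sum.inl i) (Sum.inl i)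
      + X (Sum.inr (Sum.inr e)) (Sum.inr (Sum.inr e))
      - 2 * X (Sum.inl i) (Sum.inr (Sum.inr e)) := by
    have hs := hXsymm.apply (Sum.inl i) (Sum.inr (Sum.inr e))
    rw [hw]
    simp only [mulVec_sub, sub_dotProduct, dotProduct_sub, mulVec_single_one,
      single_one_dotProduct, col_apply, hs]
    ring
  have hr : y ⬝ᵥ w = z i - y2 e := by
    rw [hw, hy]
    simp [dotProduct_sub]
  have hza : ∀ a, z a = 3/4 * (Lp a i - 1/3 * Lp a (tail e) - 2/3 * Lp a (head e)) := by
    intro a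
    rw [hz, hc]
    simp only [mulVec_sub, mulVec_add, mulVec_smul, mulVec_single_one, Pi.sub_apply,
      Pi.add_apply, Pi.smul_apply, smul_eq_mul, col_apply]
    ring
  have hLB1 : ∀ a, (Lp * B1) a e = Lp a (tail e) := by
    intro a
    simp [hB1, mul_apply]
  have hLB2 : ∀ a, (Lp * B2) a e = Lp a (head e) := by
    intro a
    simp [hB2, mul_apply]
  have hT1 : ∀ Y : Matrix V E ℝ, (B1ᵀ * Y) e e = Y (tail e) e := by
    intro Y
    simp [hB1, mul_apply]
  have hT2 : ∀ Y : Matrix V E ℝ, (B2ᵀ * Y) e e = Y (head e) e := by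
    intro Y
    simp [hB2, mul_apply]
  rw [← hl, key, hr, hy2, ht, hh, hB1t, hB2t, hN', Matrix.mul_assoc]
  simp only [Pi.sub_apply, Pi.add_apply, Pi.smul_apply, smul_eq_mul, Pi.single_eq_same,
    Matrix.add_mul, Matrix.mul_add, Matrix.smul_mul, Matrix.mul_smul, Matrix.add_apply,
    Matrix.smul_apply, hT1, hT2, hLB1, hLB2, hza]
  rw [hLpsymm.apply i (tail e), hLpsymm.apply i (head e)]
  ring
end

section
/- For all edges e, f ∈ E, the resistance distance in Q(G) between the path vertices u_{e1} ∈ V1 and u_{f2} ∈ V2 satisfies r_{u_{e1},u_{f2}}(Q(G)) = 4/3 + P_{ee} + N'_{ff} − 2·((1/3)I_m + Q)_{ef}. -/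
open Matrix

theorem quad_resistance_V1_V2
    {V E : Type} [Fintype V] [Fintype E] [DecidableEq V] [DecidableEq E]
    [Nonempty V] [Nonempty E]
    (tail head : E → V)
    (hloop : ∀ e, tail e ≠ head e)
    (hsimple : ∀ e f, e ≠ f →
      ¬(tail e = tail f ∧ head e = head f) ∧ ¬(tail e = head f ∧ head e = tail f))
    (B1 B2 : Matrix V E ℝ)
    (hB1 : B1 = Matrix.of fun i e => if i = tail e then (1 : ℝ) else 0)
    (hB2 : B2 = Matrix.of fun i e => if i = head e then (1 : ℝ) else 0)
    (D_G A_G L_G : Matrix V V ℝ)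
    (hD : D_G = B1 * B1ᵀ + B2 * B2ᵀ)
    (hA : A_G = B1 * B2ᵀ + B2 * B1ᵀ)
    (hL : L_G = D_G - A_G)
    (hconn : ∀ x : V → ℝ, L_G.mulVec x = 0 → ∃ c, ∀ i, x i = c)
    (Lp : Matrix V V ℝ)
    (hLp1 : L_G * Lp * L_G = L_G)
    (hLp2 : Lp * L_G * Lp = Lp)
    (hLp3 : L_G * Lp = Lp * L_G)
    (hLpsymm : Lp.IsSymm)
    (L_Q : Matrix (V ⊕ E ⊕ E) (V ⊕ E ⊕ E) ℝ)
    (hLQ : L_Q = Matrix.fromBlocks ((2 : ℝ) • D_G - A_G)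
      (Matrix.fromCols (-B1) (-B2))
      (Matrix.fromRows (-B1ᵀ) (-B2ᵀ))
      (Matrix.fromBlocks ((2 : ℝ) • (1 : Matrix E E ℝ)) (-(1 : Matrix E E ℝ))
        (-(1 : Matrix E E ℝ)) ((2 : ℝ) • (1 : Matrix E E ℝ))))
    (P Q N' : Matrix E E ℝ)
    (hP : P = ((1/2 : ℝ) • B1ᵀ + (1/4 : ℝ) • B2ᵀ) * Lp * ((2/3 : ℝ) • B1 + (1/3 : ℝ) • B2))
    (hQ : Q = ((1/2 : ℝ) • B1ᵀ + (1/4 : ℝ) • B2ᵀ) * Lp * ((1/3 : ℝ) • B1 + (2/3 : ℝ) • B2))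
    (hN' : N' = ((1/4 : ℝ) • B1ᵀ + (1/2 : ℝ) • B2ᵀ) * Lp * ((1/3 : ℝ) • B1 + (2/3 : ℝ) • B2))
    (e f : E)
    (X : Matrix (V ⊕ E ⊕ E) (V ⊕ E ⊕ E) ℝ)
    (hXsymm : X.IsSymm)
    (hX : L_Q * X * L_Q = L_Q)
    :
    X (Sum.inr (Sum.inl e)) (Sum.inr (Sum.inl e)) +
        X (Sum.inr (Sum.inr f)) (Sum.inr (Sum.inr f)) -
        2 * X (Sum.inr (Sum.inl e)) (Sum.inr (Sum.inr f)) =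
      4/3 + P e e + N' f f - 2 * ((1/3 : ℝ) • (1 : Matrix E E ℝ) + Q) e f := by
  classical
  have hc1 : ∀ g, B1 *ᵥ Pi.single g 1 = Pi.single (tail g) 1 := by
    intro g; ext i; simp [hB1, Pi.single_apply]
  have hc2 : ∀ g, B2 *ᵥ Pi.single g 1 = Pi.single (head g) 1 := by
    intro g; ext i; simp [hB2, Pi.single_apply]
  have ht1 : ∀ (v : V → ℝ) g, (B1ᵀ *ᵥ v) g = v (tail g) := by
    intro v g; simp [hB1, Matrix.mulVec, dotProduct]
  have ht2 : ∀ (v : V → ℝ) g, (B2ᵀ *ᵥ v) g = v (head g) := by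
    intro v g; simp [hB2, Matrix.mulVec, dotProduct]
  have e11 : ∀ g h, (B1ᵀ * Lp * B1) g h = Lp (tail g) (tail h) := by
    intro g h; simp [hB1, Matrix.mul_apply]
  have e12 : ∀ g h, (B1ᵀ * Lp * B2) g h = Lp (tail g) (head h) := by
    intro g h; simp [hB1, hB2, Matrix.mul_apply]
  have e21 : ∀ g h, (B2ᵀ * Lp * B1) g h = Lp (head g) (tail h) := by
    intro g h; simp [hB1, hB2, Matrix.mul_apply]
  have e22 : ∀ g h, (B2ᵀ * Lp * B2) g h = Lp (head g) (head h) := by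
    intro g h; simp [hB2, Matrix.mul_apply]
  have hLsymm : L_Gᵀ = L_G := by
    rw [hL, hD, hA]
    simp only [transpose_sub, transpose_add, transpose_mul, transpose_transpose]
    abel
  have hproj : ∀ z : V → ℝ, ∑ i, z i = 0 → L_G *ᵥ (Lp *ᵥ z) = z := by
    intro z hz
    have hK0 : L_G * (1 - L_G * Lp) = 0 := by
      rw [hLp3, mul_sub, mul_one, ← mul_assoc, hLp1, sub_self]
    have hKs : (1 - L_G * Lp)ᵀ = 1 - L_G * Lp := by
      rw [transpose_sub, transpose_mul, hLsymm, hLpsymm.eq, transpose_one, hLp3]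
    have hKz : (1 - L_G * Lp) *ᵥ z = 0 := by
      ext i
      obtain ⟨c, hc⟩ := hconn (fun k => (1 - L_G * Lp) k i) (by
        ext j
        exact congrFun (congrFun hK0 j) i)
      have : ∀ j, (1 - L_G * Lp) i j = c := fun j => by
        rw [← hc j]; exact (congrFun (congrFun hKs i) j).symm
      simp only [Matrix.mulVec, dotProduct, this, ← Finset.mul_sum, hz]
      simp
    rw [sub_mulVec, one_mulVec, sub_eq_zero, ← mulVec_mulVec] at hKz
    exact hKz.symm
  obtain ⟨w, hw⟩ : ∃ w : V → ℝ, w = (2/3 : ℝ) • Pi.single (tail e) 1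
      + (1/3 : ℝ) • Pi.single (head e) 1 - (1/3 : ℝ) • Pi.single (tail f) 1
      - (2/3 : ℝ) • Pi.single (head f) 1 := ⟨_, rfl⟩
  have hw0 : ∑ i, w i = 0 := by
    simp [hw, Finset.sum_add_distrib, Finset.sum_sub_distrib, ← Finset.mul_sum]
  obtain ⟨v, hv⟩ : ∃ v : V → ℝ, v = (3/4 : ℝ) • (Lp *ᵥ w) := ⟨_, rfl⟩
  have hLv : L_G *ᵥ v = (3/4 : ℝ) • w := by
    rw [hv, mulVec_smul, hproj w hw0]
  have hvi : ∀ i, v i = 3/4 * (2/3 * Lp i (tail e) + 1/3 * Lp i (head e)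
      - 1/3 * Lp i (tail f) - 2/3 * Lp i (head f)) := by
    intro i
    rw [hv, hw]
    simp [mulVec_add, mulVec_sub, mulVec_smul]
  obtain ⟨y1, hy1⟩ : ∃ y : E → ℝ, y = (2/3 : ℝ) • Pi.single e 1 - (1/3 : ℝ) • Pi.single f 1
      + (2/3 : ℝ) • (B1ᵀ *ᵥ v) + (1/3 : ℝ) • (B2ᵀ *ᵥ v) := ⟨_, rfl⟩
  obtain ⟨y2, hy2⟩ : ∃ y : E → ℝ, y = (1/3 : ℝ) • Pi.single e 1 - (2/3 : ℝ) • Pi.single f 1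
      + (1/3 : ℝ) • (B1ᵀ *ᵥ v) + (2/3 : ℝ) • (B2ᵀ *ᵥ v) := ⟨_, rfl⟩
  obtain ⟨y, hy⟩ : ∃ y : V ⊕ E ⊕ E → ℝ, y = Sum.elim v (Sum.elim y1 y2) := ⟨_, rfl⟩
  obtain ⟨c, hc⟩ : ∃ c : V ⊕ E ⊕ E → ℝ, c = Pi.single (Sum.inr (Sum.inl e)) 1
      - Pi.single (Sum.inr (Sum.inr f)) 1 := ⟨_, rfl⟩
  have hLy : L_Q *ᵥ y = c := by
    have hV : ((2 : ℝ) • D_G - A_G) *ᵥ v - B1 *ᵥ y1 - B2 *ᵥ y2 = 0 := by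
      rw [hL, hD, hA] at hLv
      have h4 : (4/3 : ℝ) • ((B1 * B1ᵀ + B2 * B2ᵀ - (B1 * B2ᵀ + B2 * B1ᵀ)) *ᵥ v) = w := by
        rw [hLv, smul_smul]; norm_num
      ext i
      have h5 := congrFun h4 i
      rw [hw] at h5
      rw [hy1, hy2, hD, hA]
      simp only [mulVec_add, mulVec_sub, mulVec_smul, hc1, hc2, sub_mulVec, add_mulVec,
        smul_mulVec, ← mulVec_mulVec, Pi.add_apply, Pi.sub_apply, Pi.smul_apply, smul_eq_mul,
        Pi.zero_apply] at h5 ⊢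
      linarith
    rw [hLQ, hy, fromBlocks_mulVec]
    ext i
    rcases i with i | i | i
    · have := congrFun hV i
      simp [hc, fromCols_mulVec, neg_mulVec] at this ⊢
      linarith
    · simp [hc, fromRows_mulVec, fromBlocks_mulVec, neg_mulVec, smul_mulVec, hy1, hy2,
        Pi.single_apply]
      split_ifs <;> ring
    · simp [hc, fromRows_mulVec, fromBlocks_mulVec, neg_mulVec, smul_mulVec, hy1, hy2,
        Pi.single_apply]
      split_ifs <;> ring
  have hLQs : L_Qᵀ = L_Q := by
    have hDs : D_Gᵀ = D_G := by simp [hD]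
    have hAs : A_Gᵀ = A_G := by simp [hA, add_comm]
    rw [hLQ, fromBlocks_transpose, fromBlocks_transpose, transpose_fromCols, transpose_fromRows]
    simp [hDs, hAs]
  have hmain : c ⬝ᵥ (X *ᵥ c) = y ⬝ᵥ c := by
    have h1 : c ⬝ᵥ (X *ᵥ c) = y ⬝ᵥ (L_Q *ᵥ (X *ᵥ c)) := by
      rw [dotProduct_mulVec y, ← mulVec_transpose, hLQs, hLy]
    rw [h1]
    conv_lhs => rw [← hLy]
    rw [mulVec_mulVec, mulVec_mulVec, hX, hLy]
  have hl : c ⬝ᵥ (X *ᵥ c) = X (Sum.inr (Sum.inl e)) (Sum.inr (Sum.inl e)) +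
        X (Sum.inr (Sum.inr f)) (Sum.inr (Sum.inr f)) -
        2 * X (Sum.inr (Sum.inl e)) (Sum.inr (Sum.inr f)) := by
    have := hXsymm.apply (Sum.inr (Sum.inl e)) (Sum.inr (Sum.inr f))
    rw [hc]
    simp [sub_dotProduct, mulVec_sub]
    linarith
  have hr : y ⬝ᵥ c = y1 e - y2 f := by
    rw [hc, hy]; simp [dotProduct_sub]
  rw [← hl, hmain, hr, hP, hQ, hN', hy1, hy2]
  simp only [Matrix.add_mul, Matrix.mul_add, Matrix.smul_mul, Matrix.mul_smul, Matrix.add_apply,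
    Matrix.smul_apply, e11, e12, e21, e22, Pi.add_apply, Pi.sub_apply, Pi.smul_apply, smul_eq_mul,
    ht1, ht2, hvi, Pi.single_apply, Matrix.one_apply, smul_add, eq_comm (a := f) (b := e)]
  rw [hLpsymm.apply (tail e) (head e), hLpsymm.apply (tail e) (tail f),
    hLpsymm.apply (tail e) (head f), hLpsymm.apply (head e) (tail f),
    hLpsymm.apply (head e) (head f), hLpsymm.apply (tail f) (head f)]
  simp only [if_true]
  ring
end

section
/- For all distinct edges e, f ∈ E, the resistance distance in Q(G) between the path vertices u_{e1} ∈ V1 and u_{f1} ∈ V1 satisfies r_{u_{e1},u_{f1}}(Q(G)) = 4/3 + P_{ee} + P_{ff} − 2·P_{ef}. -/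
open Matrix

theorem quad_resistance_V1_V1
    {V E : Type} [Fintype V] [Fintype E] [DecidableEq V] [DecidableEq E]
    [Nonempty V] [Nonempty E]
    (tail head : E → V)
    (hloop : ∀ e, tail e ≠ head e)
    (hsimple : ∀ e f, e ≠ f →
      ¬(tail e = tail f ∧ head e = head f) ∧ ¬(tail e = head f ∧ head e = tail f))
    (B1 B2 : Matrix V E ℝ)
    (hB1 : B1 = Matrix.of fun i e => if i = tail e then (1 : ℝ) else 0)
    (hB2 : B2 = Matrix.of fun i e => if i = head e then (1 : ℝ) else 0)
    (D_G A_G L_G : Matrix V V ℝ)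
    (hD : D_G = B1 * B1ᵀ + B2 * B2ᵀ)
    (hA : A_G = B1 * B2ᵀ + B2 * B1ᵀ)
    (hL : L_G = D_G - A_G)
    (hconn : ∀ x : V → ℝ, L_G.mulVec x = 0 → ∃ c, ∀ i, x i = c)
    (Lp : Matrix V V ℝ)
    (hLp1 : L_G * Lp * L_G = L_G)
    (hLp2 : Lp * L_G * Lp = Lp)
    (hLp3 : L_G * Lp = Lp * L_G)
    (hLpsymm : Lp.IsSymm)
    (L_Q : Matrix (V ⊕ E ⊕ E) (V ⊕ E ⊕ E) ℝ)
    (hLQ : L_Q = Matrix.fromBlocks ((2 : ℝ) • D_G - A_G)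
      (Matrix.fromCols (-B1) (-B2))
      (Matrix.fromRows (-B1ᵀ) (-B2ᵀ))
      (Matrix.fromBlocks ((2 : ℝ) • (1 : Matrix E E ℝ)) (-(1 : Matrix E E ℝ))
        (-(1 : Matrix E E ℝ)) ((2 : ℝ) • (1 : Matrix E E ℝ))))
    (P Q N' : Matrix E E ℝ)
    (hP : P = ((1/2 : ℝ) • B1ᵀ + (1/4 : ℝ) • B2ᵀ) * Lp * ((2/3 : ℝ) • B1 + (1/3 : ℝ) • B2))
    (hQ : Q = ((1/2 : ℝ) • B1ᵀ + (1/4 : ℝ) • B2ᵀ) * Lp * ((1/3 : ℝ) • B1 + (2/3 : ℝ) • B2))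
    (hN' : N' = ((1/4 : ℝ) • B1ᵀ + (1/2 : ℝ) • B2ᵀ) * Lp * ((1/3 : ℝ) • B1 + (2/3 : ℝ) • B2))
    (e f : E) (hef : e ≠ f)
    (X : Matrix (V ⊕ E ⊕ E) (V ⊕ E ⊕ E) ℝ)
    (hXsymm : X.IsSymm)
    (hX : L_Q * X * L_Q = L_Q)
    :
    X (Sum.inr (Sum.inl e)) (Sum.inr (Sum.inl e)) +
        X (Sum.inr (Sum.inl f)) (Sum.inr (Sum.inl f)) -
        2 * X (Sum.inr (Sum.inl e)) (Sum.inr (Sum.inl f)) =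
      4/3 + P e e + P f f - 2 * P e f := by
  set δ : E → ℝ := Pi.single e 1 - Pi.single f 1 with hδ
  set M : Matrix V E ℝ := (2/3 : ℝ) • B1 + (1/3 : ℝ) • B2 with hM
  set w : V → ℝ := M *ᵥ δ with hw
  have hB1s : ∀ e, ∑ i, B1 i e = 1 := by intro e; simp [hB1]
  have hB2s : ∀ e, ∑ i, B2 i e = 1 := by intro e; simp [hB2]
  have hMs : (1 : V → ℝ) ᵥ* M = 1 := by
    funext j
    simp only [Matrix.vecMul, dotProduct, hM, Pi.one_apply, one_mul, Matrix.add_apply,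
      Matrix.smul_apply, smul_eq_mul, Finset.sum_add_distrib, ← Finset.mul_sum, hB1s, hB2s]
    norm_num
  have hB1v : (1 : V → ℝ) ᵥ* B1 = 1 := by
    funext j; simp [Matrix.vecMul, dotProduct, hB1s]
  have hB2v : (1 : V → ℝ) ᵥ* B2 = 1 := by
    funext j; simp [Matrix.vecMul, dotProduct, hB2s]
  have hLs : (1 : V → ℝ) ᵥ* L_G = 0 := by
    rw [hL, hD, hA]
    simp only [Matrix.vecMul_sub, Matrix.vecMul_add, ← Matrix.vecMul_vecMul, hB1v, hB2v]
    abel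
  have hws : (1 : V → ℝ) ⬝ᵥ w = 0 := by
    rw [hw, Matrix.dotProduct_mulVec, hMs, hδ]
    simp
  have hLw : L_G *ᵥ (Lp *ᵥ w) = w := by
    obtain ⟨c, hc⟩ := hconn (w - L_G *ᵥ (Lp *ᵥ w)) (by
      rw [Matrix.mulVec_sub, Matrix.mulVec_mulVec w L_G Lp, hLp3, Matrix.mulVec_mulVec w L_G (Lp * L_G),
        ← Matrix.mul_assoc, hLp1, sub_self])
    have h0 : (1 : V → ℝ) ⬝ᵥ (w - L_G *ᵥ (Lp *ᵥ w)) = 0 := by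
      rw [dotProduct_sub, hws, Matrix.dotProduct_mulVec, hLs]; simp
    have h1 : (1 : V → ℝ) ⬝ᵥ (w - L_G *ᵥ (Lp *ᵥ w)) = Fintype.card V * c := by
      rw [dotProduct, Finset.sum_congr rfl (fun i _ => by rw [hc i])]
      simp
    have hc0 : c = 0 := by
      have : (Fintype.card V : ℝ) ≠ 0 := by exact_mod_cast Fintype.card_ne_zero
      rw [h1] at h0
      exact (mul_eq_zero.mp h0).resolve_left this
    funext i
    have := hc i
    rw [hc0, Pi.sub_apply] at this
    linarith
  set v : V → ℝ := (3/4 : ℝ) • (Lp *ᵥ w) with hv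
  have hLv : L_G *ᵥ v = (3/4 : ℝ) • w := by rw [hv, Matrix.mulVec_smul, hLw]
  set y1 : E → ℝ := (2/3 : ℝ) • (δ + B1ᵀ *ᵥ v) + (1/3 : ℝ) • (B2ᵀ *ᵥ v) with hy1
  set y2 : E → ℝ := (1/3 : ℝ) • (δ + B1ᵀ *ᵥ v) + (2/3 : ℝ) • (B2ᵀ *ᵥ v) with hy2
  set z : V ⊕ E ⊕ E → ℝ := Sum.elim v (Sum.elim y1 y2) with hz
  set b : V ⊕ E ⊕ E → ℝ := Sum.elim 0 (Sum.elim δ 0) with hb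
  have hzb : L_Q *ᵥ z = b := by
    rw [hLQ, hz, hb, Matrix.fromBlocks_mulVec]
    simp only [Sum.elim_comp_inl, Sum.elim_comp_inr, Matrix.fromBlocks_mulVec,
      Matrix.fromCols_mulVec, Matrix.fromRows_mulVec]
    have hw' := hw
    rw [hM] at hw'
    rw [hL, hD, hA] at hLv
    simp only [Matrix.sub_mulVec, Matrix.add_mulVec, ← Matrix.mulVec_mulVec,
      Matrix.smul_mulVec] at hLv hw'
    funext i
    rcases i with i | i | i
    · have h1 := congrFun hLv i
      have h2 := congrFun hw' i
      simp only [hD, hA, hy1, hy2, Matrix.sub_mulVec, Matrix.add_mulVec, Matrix.neg_mulVec,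
        ← Matrix.mulVec_mulVec, Matrix.smul_mulVec, Matrix.mulVec_add, Matrix.mulVec_smul,
        Sum.elim_inl, Pi.add_apply, Pi.sub_apply, Pi.neg_apply, Pi.smul_apply, smul_eq_mul,
        Pi.zero_apply] at h1 h2 ⊢
      linarith
    · simp [hy1, hy2, Matrix.neg_mulVec, Matrix.smul_mulVec]
      ring
    · simp [hy1, hy2, Matrix.neg_mulVec, Matrix.smul_mulVec]
      ring
  have hLQs : L_Qᵀ = L_Q := by
    rw [hLQ, hD, hA]
    simp only [Matrix.fromBlocks_transpose, Matrix.transpose_fromCols, Matrix.transpose_fromRows,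
      Matrix.transpose_sub, Matrix.transpose_add, Matrix.transpose_smul, Matrix.transpose_mul,
      Matrix.transpose_neg, Matrix.transpose_transpose, Matrix.transpose_one]
    rw [add_comm (B2 * B1ᵀ)]
  have key : b ⬝ᵥ (X *ᵥ b) = z ⬝ᵥ b := by
    have h1 : b ᵥ* X ᵥ* L_Q = b := by
      conv_lhs => rw [← hzb, ← Matrix.vecMul_transpose, hLQs]
      rw [Matrix.vecMul_vecMul, Matrix.vecMul_vecMul, ← Matrix.mul_assoc, hX, ← hzb]
      conv_rhs => rw [← Matrix.vecMul_transpose, hLQs]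
    calc b ⬝ᵥ (X *ᵥ b) = (b ᵥ* X) ⬝ᵥ (L_Q *ᵥ z) := by rw [hzb, Matrix.dotProduct_mulVec]
      _ = b ⬝ᵥ z := by rw [Matrix.dotProduct_mulVec, h1]
      _ = z ⬝ᵥ b := dotProduct_comm _ _
  have hb' : b = Pi.single (Sum.inr (Sum.inl e)) 1 - Pi.single (Sum.inr (Sum.inl f)) 1 := by
    funext i
    rcases i with i | i | i <;> simp [hb, hδ, Pi.single_apply]
  have hXs := hXsymm.apply (Sum.inr (Sum.inl e)) (Sum.inr (Sum.inl f))
  have hPm : P = (3/4 : ℝ) • (Mᵀ * Lp * M) := by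
    rw [hP, hM, ← Matrix.smul_mul, ← Matrix.smul_mul]
    congr 2
    simp only [Matrix.transpose_add, Matrix.transpose_smul, smul_add, smul_smul]
    norm_num
  have hPs : P f e = P e f := by
    have : Pᵀ = P := by
      rw [hPm]
      simp only [Matrix.transpose_smul, Matrix.transpose_mul, Matrix.transpose_transpose,
        hLpsymm.eq, Matrix.mul_assoc]
    exact congrFun (congrFun this e) f
  have hy : y1 = (2/3 : ℝ) • δ + P *ᵥ δ := by
    have h2 : P *ᵥ δ = Mᵀ *ᵥ v := by
      rw [hPm, hv, hw, Matrix.smul_mulVec, Matrix.mulVec_smul]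
      simp only [Matrix.mulVec_mulVec, Matrix.mul_assoc]
    rw [h2, hy1, hM]
    simp only [Matrix.transpose_add, Matrix.transpose_smul, Matrix.add_mulVec, Matrix.smul_mulVec,
      smul_add]
    abel
  have hl : b ⬝ᵥ (X *ᵥ b) = X (Sum.inr (Sum.inl e)) (Sum.inr (Sum.inl e)) +
        X (Sum.inr (Sum.inl f)) (Sum.inr (Sum.inl f)) -
        2 * X (Sum.inr (Sum.inl e)) (Sum.inr (Sum.inl f)) := by
    rw [hb']
    simp [Matrix.mulVec_sub]
    linarith
  have hr : z ⬝ᵥ b = 4/3 + P e e + P f f - 2 * P e f := by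
    rw [hb', dotProduct_sub, dotProduct_single, dotProduct_single, hz]
    simp only [Sum.elim_inl, Sum.elim_inr]
    rw [hy, hδ]
    simp [Matrix.mulVec_sub, hef, hef.symm]
    linarith
  rw [← hl, key, hr]
end

section
/- For all distinct edges e, f ∈ E, the resistance distance in Q(G) between the path vertices u_{e2} ∈ V2 and u_{f2} ∈ V2 satisfies r_{u_{e2},u_{f2}}(Q(G)) = 4/3 + N'_{ee} + N'_{ff} − 2·N'_{ef}. -/
open Matrix

theorem quad_resistance_V2_V2
    {V E : Type} [Fintype V] [Fintype E] [DecidableEq V] [DecidableEq E]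
    [Nonempty V] [Nonempty E]
    (tail head : E → V)
    (hloop : ∀ e, tail e ≠ head e)
    (hsimple : ∀ e f, e ≠ f →
      ¬(tail e = tail f ∧ head e = head f) ∧ ¬(tail e = head f ∧ head e = tail f))
    (B1 B2 : Matrix V E ℝ)
    (hB1 : B1 = Matrix.of fun i e => if i = tail e then (1 : ℝ) else 0)
    (hB2 : B2 = Matrix.of fun i e => if i = head e then (1 : ℝ) else 0)
    (D_G A_G L_G : Matrix V V ℝ)
    (hD : D_G = B1 * B1ᵀ + B2 * B2ᵀ)
    (hA : A_G = B1 * B2ᵀ + B2 * B1ᵀ)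
    (hL : L_G = D_G - A_G)
    (hconn : ∀ x : V → ℝ, L_G.mulVec x = 0 → ∃ c, ∀ i, x i = c)
    (Lp : Matrix V V ℝ)
    (hLp1 : L_G * Lp * L_G = L_G)
    (hLp2 : Lp * L_G * Lp = Lp)
    (hLp3 : L_G * Lp = Lp * L_G)
    (hLpsymm : Lp.IsSymm)
    (L_Q : Matrix (V ⊕ E ⊕ E) (V ⊕ E ⊕ E) ℝ)
    (hLQ : L_Q = Matrix.fromBlocks ((2 : ℝ) • D_G - A_G)
      (Matrix.fromCols (-B1) (-B2))
      (Matrix.fromRows (-B1ᵀ) (-B2ᵀ))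
      (Matrix.fromBlocks ((2 : ℝ) • (1 : Matrix E E ℝ)) (-(1 : Matrix E E ℝ))
        (-(1 : Matrix E E ℝ)) ((2 : ℝ) • (1 : Matrix E E ℝ))))
    (P Q N' : Matrix E E ℝ)
    (hP : P = ((1/2 : ℝ) • B1ᵀ + (1/4 : ℝ) • B2ᵀ) * Lp * ((2/3 : ℝ) • B1 + (1/3 : ℝ) • B2))
    (hQ : Q = ((1/2 : ℝ) • B1ᵀ + (1/4 : ℝ) • B2ᵀ) * Lp * ((1/3 : ℝ) • B1 + (2/3 : ℝ) • B2))
    (hN' : N' = ((1/4 : ℝ) • B1ᵀ + (1/2 : ℝ) • B2ᵀ) * Lp * ((1/3 : ℝ) • B1 + (2/3 : ℝ) • B2))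
    (e f : E) (hef : e ≠ f)
    (X : Matrix (V ⊕ E ⊕ E) (V ⊕ E ⊕ E) ℝ)
    (hXsymm : X.IsSymm)
    (hX : L_Q * X * L_Q = L_Q)
    :
    X (Sum.inr (Sum.inr e)) (Sum.inr (Sum.inr e)) +
        X (Sum.inr (Sum.inr f)) (Sum.inr (Sum.inr f)) -
        2 * X (Sum.inr (Sum.inr e)) (Sum.inr (Sum.inr f)) =
      4/3 + N' e e + N' f f - 2 * N' e f := by
  classical
  set d : E → ℝ := Pi.single e 1 - Pi.single f 1 with hd
  set w : V → ℝ := (1/3 : ℝ) • (B1 *ᵥ d) + (2/3 : ℝ) • (B2 *ᵥ d) with hw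
  have hone1 : (1 : V → ℝ) ᵥ* B1 = 1 := by
    subst hB1; ext e; simp [Matrix.vecMul, dotProduct]
  have hone2 : (1 : V → ℝ) ᵥ* B2 = 1 := by
    subst hB2; ext e; simp [Matrix.vecMul, dotProduct]
  have honeL : (1 : V → ℝ) ᵥ* L_G = 0 := by
    rw [hL, hD, hA]
    simp only [Matrix.vecMul_sub, Matrix.vecMul_add, ← Matrix.vecMul_vecMul, hone1, hone2]
    abel
  have hdsum : (1 : E → ℝ) ⬝ᵥ d = 0 := by
    simp [hd, dotProduct_sub]
  have hwsum : (1 : V → ℝ) ⬝ᵥ w = 0 := by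
    simp only [hw, dotProduct_add, dotProduct_smul, Matrix.dotProduct_mulVec, hone1, hone2, hdsum]
    simp
  have hproj : L_G *ᵥ (Lp *ᵥ w) = w := by
    have hk : L_G *ᵥ (w - L_G *ᵥ (Lp *ᵥ w)) = 0 := by
      rw [Matrix.mulVec_sub, Matrix.mulVec_mulVec, Matrix.mulVec_mulVec, Matrix.mul_assoc, hLp3,
        ← Matrix.mul_assoc, hLp1, sub_self]
    obtain ⟨c, hc⟩ := hconn _ hk
    have hs : (1 : V → ℝ) ⬝ᵥ (w - L_G *ᵥ (Lp *ᵥ w)) = 0 := by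
      rw [dotProduct_sub, hwsum, Matrix.dotProduct_mulVec, honeL]
      simp
    have hfun : w - L_G *ᵥ (Lp *ᵥ w) = fun _ => c := funext hc
    rw [hfun] at hs
    have hc0 : c = 0 := by
      simpa [dotProduct] using hs
    rw [hc0] at hfun
    exact (sub_eq_zero.mp hfun).symm
  set p : V → ℝ := (3/4 : ℝ) • (Lp *ᵥ w) with hp
  have hLp' : L_G *ᵥ p = (3/4 : ℝ) • w := by rw [hp, Matrix.mulVec_smul, hproj]
  set y1 : E → ℝ := (1/3 : ℝ) • (d + (2:ℝ) • (B1ᵀ *ᵥ p) + B2ᵀ *ᵥ p) with hy1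
  set y2 : E → ℝ := (1/3 : ℝ) • ((2:ℝ) • d + B1ᵀ *ᵥ p + (2:ℝ) • (B2ᵀ *ᵥ p)) with hy2
  set y : V ⊕ E ⊕ E → ℝ := Sum.elim p (Sum.elim y1 y2) with hy
  set b : V ⊕ E ⊕ E → ℝ := Sum.elim 0 (Sum.elim 0 d) with hb
  have hLy : L_Q *ᵥ y = b := by
    rw [hLQ, hy, hb, Matrix.fromBlocks_mulVec]
    simp only [Sum.elim_comp_inl, Sum.elim_comp_inr, Matrix.fromCols_mulVec_sumElim,
      Matrix.fromRows_mulVec, Matrix.fromBlocks_mulVec]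
    have h1 : ((2 : ℝ) • D_G - A_G) *ᵥ p + (-B1 *ᵥ y1 + -B2 *ᵥ y2) = 0 := by
      rw [hL, hD, hA, hw] at hLp'
      rw [hD, hA, hy1, hy2]
      simp only [Matrix.sub_mulVec, Matrix.add_mulVec, Matrix.smul_mulVec, Matrix.neg_mulVec,
        Matrix.mulVec_add, Matrix.mulVec_smul, ← Matrix.mulVec_mulVec] at hLp' ⊢
      linear_combination (norm := module) (4/3 : ℝ) • hLp'
    rw [h1]
    congr 1
    funext i
    rcases i with i | i
    · simp [hy1, hy2, Matrix.neg_mulVec, Matrix.smul_mulVec]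
      ring
    · simp [hy1, hy2, Matrix.neg_mulVec, Matrix.smul_mulVec]
      ring
  have hLQs : L_Qᵀ = L_Q := by
    have hDs : D_Gᵀ = D_G := by rw [hD]; simp [Matrix.transpose_mul]
    have hAs : A_Gᵀ = A_G := by rw [hA]; simp [Matrix.transpose_mul, add_comm]
    rw [hLQ]
    simp [Matrix.fromBlocks_transpose, Matrix.transpose_fromCols, Matrix.transpose_fromRows, hDs, hAs]
  have hyL : y ᵥ* L_Q = b := by rw [← hLy, ← Matrix.vecMul_transpose, hLQs]
  have key : b ⬝ᵥ (X *ᵥ b) = y ⬝ᵥ b := by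
    calc b ⬝ᵥ (X *ᵥ b) = (y ᵥ* L_Q) ⬝ᵥ (X *ᵥ (L_Q *ᵥ y)) := by rw [hyL, hLy]
      _ = y ⬝ᵥ ((L_Q * X * L_Q) *ᵥ y) := by
        rw [← Matrix.dotProduct_mulVec, Matrix.mulVec_mulVec, Matrix.mulVec_mulVec, Matrix.mul_assoc]
      _ = y ⬝ᵥ b := by rw [hX, hLy]
  have hb' : b = Pi.single (Sum.inr (Sum.inr e)) 1 - Pi.single (Sum.inr (Sum.inr f)) 1 := by
    funext i
    rcases i with i | i | i <;> simp [hb, hd, Pi.single_apply]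
  have hl : b ⬝ᵥ (X *ᵥ b) = X (Sum.inr (Sum.inr e)) (Sum.inr (Sum.inr e)) +
        X (Sum.inr (Sum.inr f)) (Sum.inr (Sum.inr f)) -
        2 * X (Sum.inr (Sum.inr e)) (Sum.inr (Sum.inr f)) := by
    have hs := hXsymm.apply (Sum.inr (Sum.inr e)) (Sum.inr (Sum.inr f))
    rw [hb']
    simp [Matrix.mulVec_sub, sub_dotProduct]
    linarith
  have hNd : N' *ᵥ d = (3/4 : ℝ) • ((1/3 : ℝ) • (B1ᵀ *ᵥ (Lp *ᵥ w)) + (2/3 : ℝ) • (B2ᵀ *ᵥ (Lp *ᵥ w))) := by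
    rw [hN', hw]
    simp only [← Matrix.mulVec_mulVec, Matrix.add_mulVec, Matrix.smul_mulVec]
    module
  have hy2' : y2 = (2/3 : ℝ) • d + N' *ᵥ d := by
    rw [hNd, hy2, hp]
    simp only [Matrix.mulVec_smul]
    module
  have hNs : N' f e = N' e f := by
    have : N'ᵀ = N' := by
      have e1 : ((1/4 : ℝ) • B1ᵀ + (1/2 : ℝ) • B2ᵀ) = (3/4 : ℝ) • ((1/3 : ℝ) • B1 + (2/3 : ℝ) • B2)ᵀ := by
        simp only [Matrix.transpose_add, Matrix.transpose_smul]
        module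
      rw [hN', e1]
      simp only [Matrix.smul_mul, Matrix.transpose_smul, Matrix.transpose_mul,
        Matrix.transpose_transpose, hLpsymm.eq, Matrix.mul_assoc]
    exact congrFun (congrFun this e) f
  have hr : y ⬝ᵥ b = 4/3 + N' e e + N' f f - 2 * N' e f := by
    have : y ⬝ᵥ b = y2 e - y2 f := by
      rw [hb', dotProduct_sub]
      simp [hy]
    rw [this, hy2']
    have hfe := hef.symm
    simp [hd, Matrix.mulVec_sub, hef, hfe]
    linarith
  rw [← hl, key, hr]
end

section
/- The Kirchhoff index of the quadrilateral graph satisfies Kf(Q(G)) = (n + 2m)·( (3/(4n))·Kf(G) + (5/12)·(tr(B1ᵀ·L_G^#·B1) + tr(B2ᵀ·L_G^#·B2)) + (1/3)·(tr(B1ᵀ·L_G^#·B2) + tr(B2ᵀ·L_G^#·B1)) + 4m/3 ) − (3/4)·1ᵀ·(B1 + B2)ᵀ·L_G^#·(B1 + B2)·1 − 2m, where Kf(G) = n·tr(L_G^#). -/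
open Matrix

theorem qk_trace {V F : Type} [Fintype V] [Fintype F] (A : Matrix V V ℝ) (B : Matrix V F ℝ)
    (C : Matrix F V ℝ) (D : Matrix F F ℝ) :
    trace (fromBlocks A B C D) = trace A + trace D := by
  simp [trace]

theorem qk_uniq {ι : Type} [Fintype ι] [DecidableEq ι] (L X Y : Matrix ι ι ℝ) (c : ι → ℝ)
    (hX : L * X * L = L) (hY : L * Y * L = L) (hLs : Lᵀ = L) (hYs : Yᵀ = Y)
    (hK : Y * L = 1 - vecMulVec 1 c) :
    (Fintype.card ι : ℝ) * trace X - ∑ x, ∑ y, X x y =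
      (Fintype.card ι : ℝ) * trace Y - ∑ x, ∑ y, Y x y := by
  have hK' : L * Y = 1 - vecMulVec c 1 := by
    have := congrArg Matrix.transpose hK
    simpa [hLs, hYs, Matrix.transpose_vecMulVec] using this
  have h0 : (Y * L) * (X - Y) * (L * Y) = 0 := by
    have : (Y * L) * (X - Y) * (L * Y) = Y * (L * X * L) * Y - Y * (L * Y * L) * Y := by
      noncomm_ring
    rw [this, hX, hY, sub_self]
  rw [hK, hK'] at h0
  obtain ⟨u, a, hua⟩ : ∃ u a : ι → ℝ, ∀ i j, X i j - Y i j = u j + a i := by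
    set Z := X - Y with hZ
    refine ⟨c ᵥ* Z, fun i => (((1 - vecMulVec 1 c) * Z) *ᵥ c) i, fun i j => ?_⟩
    have h := congrFun (congrFun h0 i) j
    rw [mul_sub, mul_one, sub_mul, one_mul, Matrix.vecMulVec_mul, Matrix.mul_vecMulVec] at h
    rw [sub_mul, one_mul, Matrix.vecMulVec_mul]
    simp only [Matrix.sub_apply, vecMulVec_apply, Pi.one_apply, one_mul, mul_one, Matrix.zero_apply] at h
    have : Z i j = X i j - Y i j := rfl
    linarith
  have hX' : ∀ i j, X i j = Y i j + (u j + a i) := fun i j => by linarith only [hua i j]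
  simp only [trace, diag_apply, hX', Finset.sum_add_distrib, Finset.sum_const, Finset.card_univ,
    nsmul_eq_mul, ← Finset.mul_sum]
  ring

theorem qk_block {V F : Type} [Fintype V] [Fintype F] [DecidableEq V] [DecidableEq F]
    (A T : Matrix V V ℝ) (B : Matrix V F ℝ) (M N : Matrix F F ℝ) (c : V → ℝ)
    (hMN : M * N = 1) (hTs : Tᵀ = T) (hMs : Mᵀ = M) (hNs : Nᵀ = N) (hAs : Aᵀ = A)
    (hS : T * (A - B * M * Bᵀ) = 1 - vecMulVec 1 c)
    (hA1 : A *ᵥ 1 = B *ᵥ 1) (hB1 : M *ᵥ (Bᵀ *ᵥ 1) = 1) (hT1 : T *ᵥ 1 = 0) (hM1 : M *ᵥ 1 = 1)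
    (X : Matrix (V ⊕ F) (V ⊕ F) ℝ)
    (hX : fromBlocks A (-B) (-Bᵀ) N * X * fromBlocks A (-B) (-Bᵀ) N
      = fromBlocks A (-B) (-Bᵀ) N) :
    (Fintype.card (V ⊕ F) : ℝ) * trace X - ∑ x, ∑ y, X x y =
      (Fintype.card (V ⊕ F) : ℝ) * (trace T + trace M + trace (M * M * (Bᵀ * T * B)))
        - Fintype.card F - ∑ e, ∑ f, (Bᵀ * T * B) e f := by
  have hNM : N * M = 1 := mul_eq_one_comm.mp hMN
  have hN1 : N *ᵥ 1 = (1 : F → ℝ) := by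
    conv_lhs => rw [← hM1]
    rw [mulVec_mulVec, hNM, one_mulVec]
  have hB1' : Bᵀ *ᵥ 1 = (1 : F → ℝ) := by
    have h := congrArg (fun v => N *ᵥ v) hB1
    simpa only [mulVec_mulVec, hN1, ← Matrix.mul_assoc, hNM, Matrix.one_mul] using h
  set L := fromBlocks A (-B) (-Bᵀ) N with hL
  set Y := fromBlocks T (T * B * M) (M * Bᵀ * T) (M + M * Bᵀ * T * B * M) with hY
  have hLs : Lᵀ = L := by
    rw [hL, fromBlocks_transpose]; simp [hNs, hAs]
  have hYs : Yᵀ = Y := by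
    rw [hY, fromBlocks_transpose]; simp [hMs, hTs, Matrix.mul_assoc]
  have hK : Y * L = 1 - vecMulVec 1 (Sum.elim c 0) := by
    have e : (1 : Matrix (V ⊕ F) (V ⊕ F) ℝ) - vecMulVec 1 (Sum.elim c 0) =
        fromBlocks (1 - vecMulVec 1 c) 0 (- vecMulVec 1 c) 1 := by
      ext i j
      rcases i with i | i <;> rcases j with j | j <;> simp [vecMulVec_apply, Matrix.one_apply]
    have h3 : M * Bᵀ * (T * (A - B * M * Bᵀ)) = M * Bᵀ - vecMulVec 1 c := by
      rw [hS, Matrix.mul_sub, Matrix.mul_one, mul_vecMulVec, ← mulVec_mulVec, hB1]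
    rw [e, hY, hL, fromBlocks_multiply]
    congr 1
    · rw [← hS]; simp only [Matrix.mul_assoc, Matrix.mul_add, Matrix.mul_neg, sub_eq_add_neg]
    · simp [Matrix.mul_assoc, hMN]
    · rw [neg_eq_iff_eq_neg.mpr (show vecMulVec 1 c = -(M * Bᵀ * (T * (A - B * M * Bᵀ)) - M * Bᵀ) by
        rw [h3]; simp)]
      simp only [Matrix.mul_assoc, Matrix.mul_sub, Matrix.add_mul, Matrix.mul_neg]
      abel
    · simp [Matrix.mul_assoc, hMN, Matrix.add_mul]
  have hL1 : L *ᵥ 1 = 0 := by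
    have : (1 : V ⊕ F → ℝ) = Sum.elim (1 : V → ℝ) (1 : F → ℝ) := by ext i; rcases i <;> rfl
    rw [this, hL, fromBlocks_mulVec]
    simp [neg_mulVec, hA1, hN1, hB1']
  have hY1 : L * Y * L = L := by
    rw [Matrix.mul_assoc, hK, mul_sub, mul_one, mul_vecMulVec, hL1, zero_vecMulVec, sub_zero]
  rw [qk_uniq L X Y _ hX hY1 hLs hYs hK]
  have htr : trace Y = trace T + trace M + trace (M * M * (Bᵀ * T * B)) := by
    rw [hY, qk_trace, trace_add, add_assoc]
    congr 2
    rw [trace_mul_comm]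
    simp only [Matrix.mul_assoc]
  have hsum : ∑ x, ∑ y, Y x y = Fintype.card F + ∑ e, ∑ f, (Bᵀ * T * B) e f := by
    have h1 : ∀ {ι κ : Type} [Fintype ι] [Fintype κ] (W : Matrix ι κ ℝ),
        ∑ x, ∑ y, W x y = 1 ⬝ᵥ (W *ᵥ 1) := by
      intro ι κ _ _ W
      simp [dotProduct, mulVec]
    have hM1' : (1 : F → ℝ) ᵥ* M = 1 := by rw [← mulVec_transpose, hMs, hM1]
    have hT1' : (1 : V → ℝ) ᵥ* T = 0 := by rw [← mulVec_transpose, hTs, hT1]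
    have : (1 : V ⊕ F → ℝ) = Sum.elim (1 : V → ℝ) (1 : F → ℝ) := by ext i; rcases i <;> rfl
    rw [h1, h1, this, hY, fromBlocks_mulVec]
    simp only [Sum.elim_comp_inl, Sum.elim_comp_inr, sumElim_dotProduct_sumElim, dotProduct_add,
      add_mulVec, Matrix.mul_assoc, ← mulVec_mulVec, hM1, hT1, mulVec_zero, dotProduct_zero]
    simp only [dotProduct_mulVec, hT1', hM1', zero_vecMul, zero_dotProduct]
    simp [dotProduct]
  rw [htr, hsum]; ring

theorem quad_kirchhoff
    {V E : Type} [Fintype V] [Fintype E] [DecidableEq V] [DecidableEq E]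
    [Nonempty V] [Nonempty E]
    (tail head : E → V)
    (hloop : ∀ e, tail e ≠ head e)
    (hsimple : ∀ e f, e ≠ f →
      ¬(tail e = tail f ∧ head e = head f) ∧ ¬(tail e = head f ∧ head e = tail f))
    (B1 B2 : Matrix V E ℝ)
    (hB1 : B1 = Matrix.of fun i e => if i = tail e then (1 : ℝ) else 0)
    (hB2 : B2 = Matrix.of fun i e => if i = head e then (1 : ℝ) else 0)
    (D_G A_G L_G : Matrix V V ℝ)
    (hD : D_G = B1 * B1ᵀ + B2 * B2ᵀ)
    (hA : A_G = B1 * B2ᵀ + B2 * B1ᵀ)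
    (hL : L_G = D_G - A_G)
    (hconn : ∀ x : V → ℝ, L_G.mulVec x = 0 → ∃ c, ∀ i, x i = c)
    (Lp : Matrix V V ℝ)
    (hLp1 : L_G * Lp * L_G = L_G)
    (hLp2 : Lp * L_G * Lp = Lp)
    (hLp3 : L_G * Lp = Lp * L_G)
    (hLpsymm : Lp.IsSymm)
    (L_Q : Matrix (V ⊕ E ⊕ E) (V ⊕ E ⊕ E) ℝ)
    (hLQ : L_Q = Matrix.fromBlocks ((2 : ℝ) • D_G - A_G)
      (Matrix.fromCols (-B1) (-B2))
      (Matrix.fromRows (-B1ᵀ) (-B2ᵀ))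
      (Matrix.fromBlocks ((2 : ℝ) • (1 : Matrix E E ℝ)) (-(1 : Matrix E E ℝ))
        (-(1 : Matrix E E ℝ)) ((2 : ℝ) • (1 : Matrix E E ℝ))))
    (X : Matrix (V ⊕ E ⊕ E) (V ⊕ E ⊕ E) ℝ)
    (hXsymm : X.IsSymm)
    (hX : L_Q * X * L_Q = L_Q)
    :
    ((Fintype.card V : ℝ) + 2 * (Fintype.card E : ℝ)) * Matrix.trace X -
        ∑ x, ∑ y, X x y =
      ((Fintype.card V : ℝ) + 2 * (Fintype.card E : ℝ)) *
          ((3 / (4 * (Fintype.card V : ℝ))) * ((Fintype.card V : ℝ) * Matrix.trace Lp) +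
            (5/12 : ℝ) * (Matrix.trace (B1ᵀ * Lp * B1) + Matrix.trace (B2ᵀ * Lp * B2)) +
            (1/3 : ℝ) * (Matrix.trace (B1ᵀ * Lp * B2) + Matrix.trace (B2ᵀ * Lp * B1)) +
            4 * (Fintype.card E : ℝ) / 3) -
        (3/4 : ℝ) * ∑ e, ∑ f, ((B1 + B2)ᵀ * Lp * (B1 + B2)) e f -
        2 * (Fintype.card E : ℝ) := by
  have hb1 : B1ᵀ *ᵥ 1 = (1 : E → ℝ) := by
    ext e; simp [hB1, mulVec, dotProduct]
  have hb2 : B2ᵀ *ᵥ 1 = (1 : E → ℝ) := by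
    ext e; simp [hB2, mulVec, dotProduct]
  have hDs : D_Gᵀ = D_G := by rw [hD]; simp
  have hAs : A_Gᵀ = A_G := by rw [hA]; simp [add_comm]
  have hLs : L_Gᵀ = L_G := by rw [hL]; simp [hDs, hAs]
  have hD1 : D_G *ᵥ 1 = B1 *ᵥ 1 + B2 *ᵥ 1 := by
    rw [hD, add_mulVec, ← mulVec_mulVec, ← mulVec_mulVec, hb1, hb2]
  have hA1 : A_G *ᵥ 1 = B1 *ᵥ 1 + B2 *ᵥ 1 := by
    rw [hA, add_mulVec, ← mulVec_mulVec, ← mulVec_mulVec, hb1, hb2]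
  have hL1 : L_G *ᵥ 1 = 0 := by rw [hL, sub_mulVec, hD1, hA1, sub_self]
  have hLp1' : Lp *ᵥ 1 = 0 := by
    rw [← hLp2, Matrix.mul_assoc, hLp3, ← mulVec_mulVec, ← mulVec_mulVec, hL1]; simp
  obtain ⟨c, hc⟩ : ∃ c : V → ℝ, Lp * L_G = 1 - vecMulVec 1 c := by
    have h : ∀ j, ∃ c, ∀ i, (1 - Lp * L_G) i j = c := by
      intro j
      refine hconn (fun i => (1 - Lp * L_G) i j) ?_
      have h0 : L_G * (1 - Lp * L_G) = 0 := by
        rw [mul_sub, mul_one, ← Matrix.mul_assoc, hLp1, sub_self]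
      ext i
      exact congrFun (congrFun h0 i) j
    choose c hc using h
    refine ⟨c, ?_⟩
    rw [eq_sub_iff_add_eq, ← eq_sub_iff_add_eq']
    ext i j
    simp [hc, vecMulVec_apply]
  set M : Matrix (E ⊕ E) (E ⊕ E) ℝ := fromBlocks ((2/3 : ℝ) • 1) ((1/3 : ℝ) • 1)
    ((1/3 : ℝ) • 1) ((2/3 : ℝ) • 1) with hM
  set N : Matrix (E ⊕ E) (E ⊕ E) ℝ := fromBlocks ((2 : ℝ) • 1) (-1) (-1) ((2 : ℝ) • 1) with hN
  have hMN : M * N = 1 := by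
    rw [hM, hN, fromBlocks_multiply, ← fromBlocks_one]
    congr 1 <;> simp [smul_smul, ← sub_eq_add_neg] <;> simp only [← add_smul, ← sub_smul, ← neg_smul] <;> norm_num
  have hone : (1 : E ⊕ E → ℝ) = Sum.elim (1 : E → ℝ) (1 : E → ℝ) := by ext i; rcases i <;> rfl
  have hM1 : M *ᵥ 1 = 1 := by
    rw [hone, hM, fromBlocks_mulVec]
    ext i; rcases i <;> simp [smul_mulVec] <;> norm_num
  have hBT : (fromCols B1 B2)ᵀ = fromRows B1ᵀ B2ᵀ := transpose_fromCols _ _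
  have hBB1 : (fromCols B1 B2)ᵀ *ᵥ 1 = (1 : E ⊕ E → ℝ) := by
    rw [hBT, fromRows_mulVec, hb1, hb2, hone]
  have hLQ' : L_Q = fromBlocks ((2 : ℝ) • D_G - A_G) (-(fromCols B1 B2)) (-(fromCols B1 B2)ᵀ) N := by
    rw [hLQ, hBT, fromCols_neg, fromRows_neg]
  have hBMB : fromCols B1 B2 * M * (fromCols B1 B2)ᵀ = (2/3 : ℝ) • D_G + (1/3 : ℝ) • A_G := by
    rw [hBT, hM, fromCols_mul_fromBlocks, fromCols_mul_fromRows, hD, hA]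
    simp [Matrix.add_mul]
    abel
  have key := qk_block ((2 : ℝ) • D_G - A_G) ((3/4 : ℝ) • Lp) (fromCols B1 B2) M N c hMN
    (by rw [transpose_smul, hLpsymm]) (by rw [hM, fromBlocks_transpose]; simp)
    (by rw [hN, fromBlocks_transpose]; simp) (by simp [hDs, hAs])
    (by
      rw [hBMB, ← hc, hL]
      have : (2 : ℝ) • D_G - A_G - ((2/3 : ℝ) • D_G + (1/3 : ℝ) • A_G) = (4/3 : ℝ) • (D_G - A_G) := by
        module
      rw [this, Matrix.smul_mul, Matrix.mul_smul, smul_smul]; norm_num)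
    (by
      rw [sub_mulVec, smul_mulVec, hD1, hA1, hone, fromCols_mulVec]
      simp only [Sum.elim_comp_inl, Sum.elim_comp_inr]
      module)
    (by rw [hBB1, hM1]) (by rw [smul_mulVec, hLp1', smul_zero]) hM1 X (by rw [← hLQ', hX])
  have hcard : (Fintype.card (V ⊕ E ⊕ E) : ℝ) = Fintype.card V + 2 * Fintype.card E := by
    simp only [Fintype.card_sum]; push_cast; ring
  have hcard' : (Fintype.card (E ⊕ E) : ℝ) = 2 * Fintype.card E := by
    simp only [Fintype.card_sum]; push_cast; ring
  have hBLB : (fromCols B1 B2)ᵀ * ((3/4 : ℝ) • Lp) * fromCols B1 B2 =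
      (3/4 : ℝ) • fromBlocks (B1ᵀ * Lp * B1) (B1ᵀ * Lp * B2) (B2ᵀ * Lp * B1) (B2ᵀ * Lp * B2) := by
    rw [hBT, Matrix.mul_smul, Matrix.smul_mul, fromRows_mul, fromRows_mul_fromCols]
  have hMM : M * M = fromBlocks ((5/9 : ℝ) • 1) ((4/9 : ℝ) • 1) ((4/9 : ℝ) • 1) ((5/9 : ℝ) • 1) := by
    rw [hM, fromBlocks_multiply]
    congr 1 <;> simp only [Matrix.smul_mul, Matrix.mul_smul, one_mul, smul_smul, ← add_smul] <;> norm_num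
  have ht : trace (M * M * ((fromCols B1 B2)ᵀ * ((3/4 : ℝ) • Lp) * fromCols B1 B2)) =
      (5/12 : ℝ) * (Matrix.trace (B1ᵀ * Lp * B1) + Matrix.trace (B2ᵀ * Lp * B2)) +
            (1/3 : ℝ) * (Matrix.trace (B1ᵀ * Lp * B2) + Matrix.trace (B2ᵀ * Lp * B1)) := by
    rw [hBLB, hMM, Matrix.mul_smul, trace_smul, fromBlocks_multiply, qk_trace]
    simp only [Matrix.smul_mul, Matrix.one_mul, trace_add, trace_smul, smul_eq_mul]
    ring
  have htM : trace M = 4 * (Fintype.card E : ℝ) / 3 := by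
    rw [hM, qk_trace]
    simp only [trace_smul, trace_one, smul_eq_mul]
    ring
  have hs : ∑ e, ∑ f, ((fromCols B1 B2)ᵀ * ((3/4 : ℝ) • Lp) * fromCols B1 B2) e f =
      (3/4 : ℝ) * ∑ e, ∑ f, ((B1 + B2)ᵀ * Lp * (B1 + B2)) e f := by
    rw [hBLB, transpose_add, Matrix.add_mul, Matrix.add_mul, Matrix.mul_add, Matrix.mul_add]
    simp only [Fintype.sum_sum_type, Matrix.smul_apply, Matrix.add_apply, fromBlocks_apply₁₁, fromBlocks_apply₁₂,
      fromBlocks_apply₂₁, fromBlocks_apply₂₂, smul_eq_mul, Finset.sum_add_distrib, ← Finset.mul_sum]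
    ring
  have hn : (Fintype.card V : ℝ) ≠ 0 := by exact_mod_cast Fintype.card_ne_zero
  have hn2 : (3 / (4 * (Fintype.card V : ℝ))) * ((Fintype.card V : ℝ) * Matrix.trace Lp)
      = 3 / 4 * trace Lp := by field_simp
  rw [hcard, hcard', ht, htM, hs, trace_smul, smul_eq_mul] at key
  rw [key, hn2]
  ring
end

section
/- The Schur complement of the lower-right block of L_{W(G)} equals (5/4)·L_G; explicitly, with D = [[2I_m, −I_m, 0], [−I_m, 2I_m, −I_m], [0, −I_m, 2I_m]] and B = [−B1, 0, −B2], one has (2D_G − A_G) − B·D⁻¹·Bᵀ = 2D_G − A_G − (3/4)·(B1·B1ᵀ + B2·B2ᵀ) − (1/4)·(B1·B2ᵀ + B2·B1ᵀ) = (5/4)·L_G. -/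
open Matrix

/-- The explicit inverse of the block-tridiagonal matrix `D`. -/
lemma pent_inv {E : Type} [Fintype E] [DecidableEq E] :
    (Matrix.fromBlocks ((2 : ℝ) • (1 : Matrix E E ℝ))
        (Matrix.fromCols (-(1 : Matrix E E ℝ)) (0 : Matrix E E ℝ))
        (Matrix.fromRows (-(1 : Matrix E E ℝ)) (0 : Matrix E E ℝ))
        (Matrix.fromBlocks ((2 : ℝ) • (1 : Matrix E E ℝ)) (-(1 : Matrix E E ℝ))
          (-(1 : Matrix E E ℝ)) ((2 : ℝ) • (1 : Matrix E E ℝ))))⁻¹ =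
    Matrix.fromBlocks ((3/4 : ℝ) • (1 : Matrix E E ℝ))
        (Matrix.fromCols ((1/2 : ℝ) • (1 : Matrix E E ℝ)) ((1/4 : ℝ) • (1 : Matrix E E ℝ)))
        (Matrix.fromRows ((1/2 : ℝ) • (1 : Matrix E E ℝ)) ((1/4 : ℝ) • (1 : Matrix E E ℝ)))
        (Matrix.fromBlocks (1 : Matrix E E ℝ) ((1/2 : ℝ) • (1 : Matrix E E ℝ))
          ((1/2 : ℝ) • (1 : Matrix E E ℝ)) ((3/4 : ℝ) • (1 : Matrix E E ℝ))) := by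
  apply Matrix.inv_eq_right_inv
  ext i j
  rcases i with i | i | i <;> rcases j with j | j | j <;>
    simp [Matrix.mul_apply, Fintype.sum_sum_type, Matrix.one_apply] <;>
    split_ifs <;> norm_num

theorem pent_schur_complement
    {V E : Type} [Fintype V] [Fintype E] [DecidableEq V] [DecidableEq E]
    [Nonempty V] [Nonempty E]
    (tail head : E → V)
    (hloop : ∀ e, tail e ≠ head e)
    (hsimple : ∀ e f, e ≠ f →
      ¬(tail e = tail f ∧ head e = head f) ∧ ¬(tail e = head f ∧ head e = tail f))
    (B1 B2 : Matrix V E ℝ)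
    (hB1 : B1 = Matrix.of fun i e => if i = tail e then (1 : ℝ) else 0)
    (hB2 : B2 = Matrix.of fun i e => if i = head e then (1 : ℝ) else 0)
    (D_G A_G L_G : Matrix V V ℝ)
    (hD : D_G = B1 * B1ᵀ + B2 * B2ᵀ)
    (hA : A_G = B1 * B2ᵀ + B2 * B1ᵀ)
    (hL : L_G = D_G - A_G)
    (hconn : ∀ x : V → ℝ, L_G.mulVec x = 0 → ∃ c, ∀ i, x i = c)
    :
    ((2 : ℝ) • D_G - A_G -
        Matrix.fromCols (-B1) (Matrix.fromCols (0 : Matrix V E ℝ) (-B2)) *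
          (Matrix.fromBlocks ((2 : ℝ) • (1 : Matrix E E ℝ))
              (Matrix.fromCols (-(1 : Matrix E E ℝ)) (0 : Matrix E E ℝ))
              (Matrix.fromRows (-(1 : Matrix E E ℝ)) (0 : Matrix E E ℝ))
              (Matrix.fromBlocks ((2 : ℝ) • (1 : Matrix E E ℝ)) (-(1 : Matrix E E ℝ))
                (-(1 : Matrix E E ℝ)) ((2 : ℝ) • (1 : Matrix E E ℝ))))⁻¹ *
          (Matrix.fromCols (-B1) (Matrix.fromCols (0 : Matrix V E ℝ) (-B2)))ᵀ =
      (2 : ℝ) • D_G - A_G - (3/4 : ℝ) • (B1 * B1ᵀ + B2 * B2ᵀ) -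
        (1/4 : ℝ) • (B1 * B2ᵀ + B2 * B1ᵀ)) ∧
    (2 : ℝ) • D_G - A_G - (3/4 : ℝ) • (B1 * B1ᵀ + B2 * B2ᵀ) -
        (1/4 : ℝ) • (B1 * B2ᵀ + B2 * B1ᵀ) = (5/4 : ℝ) • L_G := by
  constructor
  · rw [pent_inv, sub_sub _ ((3/4 : ℝ) • _)]
    congr 1
    ext i j
    simp only [Matrix.mul_apply, Fintype.sum_sum_type, Matrix.transpose_apply, Matrix.add_apply,
      Matrix.smul_apply, Matrix.fromCols_apply_inl, Matrix.fromCols_apply_inr,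
      Matrix.fromRows_apply_inl, Matrix.fromRows_apply_inr,
      Matrix.fromBlocks_apply₁₁, Matrix.fromBlocks_apply₁₂, Matrix.fromBlocks_apply₂₁,
      Matrix.fromBlocks_apply₂₂, Matrix.one_apply, Matrix.neg_apply, Matrix.zero_apply,
      smul_eq_mul, mul_ite, mul_one, mul_zero, zero_mul, Finset.sum_ite_eq', Finset.mem_univ,
      if_true, Finset.sum_const_zero, neg_zero, add_zero, zero_add]
    simp only [Finset.mul_sum, ← Finset.sum_add_distrib]
    refine Finset.sum_congr rfl fun e _ => ?_
    ring
  · rw [hL, hD, hA]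
    module
end

section
/- The block matrix N indexed by V ⊕ E ⊕ E ⊕ E with blocks N_{V,V} = (4/5)·L_G^#, N_{V,V1} = L_G^#·((3/5)B1 + (1/5)B2), N_{V,V2} = L_G^#·((2/5)B1 + (2/5)B2), N_{V,V3} = L_G^#·((1/5)B1 + (3/5)B2), N_{V1,V1} = (3/4)I_m + P1, N_{V1,V2} = (1/2)I_m + P2, N_{V1,V3} = (1/4)I_m + P3, N_{V2,V2} = I_m + Q2, N_{V2,V3} = (1/2)I_m + Q3, N_{V3,V3} = (3/4)I_m + R3, and the blocks below the diagonal the transposes of the corresponding blocks above, is a symmetric {1}-inverse of L_{W(G)}: N is symmetric and L_{W(G)}·N·L_{W(G)} = L_{W(G)}. -/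
open Matrix

theorem pent_general {V F : Type} [Fintype V] [Fintype F] [DecidableEq V] [DecidableEq F]
    (S T : Matrix V V ℝ) (H K : Matrix F F ℝ) (X : Matrix F V ℝ)
    (hS : S * T * S = S) (hH : H * K = 1) (hTs : Tᵀ = T) (hK : Kᵀ = K) :
    (fromBlocks T (T * Xᵀ) (X * T) (K + X * T * Xᵀ)).IsSymm ∧
    fromBlocks (S + Xᵀ * H * X) (-(Xᵀ * H)) (-(H * X)) H *
      fromBlocks T (T * Xᵀ) (X * T) (K + X * T * Xᵀ) *
      fromBlocks (S + Xᵀ * H * X) (-(Xᵀ * H)) (-(H * X)) H =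
    fromBlocks (S + Xᵀ * H * X) (-(Xᵀ * H)) (-(H * X)) H := by
  constructor
  · rw [IsSymm, fromBlocks_transpose]
    simp [hTs, hK, Matrix.mul_assoc]
  · have h1 : fromBlocks (S + Xᵀ * H * X) (-(Xᵀ * H)) (-(H * X)) H *
      fromBlocks T (T * Xᵀ) (X * T) (K + X * T * Xᵀ) =
      fromBlocks (S * T) (S * T * Xᵀ - Xᵀ) 0 1 := by
      rw [fromBlocks_multiply]
      congr 1
      · simp only [Matrix.add_mul, Matrix.neg_mul, Matrix.mul_assoc]; abel
      · simp only [Matrix.add_mul, Matrix.mul_add, Matrix.neg_mul, Matrix.mul_assoc, hH,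
          Matrix.mul_one]; abel
      · simp only [Matrix.neg_mul, Matrix.mul_assoc]; abel
      · simp only [Matrix.mul_add, Matrix.neg_mul, Matrix.mul_assoc, hH]; abel
    rw [h1, fromBlocks_multiply]
    congr 1
    · simp only [Matrix.mul_add, Matrix.sub_mul, Matrix.mul_neg, hS, ← Matrix.mul_assoc]; abel
    · simp only [Matrix.sub_mul, Matrix.mul_neg, ← Matrix.mul_assoc]; abel
    · simp
    · simp

theorem pent_one_inverse
    {V E : Type} [Fintype V] [Fintype E] [DecidableEq V] [DecidableEq E]
    [Nonempty V] [Nonempty E]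
    (tail head : E → V)
    (hloop : ∀ e, tail e ≠ head e)
    (hsimple : ∀ e f, e ≠ f →
      ¬(tail e = tail f ∧ head e = head f) ∧ ¬(tail e = head f ∧ head e = tail f))
    (B1 B2 : Matrix V E ℝ)
    (hB1 : B1 = Matrix.of fun i e => if i = tail e then (1 : ℝ) else 0)
    (hB2 : B2 = Matrix.of fun i e => if i = head e then (1 : ℝ) else 0)
    (D_G A_G L_G : Matrix V V ℝ)
    (hD : D_G = B1 * B1ᵀ + B2 * B2ᵀ)
    (hA : A_G = B1 * B2ᵀ + B2 * B1ᵀ)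
    (hL : L_G = D_G - A_G)
    (hconn : ∀ x : V → ℝ, L_G.mulVec x = 0 → ∃ c, ∀ i, x i = c)
    (Lp : Matrix V V ℝ)
    (hLp1 : L_G * Lp * L_G = L_G)
    (hLp2 : Lp * L_G * Lp = Lp)
    (hLp3 : L_G * Lp = Lp * L_G)
    (hLpsymm : Lp.IsSymm)
    (L_W : Matrix (V ⊕ E ⊕ E ⊕ E) (V ⊕ E ⊕ E ⊕ E) ℝ)
    (hLW : L_W = Matrix.fromBlocks ((2 : ℝ) • D_G - A_G)
      (Matrix.fromCols (-B1) (Matrix.fromCols (0 : Matrix V E ℝ) (-B2)))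
      (Matrix.fromRows (-B1ᵀ) (Matrix.fromRows (0 : Matrix E V ℝ) (-B2ᵀ)))
      (Matrix.fromBlocks ((2 : ℝ) • (1 : Matrix E E ℝ))
        (Matrix.fromCols (-(1 : Matrix E E ℝ)) (0 : Matrix E E ℝ))
        (Matrix.fromRows (-(1 : Matrix E E ℝ)) (0 : Matrix E E ℝ))
        (Matrix.fromBlocks ((2 : ℝ) • (1 : Matrix E E ℝ)) (-(1 : Matrix E E ℝ))
          (-(1 : Matrix E E ℝ)) ((2 : ℝ) • (1 : Matrix E E ℝ)))))
    (P1 P2 P3 Q2 Q3 R3 : Matrix E E ℝ)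
    (hP1 : P1 = ((3/5 : ℝ) • B1ᵀ + (1/5 : ℝ) • B2ᵀ) * Lp * ((3/4 : ℝ) • B1 + (1/4 : ℝ) • B2))
    (hP2 : P2 = ((3/5 : ℝ) • B1ᵀ + (1/5 : ℝ) • B2ᵀ) * Lp * ((1/2 : ℝ) • B1 + (1/2 : ℝ) • B2))
    (hP3 : P3 = ((3/5 : ℝ) • B1ᵀ + (1/5 : ℝ) • B2ᵀ) * Lp * ((1/4 : ℝ) • B1 + (3/4 : ℝ) • B2))
    (hQ2 : Q2 = ((2/5 : ℝ) • B1ᵀ + (2/5 : ℝ) • B2ᵀ) * Lp * ((1/2 : ℝ) • B1 + (1/2 : ℝ) • B2))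
    (hQ3 : Q3 = ((2/5 : ℝ) • B1ᵀ + (2/5 : ℝ) • B2ᵀ) * Lp * ((1/4 : ℝ) • B1 + (3/4 : ℝ) • B2))
    (hR3 : R3 = ((1/5 : ℝ) • B1ᵀ + (3/5 : ℝ) • B2ᵀ) * Lp * ((1/4 : ℝ) • B1 + (3/4 : ℝ) • B2))
    (N : Matrix (V ⊕ E ⊕ E ⊕ E) (V ⊕ E ⊕ E ⊕ E) ℝ)
    (hN : N = Matrix.fromBlocks ((4/5 : ℝ) • Lp)
      (Matrix.fromCols (Lp * ((3/5 : ℝ) • B1 + (1/5 : ℝ) • B2))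
        (Matrix.fromCols (Lp * ((2/5 : ℝ) • B1 + (2/5 : ℝ) • B2))
          (Lp * ((1/5 : ℝ) • B1 + (3/5 : ℝ) • B2))))
      (Matrix.fromRows (Lp * ((3/5 : ℝ) • B1 + (1/5 : ℝ) • B2))ᵀ
        (Matrix.fromRows (Lp * ((2/5 : ℝ) • B1 + (2/5 : ℝ) • B2))ᵀ
          (Lp * ((1/5 : ℝ) • B1 + (3/5 : ℝ) • B2))ᵀ))
      (Matrix.fromBlocks ((3/4 : ℝ) • (1 : Matrix E E ℝ) + P1)
        (Matrix.fromCols ((1/2 : ℝ) • (1 : Matrix E E ℝ) + P2)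
          ((1/4 : ℝ) • (1 : Matrix E E ℝ) + P3))
        (Matrix.fromRows ((1/2 : ℝ) • (1 : Matrix E E ℝ) + P2)ᵀ
          ((1/4 : ℝ) • (1 : Matrix E E ℝ) + P3)ᵀ)
        (Matrix.fromBlocks ((1 : Matrix E E ℝ) + Q2)
          ((1/2 : ℝ) • (1 : Matrix E E ℝ) + Q3)
          ((1/2 : ℝ) • (1 : Matrix E E ℝ) + Q3)ᵀ
          ((3/4 : ℝ) • (1 : Matrix E E ℝ) + R3))))
    :
    N.IsSymm ∧ L_W * N * L_W = L_W := by
  obtain ⟨X, hX⟩ : ∃ X, X = fromRows ((3/4 : ℝ) • B1ᵀ + (1/4 : ℝ) • B2ᵀ)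
    (fromRows ((1/2 : ℝ) • B1ᵀ + (1/2 : ℝ) • B2ᵀ) ((1/4 : ℝ) • B1ᵀ + (3/4 : ℝ) • B2ᵀ)) := ⟨_, rfl⟩
  obtain ⟨H, hH⟩ : ∃ H, H = (Matrix.fromBlocks ((2 : ℝ) • (1 : Matrix E E ℝ))
        (Matrix.fromCols (-(1 : Matrix E E ℝ)) (0 : Matrix E E ℝ))
        (Matrix.fromRows (-(1 : Matrix E E ℝ)) (0 : Matrix E E ℝ))
        (Matrix.fromBlocks ((2 : ℝ) • (1 : Matrix E E ℝ)) (-(1 : Matrix E E ℝ))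
          (-(1 : Matrix E E ℝ)) ((2 : ℝ) • (1 : Matrix E E ℝ)))) := ⟨_, rfl⟩
  obtain ⟨K, hK⟩ : ∃ K, K = (Matrix.fromBlocks ((3/4 : ℝ) • (1 : Matrix E E ℝ))
        (Matrix.fromCols ((1/2 : ℝ) • (1 : Matrix E E ℝ)) ((1/4 : ℝ) • (1 : Matrix E E ℝ)))
        (Matrix.fromRows ((1/2 : ℝ) • (1 : Matrix E E ℝ)) ((1/4 : ℝ) • (1 : Matrix E E ℝ)))
        (Matrix.fromBlocks (1 : Matrix E E ℝ) ((1/2 : ℝ) • (1 : Matrix E E ℝ))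
          ((1/2 : ℝ) • (1 : Matrix E E ℝ)) ((3/4 : ℝ) • (1 : Matrix E E ℝ)))) := ⟨_, rfl⟩
  have hXT : Xᵀ = fromCols ((3/4 : ℝ) • B1 + (1/4 : ℝ) • B2)
    (fromCols ((1/2 : ℝ) • B1 + (1/2 : ℝ) • B2) ((1/4 : ℝ) • B1 + (3/4 : ℝ) • B2)) := by
    rw [hX]; simp [transpose_fromRows]
  have hHX : H * X = fromRows B1ᵀ (fromRows 0 B2ᵀ) := by
    rw [hH, hX]
    simp only [fromBlocks_mul_fromRows, fromCols_mul_fromRows, fromRows_mul]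
    ext i j
    rcases i with i | i | i <;> simp <;> ring
  have hHs : Hᵀ = H := by
    rw [hH]; simp [fromBlocks_transpose, transpose_fromRows, transpose_fromCols]
  have hXH : Xᵀ * H = fromCols B1 (fromCols 0 B2) := by
    have := congrArg transpose hHX
    rw [transpose_mul, hHs] at this
    rw [this]; simp [transpose_fromRows]
  have hKs : Kᵀ = K := by
    rw [hK]; simp [fromBlocks_transpose, transpose_fromRows, transpose_fromCols]
  have hHK : H * K = 1 := by
    rw [hH, hK]
    simp only [fromBlocks_multiply, fromCols_mul_fromRows, fromRows_mul_fromCols, fromRows_mul,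
      mul_fromCols, fromCols_mul_fromBlocks, fromBlocks_mul_fromRows]
    ext i j
    rcases i with i | i | i <;> rcases j with j | j | j <;> simp [Matrix.one_apply] <;> grind
  have hLps : Lpᵀ = Lp := hLpsymm
  have hLWeq : L_W = fromBlocks ((5/4 : ℝ) • L_G + Xᵀ * H * X) (-(Xᵀ * H)) (-(H * X)) H := by
    rw [hXH, hHX, hLW, hH]
    congr 1
    · rw [hX, fromCols_mul_fromRows, fromCols_mul_fromRows, hL, hD, hA]
      simp only [Matrix.mul_add, Matrix.mul_smul, Matrix.zero_mul]
      module
    · ext i j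
      rcases j with j | j | j <;> simp
    · ext i j
      rcases i with i | i | i <;> simp
  have hNeq : N = fromBlocks ((4/5 : ℝ) • Lp) (((4/5 : ℝ) • Lp) * Xᵀ) (X * ((4/5 : ℝ) • Lp))
      (K + X * ((4/5 : ℝ) • Lp) * Xᵀ) := by
    rw [hN, hXT, hX, hK]
    congr 1
    · simp only [mul_fromCols, Matrix.mul_add, Matrix.mul_smul, Matrix.smul_mul, smul_smul, smul_add]
      ext i j
      rcases j with j | j | j <;> simp <;> ring
    · simp only [fromRows_mul, transpose_mul, transpose_add, transpose_smul, hLps, Matrix.add_mul,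
        Matrix.mul_smul, Matrix.smul_mul, smul_smul, smul_add]
      ext i j
      rcases i with i | i | i <;> simp <;> ring
    · simp only [hP1, hP2, hP3, hQ2, hQ3, hR3, fromRows_mul, mul_fromCols, transpose_mul,
        transpose_add, transpose_smul, transpose_transpose, transpose_one, hLps, Matrix.add_mul,
        Matrix.mul_add, Matrix.mul_smul, Matrix.smul_mul, smul_smul, smul_add, ← Matrix.mul_assoc]
      ext i j
      rcases i with i | i | i <;> rcases j with j | j | j <;> simp <;> ring
  rw [hNeq, hLWeq]
  apply pent_general _ _ _ _ _ _ hHK _ hKs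
  · simp only [Matrix.mul_smul, Matrix.smul_mul, smul_smul, hLp1]
    norm_num
  · simp [hLps]
end

section
/- For all vertices i, j ∈ V, the resistance distance in the pentagonal graph satisfies r_{ij}(W(G)) = (4/5)·((L_G^#)_{ii} + (L_G^#)_{jj} − 2·(L_G^#)_{ij}) = (4/5)·r_{ij}(G). -/
open Matrix

theorem pent_resistance_VV
    {V E : Type} [Fintype V] [Fintype E] [DecidableEq V] [DecidableEq E]
    [Nonempty V] [Nonempty E]
    (tail head : E → V)
    (hloop : ∀ e, tail e ≠ head e)
    (hsimple : ∀ e f, e ≠ f →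
      ¬(tail e = tail f ∧ head e = head f) ∧ ¬(tail e = head f ∧ head e = tail f))
    (B1 B2 : Matrix V E ℝ)
    (hB1 : B1 = Matrix.of fun i e => if i = tail e then (1 : ℝ) else 0)
    (hB2 : B2 = Matrix.of fun i e => if i = head e then (1 : ℝ) else 0)
    (D_G A_G L_G : Matrix V V ℝ)
    (hD : D_G = B1 * B1ᵀ + B2 * B2ᵀ)
    (hA : A_G = B1 * B2ᵀ + B2 * B1ᵀ)
    (hL : L_G = D_G - A_G)
    (hconn : ∀ x : V → ℝ, L_G.mulVec x = 0 → ∃ c, ∀ i, x i = c)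
    (Lp : Matrix V V ℝ)
    (hLp1 : L_G * Lp * L_G = L_G)
    (hLp2 : Lp * L_G * Lp = Lp)
    (hLp3 : L_G * Lp = Lp * L_G)
    (hLpsymm : Lp.IsSymm)
    (L_W : Matrix (V ⊕ E ⊕ E ⊕ E) (V ⊕ E ⊕ E ⊕ E) ℝ)
    (hLW : L_W = Matrix.fromBlocks ((2 : ℝ) • D_G - A_G)
      (Matrix.fromCols (-B1) (Matrix.fromCols (0 : Matrix V E ℝ) (-B2)))
      (Matrix.fromRows (-B1ᵀ) (Matrix.fromRows (0 : Matrix E V ℝ) (-B2ᵀ)))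
      (Matrix.fromBlocks ((2 : ℝ) • (1 : Matrix E E ℝ))
        (Matrix.fromCols (-(1 : Matrix E E ℝ)) (0 : Matrix E E ℝ))
        (Matrix.fromRows (-(1 : Matrix E E ℝ)) (0 : Matrix E E ℝ))
        (Matrix.fromBlocks ((2 : ℝ) • (1 : Matrix E E ℝ)) (-(1 : Matrix E E ℝ))
          (-(1 : Matrix E E ℝ)) ((2 : ℝ) • (1 : Matrix E E ℝ)))))
    (i j : V)
    (X : Matrix (V ⊕ E ⊕ E ⊕ E) (V ⊕ E ⊕ E ⊕ E) ℝ)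
    (hXsymm : X.IsSymm)
    (hX : L_W * X * L_W = L_W)
    :
    X (Sum.inl i) (Sum.inl i) + X (Sum.inl j) (Sum.inl j) -
        2 * X (Sum.inl i) (Sum.inl j) =
      (4/5 : ℝ) * (Lp i i + Lp j j - 2 * Lp i j) := by
  have hLsymm : L_Gᵀ = L_G := by
    subst hL hD hA
    simp [Matrix.transpose_sub, Matrix.transpose_add, Matrix.transpose_mul, add_comm]
  have hDsymm : D_Gᵀ = D_G := by
    subst hD
    simp [Matrix.transpose_add, Matrix.transpose_mul]
  have hAsymm : A_Gᵀ = A_G := by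
    subst hA
    simp [Matrix.transpose_add, Matrix.transpose_mul, add_comm]
  have hWsymm : L_Wᵀ = L_W := by
    subst hLW
    simp [Matrix.fromBlocks_transpose, Matrix.transpose_fromCols, Matrix.transpose_fromRows,
      hDsymm, hAsymm]
  set d : V → ℝ := Pi.single i 1 - Pi.single j 1 with hd
  -- the projection onto constants
  have hLd : L_G *ᵥ (Lp *ᵥ d) = d := by
    set P : Matrix V V ℝ := 1 - L_G * Lp with hP
    have hPs : Pᵀ = P := by
      rw [hP, Matrix.transpose_sub, Matrix.transpose_mul, hLsymm, hLpsymm.eq, hLp3]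
      simp
    have hLP : L_G * P = 0 := by
      rw [hP, Matrix.mul_sub, hLp3, ← Matrix.mul_assoc, hLp1]
      simp
    have hPd : P *ᵥ d = 0 := by
      have hcol : ∀ a b c, P a c = P b c := by
        intro a b c
        obtain ⟨k, hk⟩ := hconn (fun a => P a c) (by
          ext a
          exact congrFun (congrFun hLP a) c)
        rw [hk a, hk b]
      ext a
      rw [hd, Matrix.mulVec_sub]
      simp only [Matrix.mulVec_single_one, Pi.sub_apply, Matrix.col_apply, Pi.zero_apply]
      have h1 : P a i = P i a := congrFun (congrFun hPs i) a
      have h2 : P a j = P j a := congrFun (congrFun hPs j) a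
      rw [h1, h2, hcol i j a, sub_self]
    rw [hP, Matrix.sub_mulVec, Matrix.one_mulVec, sub_eq_zero] at hPd
    rw [Matrix.mulVec_mulVec, ← hPd]
  set x : V → ℝ := (4/5 : ℝ) • (Lp *ᵥ d) with hx
  set p : E → ℝ := B1ᵀ *ᵥ x with hp
  set q : E → ℝ := B2ᵀ *ᵥ x with hq
  set u : V ⊕ E ⊕ E ⊕ E → ℝ := Sum.elim x (Sum.elim ((3/4 : ℝ) • p + (1/4 : ℝ) • q)
    (Sum.elim ((1/2 : ℝ) • p + (1/2 : ℝ) • q) ((1/4 : ℝ) • p + (3/4 : ℝ) • q))) with hu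
  have hDx : D_G *ᵥ x = B1 *ᵥ p + B2 *ᵥ q := by
    rw [hD, Matrix.add_mulVec, hp, hq, Matrix.mulVec_mulVec, Matrix.mulVec_mulVec]
  have hAx : A_G *ᵥ x = B1 *ᵥ q + B2 *ᵥ p := by
    rw [hA, Matrix.add_mulVec, hp, hq, Matrix.mulVec_mulVec, Matrix.mulVec_mulVec]
  have hLx : D_G *ᵥ x - A_G *ᵥ x = (4/5 : ℝ) • d := by
    rw [← Matrix.sub_mulVec, ← hL, hx, Matrix.mulVec_smul, hLd]
  have hWu : L_W *ᵥ u = Sum.elim d 0 := by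
    rw [hLW, hu]
    ext a
    rcases a with a | a | a | a
    · have h := congrFun hLx a
      rw [hDx, hAx] at h
      simp [Matrix.fromBlocks_mulVec, Matrix.sub_mulVec, Matrix.smul_mulVec, Matrix.neg_mulVec,
        Matrix.mulVec_add, Matrix.mulVec_smul, hDx, hAx] at h ⊢
      linarith
    all_goals
      simp [Matrix.fromBlocks_mulVec, Matrix.smul_mulVec, Matrix.neg_mulVec, ← hp, ← hq]
      try ring
  have key : ∀ v w, (L_W *ᵥ v) ⬝ᵥ w = v ⬝ᵥ (L_W *ᵥ w) := by
    intro v w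
    rw [Matrix.dotProduct_mulVec, ← Matrix.mulVec_transpose, hWsymm]
  have hmain : (Sum.elim d 0 : V ⊕ E ⊕ E ⊕ E → ℝ) ⬝ᵥ (X *ᵥ Sum.elim d 0) = x ⬝ᵥ d := by
    rw [← hWu, key, Matrix.mulVec_mulVec, Matrix.mulVec_mulVec, hX, hWu, hu]
    simp
  have hb : (Sum.elim d 0 : V ⊕ E ⊕ E ⊕ E → ℝ)
      = Pi.single (Sum.inl i) 1 - Pi.single (Sum.inl j) 1 := by
    ext a
    rcases a with a | a <;> simp [hd, Pi.single_apply]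
  have hXij : X (Sum.inl j) (Sum.inl i) = X (Sum.inl i) (Sum.inl j) := hXsymm.apply _ _
  have hLij : Lp j i = Lp i j := hLpsymm.apply _ _
  rw [hb, hx, hd] at hmain
  simp [Matrix.mulVec_sub, sub_dotProduct, dotProduct_sub, hXij, hLij] at hmain
  linarith
end

section
/- For every vertex i ∈ V and every edge f ∈ E, the resistance distance in W(G) between i and the path vertex u_{f1} ∈ V1 satisfies r_{i,u_{f1}}(W(G)) = (4/5)·(L_G^#)_{ii} + 3/4 + (P1)_{ff} − 2·(L_G^#·((3/5)B1 + (1/5)B2))_{if}. -/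
open Matrix

theorem pent_resistance_V_V1
    {V E : Type} [Fintype V] [Fintype E] [DecidableEq V] [DecidableEq E]
    [Nonempty V] [Nonempty E]
    (tail head : E → V)
    (hloop : ∀ e, tail e ≠ head e)
    (hsimple : ∀ e f, e ≠ f →
      ¬(tail e = tail f ∧ head e = head f) ∧ ¬(tail e = head f ∧ head e = tail f))
    (B1 B2 : Matrix V E ℝ)
    (hB1 : B1 = Matrix.of fun i e => if i = tail e then (1 : ℝ) else 0)
    (hB2 : B2 = Matrix.of fun i e => if i = head e then (1 : ℝ) else 0)
    (D_G A_G L_G : Matrix V V ℝ)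
    (hD : D_G = B1 * B1ᵀ + B2 * B2ᵀ)
    (hA : A_G = B1 * B2ᵀ + B2 * B1ᵀ)
    (hL : L_G = D_G - A_G)
    (hconn : ∀ x : V → ℝ, L_G.mulVec x = 0 → ∃ c, ∀ i, x i = c)
    (Lp : Matrix V V ℝ)
    (hLp1 : L_G * Lp * L_G = L_G)
    (hLp2 : Lp * L_G * Lp = Lp)
    (hLp3 : L_G * Lp = Lp * L_G)
    (hLpsymm : Lp.IsSymm)
    (L_W : Matrix (V ⊕ E ⊕ E ⊕ E) (V ⊕ E ⊕ E ⊕ E) ℝ)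
    (hLW : L_W = Matrix.fromBlocks ((2 : ℝ) • D_G - A_G)
      (Matrix.fromCols (-B1) (Matrix.fromCols (0 : Matrix V E ℝ) (-B2)))
      (Matrix.fromRows (-B1ᵀ) (Matrix.fromRows (0 : Matrix E V ℝ) (-B2ᵀ)))
      (Matrix.fromBlocks ((2 : ℝ) • (1 : Matrix E E ℝ))
        (Matrix.fromCols (-(1 : Matrix E E ℝ)) (0 : Matrix E E ℝ))
        (Matrix.fromRows (-(1 : Matrix E E ℝ)) (0 : Matrix E E ℝ))
        (Matrix.fromBlocks ((2 : ℝ) • (1 : Matrix E E ℝ)) (-(1 : Matrix E E ℝ))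
          (-(1 : Matrix E E ℝ)) ((2 : ℝ) • (1 : Matrix E E ℝ)))))
    (P1 P2 P3 Q2 Q3 R3 : Matrix E E ℝ)
    (hP1 : P1 = ((3/5 : ℝ) • B1ᵀ + (1/5 : ℝ) • B2ᵀ) * Lp * ((3/4 : ℝ) • B1 + (1/4 : ℝ) • B2))
    (hP2 : P2 = ((3/5 : ℝ) • B1ᵀ + (1/5 : ℝ) • B2ᵀ) * Lp * ((1/2 : ℝ) • B1 + (1/2 : ℝ) • B2))
    (hP3 : P3 = ((3/5 : ℝ) • B1ᵀ + (1/5 : ℝ) • B2ᵀ) * Lp * ((1/4 : ℝ) • B1 + (3/4 : ℝ) • B2))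
    (hQ2 : Q2 = ((2/5 : ℝ) • B1ᵀ + (2/5 : ℝ) • B2ᵀ) * Lp * ((1/2 : ℝ) • B1 + (1/2 : ℝ) • B2))
    (hQ3 : Q3 = ((2/5 : ℝ) • B1ᵀ + (2/5 : ℝ) • B2ᵀ) * Lp * ((1/4 : ℝ) • B1 + (3/4 : ℝ) • B2))
    (hR3 : R3 = ((1/5 : ℝ) • B1ᵀ + (3/5 : ℝ) • B2ᵀ) * Lp * ((1/4 : ℝ) • B1 + (3/4 : ℝ) • B2))
    (i : V) (f : E)
    (X : Matrix (V ⊕ E ⊕ E ⊕ E) (V ⊕ E ⊕ E ⊕ E) ℝ)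
    (hXsymm : X.IsSymm)
    (hX : L_W * X * L_W = L_W)
    :
    X (Sum.inl i) (Sum.inl i) + X (Sum.inr (Sum.inl f)) (Sum.inr (Sum.inl f)) -
        2 * X (Sum.inl i) (Sum.inr (Sum.inl f)) =
      (4/5 : ℝ) * Lp i i + 3/4 + P1 f f -
        2 * (Lp * ((3/5 : ℝ) • B1 + (1/5 : ℝ) • B2)) i f := by
  have hLs : L_Gᵀ = L_G := by
    subst hL hD hA
    simp only [transpose_sub, transpose_add, transpose_mul, transpose_transpose]
    abel
  -- `L * Lp` acts as the identity on vectors with zero sum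
  have hproj : ∀ v : V → ℝ, ∑ k, v k = 0 → L_G *ᵥ (Lp *ᵥ v) = v := by
    intro v hv
    have hQs : (1 - L_G * Lp)ᵀ = 1 - L_G * Lp := by
      rw [transpose_sub, transpose_mul, hLs, hLpsymm.eq, transpose_one, ← hLp3]
    have hcol : ∀ k, ∃ c, ∀ j, (1 - L_G * Lp) j k = c := by
      intro k
      apply hconn
      have h0 : L_G * (1 - L_G * Lp) = 0 := by
        rw [hLp3, mul_sub, mul_one, ← mul_assoc, hLp1, sub_self]
      ext j
      exact congrFun (congrFun h0 j) k
    choose c hc using hcol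
    have hcc : ∀ j k, c j = c k := by
      intro j k
      have h := congrFun (congrFun hQs j) k
      rw [transpose_apply, hc, hc] at h
      exact h
    have h0 : (1 - L_G * Lp) *ᵥ v = 0 := by
      ext j
      have h1 : ∀ k, (1 - L_G * Lp) j k * v k = c i * v k := by
        intro k
        rw [hc, hcc k i]
      simp only [mulVec, dotProduct, h1, ← Finset.mul_sum, hv, mul_zero, Pi.zero_apply]
    rw [sub_mulVec, one_mulVec, sub_eq_zero] at h0
    rw [mulVec_mulVec]
    exact h0.symm
  set ef : E → ℝ := Pi.single f 1 with hef
  set ei : V → ℝ := Pi.single i 1 with hei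
  set w : V → ℝ := (3/4 : ℝ) • (B1 *ᵥ ef) + (1/4 : ℝ) • (B2 *ᵥ ef) with hw
  have hsum : ∑ k, (ei - w) k = 0 := by
    simp [hw, hei, hef, hB1, hB2, Finset.sum_add_distrib, ← Finset.mul_sum, Pi.single_apply]
    norm_num
  set y : V → ℝ := (4/5 : ℝ) • (Lp *ᵥ (ei - w)) with hy
  have hLy : (5/4 : ℝ) • (L_G *ᵥ y) = ei - w := by
    rw [hy, mulVec_smul, hproj _ hsum, smul_smul]
    norm_num
  set z1 : E → ℝ := (3/4 : ℝ) • (B1ᵀ *ᵥ y) + (1/4 : ℝ) • (B2ᵀ *ᵥ y) - (3/4 : ℝ) • ef with hz1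
  set z2 : E → ℝ := (1/2 : ℝ) • (B1ᵀ *ᵥ y) + (1/2 : ℝ) • (B2ᵀ *ᵥ y) - (1/2 : ℝ) • ef with hz2
  set z3 : E → ℝ := (1/4 : ℝ) • (B1ᵀ *ᵥ y) + (3/4 : ℝ) • (B2ᵀ *ᵥ y) - (1/4 : ℝ) • ef with hz3
  set z : V ⊕ E ⊕ E ⊕ E → ℝ := Sum.elim y (Sum.elim z1 (Sum.elim z2 z3)) with hz
  set b : V ⊕ E ⊕ E ⊕ E → ℝ := Sum.elim ei (Sum.elim (-ef) (Sum.elim 0 0)) with hb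
  have hLz : L_W *ᵥ z = b := by
    have e0 : ((2 : ℝ) • D_G - A_G) *ᵥ y + ((-B1) *ᵥ z1 + ((0 : Matrix V E ℝ) *ᵥ z2 + (-B2) *ᵥ z3))
        = ei := by
      have h2 : ei = (5/4 : ℝ) • (L_G *ᵥ y) + w := by rw [hLy]; abel
      rw [h2, hw, hz1, hz3, hL, hD, hA]
      simp only [sub_mulVec, add_mulVec, smul_mulVec, neg_mulVec, mulVec_sub, mulVec_add,
        mulVec_smul, ← mulVec_mulVec, zero_mulVec]
      module
    have e1 : (-B1ᵀ) *ᵥ y + (((2 : ℝ) • (1 : Matrix E E ℝ)) *ᵥ z1 + ((-(1 : Matrix E E ℝ)) *ᵥ z2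
        + (0 : Matrix E E ℝ) *ᵥ z3)) = -ef := by
      rw [hz1, hz2]
      simp only [smul_mulVec, neg_mulVec, one_mulVec, zero_mulVec]
      module
    have e2 : (0 : Matrix E V ℝ) *ᵥ y + ((-(1 : Matrix E E ℝ)) *ᵥ z1 +
        (((2 : ℝ) • (1 : Matrix E E ℝ)) *ᵥ z2 + (-(1 : Matrix E E ℝ)) *ᵥ z3)) = 0 := by
      rw [hz1, hz2, hz3]
      simp only [smul_mulVec, neg_mulVec, one_mulVec, zero_mulVec]
      module
    have e3 : (-B2ᵀ) *ᵥ y + ((0 : Matrix E E ℝ) *ᵥ z1 +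
        ((-(1 : Matrix E E ℝ)) *ᵥ z2 + ((2 : ℝ) • (1 : Matrix E E ℝ)) *ᵥ z3)) = 0 := by
      rw [hz2, hz3]
      simp only [smul_mulVec, neg_mulVec, one_mulVec, zero_mulVec]
      module
    rw [hLW, hz, hb]
    simp only [fromBlocks_mulVec, fromCols_mulVec, fromRows_mulVec, Sum.elim_comp_inl,
      Sum.elim_comp_inr]
    funext s
    rcases s with s | s | s | s
    · exact congrFun e0 s
    · exact congrFun e1 s
    · exact congrFun e2 s
    · exact congrFun e3 s
  have hLWs : L_Wᵀ = L_W := by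
    have hDs : D_Gᵀ = D_G := by
      rw [hD]; simp only [transpose_add, transpose_mul, transpose_transpose]
    have hAs : A_Gᵀ = A_G := by
      rw [hA]; simp only [transpose_add, transpose_mul, transpose_transpose]; abel
    rw [hLW]
    simp only [fromBlocks_transpose, transpose_fromCols, transpose_fromRows, transpose_sub,
      transpose_smul, transpose_neg, transpose_one, transpose_zero, transpose_transpose, hDs, hAs]
  have hquad : b ⬝ᵥ (X *ᵥ b) = z ⬝ᵥ b := by
    have hvz : z ᵥ* L_W = b := by rw [← hLz, ← mulVec_transpose, hLWs]
    calc b ⬝ᵥ (X *ᵥ b) = (z ᵥ* L_W) ⬝ᵥ (X *ᵥ (L_W *ᵥ z)) := by rw [hvz, hLz]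
      _ = z ⬝ᵥ ((L_W * X * L_W) *ᵥ z) := by
        rw [← dotProduct_mulVec, mulVec_mulVec, mulVec_mulVec, mul_assoc]
      _ = z ⬝ᵥ b := by rw [hX, hLz]
  have hbe : b = Pi.single (Sum.inl i) 1 - Pi.single (Sum.inr (Sum.inl f)) 1 := by
    funext s
    rcases s with s | s | s | s <;> simp [hb, hei, hef, Pi.single_apply]
  have hXs : X (Sum.inr (Sum.inl f)) (Sum.inl i) = X (Sum.inl i) (Sum.inr (Sum.inl f)) :=
    hXsymm.apply _ _
  have hl : b ⬝ᵥ (X *ᵥ b) = X (Sum.inl i) (Sum.inl i)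
      + X (Sum.inr (Sum.inl f)) (Sum.inr (Sum.inl f))
      - 2 * X (Sum.inl i) (Sum.inr (Sum.inl f)) := by
    rw [hbe]
    simp only [mulVec_sub, sub_dotProduct, dotProduct_sub, single_one_dotProduct,
      mulVec_single_one, col_apply, hXs]
    ring
  have hr : z ⬝ᵥ b = y i - z1 f := by
    rw [hbe, dotProduct_sub, dotProduct_single_one, dotProduct_single_one]
    rfl
  rw [← hl, hquad, hr]
  have hLt : Lp (tail f) i = Lp i (tail f) := hLpsymm.apply _ _
  have hLh : Lp (head f) i = Lp i (head f) := hLpsymm.apply _ _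
  have hb1 : B1 *ᵥ ef = Pi.single (tail f) 1 := by
    ext s; simp [hef, hB1, Pi.single_apply]
  have hb2 : B2 *ᵥ ef = Pi.single (head f) 1 := by
    ext s; simp [hef, hB2, Pi.single_apply]
  have hyk : ∀ k, y k = (4/5 : ℝ) * (Lp k i - (3/4 * Lp k (tail f) + 1/4 * Lp k (head f))) := by
    intro k
    rw [hy, hw, hb1, hb2, hei]
    simp [mulVec_sub, mulVec_add, mulVec_smul]
  have hzf : z1 f = 3/4 * y (tail f) + 1/4 * y (head f) - 3/4 := by
    simp [hz1, hef, hB1, hB2, mulVec, dotProduct]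
  have hPf : P1 f f = 3/5 * (3/4 * Lp (tail f) (tail f) + 1/4 * Lp (tail f) (head f))
      + 1/5 * (3/4 * Lp (head f) (tail f) + 1/4 * Lp (head f) (head f)) := by
    rw [hP1]
    simp [hB1, hB2, mul_apply, add_mul, mul_add, Finset.sum_add_distrib]
    ring
  have hMf : (Lp * ((3/5 : ℝ) • B1 + (1/5 : ℝ) • B2)) i f
      = 3/5 * Lp i (tail f) + 1/5 * Lp i (head f) := by
    simp [hB1, hB2, mul_apply, mul_add, Finset.sum_add_distrib]
    ring
  rw [hPf, hMf, hzf, hyk, hyk, hyk, hLt, hLh]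
  ring
end

section
/- For every vertex i ∈ V and every edge f ∈ E, the resistance distance in W(G) between i and the path vertex u_{f2} ∈ V2 satisfies r_{i,u_{f2}}(W(G)) = (4/5)·(L_G^#)_{ii} + 1 + (Q2)_{ff} − 2·(L_G^#·((2/5)B1 + (2/5)B2))_{if}. -/
open Matrix

theorem pent_resistance_V_V2
    {V E : Type} [Fintype V] [Fintype E] [DecidableEq V] [DecidableEq E]
    [Nonempty V] [Nonempty E]
    (tail head : E → V)
    (hloop : ∀ e, tail e ≠ head e)
    (hsimple : ∀ e f, e ≠ f →
      ¬(tail e = tail f ∧ head e = head f) ∧ ¬(tail e = head f ∧ head e = tail f))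
    (B1 B2 : Matrix V E ℝ)
    (hB1 : B1 = Matrix.of fun i e => if i = tail e then (1 : ℝ) else 0)
    (hB2 : B2 = Matrix.of fun i e => if i = head e then (1 : ℝ) else 0)
    (D_G A_G L_G : Matrix V V ℝ)
    (hD : D_G = B1 * B1ᵀ + B2 * B2ᵀ)
    (hA : A_G = B1 * B2ᵀ + B2 * B1ᵀ)
    (hL : L_G = D_G - A_G)
    (hconn : ∀ x : V → ℝ, L_G.mulVec x = 0 → ∃ c, ∀ i, x i = c)
    (Lp : Matrix V V ℝ)
    (hLp1 : L_G * Lp * L_G = L_G)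
    (hLp2 : Lp * L_G * Lp = Lp)
    (hLp3 : L_G * Lp = Lp * L_G)
    (hLpsymm : Lp.IsSymm)
    (L_W : Matrix (V ⊕ E ⊕ E ⊕ E) (V ⊕ E ⊕ E ⊕ E) ℝ)
    (hLW : L_W = Matrix.fromBlocks ((2 : ℝ) • D_G - A_G)
      (Matrix.fromCols (-B1) (Matrix.fromCols (0 : Matrix V E ℝ) (-B2)))
      (Matrix.fromRows (-B1ᵀ) (Matrix.fromRows (0 : Matrix E V ℝ) (-B2ᵀ)))
      (Matrix.fromBlocks ((2 : ℝ) • (1 : Matrix E E ℝ))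
        (Matrix.fromCols (-(1 : Matrix E E ℝ)) (0 : Matrix E E ℝ))
        (Matrix.fromRows (-(1 : Matrix E E ℝ)) (0 : Matrix E E ℝ))
        (Matrix.fromBlocks ((2 : ℝ) • (1 : Matrix E E ℝ)) (-(1 : Matrix E E ℝ))
          (-(1 : Matrix E E ℝ)) ((2 : ℝ) • (1 : Matrix E E ℝ)))))
    (P1 P2 P3 Q2 Q3 R3 : Matrix E E ℝ)
    (hP1 : P1 = ((3/5 : ℝ) • B1ᵀ + (1/5 : ℝ) • B2ᵀ) * Lp * ((3/4 : ℝ) • B1 + (1/4 : ℝ) • B2))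
    (hP2 : P2 = ((3/5 : ℝ) • B1ᵀ + (1/5 : ℝ) • B2ᵀ) * Lp * ((1/2 : ℝ) • B1 + (1/2 : ℝ) • B2))
    (hP3 : P3 = ((3/5 : ℝ) • B1ᵀ + (1/5 : ℝ) • B2ᵀ) * Lp * ((1/4 : ℝ) • B1 + (3/4 : ℝ) • B2))
    (hQ2 : Q2 = ((2/5 : ℝ) • B1ᵀ + (2/5 : ℝ) • B2ᵀ) * Lp * ((1/2 : ℝ) • B1 + (1/2 : ℝ) • B2))
    (hQ3 : Q3 = ((2/5 : ℝ) • B1ᵀ + (2/5 : ℝ) • B2ᵀ) * Lp * ((1/4 : ℝ) • B1 + (3/4 : ℝ) • B2))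
    (hR3 : R3 = ((1/5 : ℝ) • B1ᵀ + (3/5 : ℝ) • B2ᵀ) * Lp * ((1/4 : ℝ) • B1 + (3/4 : ℝ) • B2))
    (i : V) (f : E)
    (X : Matrix (V ⊕ E ⊕ E ⊕ E) (V ⊕ E ⊕ E ⊕ E) ℝ)
    (hXsymm : X.IsSymm)
    (hX : L_W * X * L_W = L_W)
    :
    X (Sum.inl i) (Sum.inl i) +
        X (Sum.inr (Sum.inr (Sum.inl f))) (Sum.inr (Sum.inr (Sum.inl f))) -
        2 * X (Sum.inl i) (Sum.inr (Sum.inr (Sum.inl f))) =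
      (4/5 : ℝ) * Lp i i + 1 + Q2 f f -
        2 * (Lp * ((2/5 : ℝ) • B1 + (2/5 : ℝ) • B2)) i f := by
  have hB1c : ∀ x : V → ℝ, B1ᵀ *ᵥ x = fun e => x (tail e) := by
    intro x; ext e; simp [hB1, mulVec, dotProduct]
  have hB2c : ∀ x : V → ℝ, B2ᵀ *ᵥ x = fun e => x (head e) := by
    intro x; ext e; simp [hB2, mulVec, dotProduct]
  have hB1s : B1 *ᵥ (Pi.single f 1) = Pi.single (tail f) (1 : ℝ) := by
    ext j; simp [hB1, Pi.single_apply]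
  have hB2s : B2 *ᵥ (Pi.single f 1) = Pi.single (head f) (1 : ℝ) := by
    ext j; simp [hB2, Pi.single_apply]
  have hLsymm : L_Gᵀ = L_G := by
    rw [hL, hD, hA]
    simp only [transpose_sub, transpose_add, transpose_mul, transpose_transpose]
    abel
  have hL1 : L_G *ᵥ (fun _ => (1 : ℝ)) = 0 := by
    rw [hL, hD, hA]
    simp only [sub_mulVec, add_mulVec, ← mulVec_mulVec, hB1c, hB2c]
    abel
  have hsumL : ∀ x : V → ℝ, ∑ j, (L_G *ᵥ x) j = 0 := by
    intro x
    have h1 : (fun _ => (1 : ℝ)) ⬝ᵥ (L_G *ᵥ x) = 0 := by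
      rw [dotProduct_mulVec, ← mulVec_transpose, hLsymm, hL1, zero_dotProduct]
    simpa [dotProduct] using h1
  have hLLL : L_G * (L_G * Lp) = L_G := by rw [hLp3, ← Matrix.mul_assoc, hLp1]
  have hproj : ∀ x : V → ℝ, ∑ j, x j = 0 → L_G *ᵥ (Lp *ᵥ x) = x := by
    intro x hx
    obtain ⟨c, hc⟩ := hconn (L_G *ᵥ (Lp *ᵥ x) - x) (by
      rw [mulVec_sub, mulVec_mulVec, mulVec_mulVec, Matrix.mul_assoc, hLLL, sub_self])
    have hs : ∑ j, (L_G *ᵥ (Lp *ᵥ x) - x) j = 0 := by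
      simp only [Pi.sub_apply, Finset.sum_sub_distrib, hsumL, hx, sub_self]
    simp only [hc, Finset.sum_const, nsmul_eq_mul] at hs
    have hc0 : c = 0 := by
      rcases mul_eq_zero.mp hs with h | h
      · exfalso
        have : (Finset.univ : Finset V).card ≠ 0 := Finset.card_ne_zero.mpr Finset.univ_nonempty
        exact this (by exact_mod_cast h)
      · exact h
    ext j
    have := hc j
    rw [hc0, Pi.sub_apply] at this
    linarith
  set g : V → ℝ := Pi.single i 1 - (1/2 : ℝ) • (Pi.single (tail f) 1 + Pi.single (head f) 1) with hg
  have hgs : ∑ j, g j = 0 := by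
    simp [hg, Finset.sum_sub_distrib, ← Finset.mul_sum, Finset.sum_add_distrib]
    norm_num
  set yV : V → ℝ := (4/5 : ℝ) • (Lp *ᵥ g) with hyV
  have hLy : L_G *ᵥ yV = (4/5 : ℝ) • g := by
    rw [hyV, mulVec_smul, hproj g hgs]
  set d : E → ℝ := Pi.single f 1 with hd
  set a1 : E → ℝ := B1ᵀ *ᵥ yV with ha1
  set a2 : E → ℝ := B2ᵀ *ᵥ yV with ha2
  set y : V ⊕ E ⊕ E ⊕ E → ℝ := Sum.elim yV (Sum.elim
      ((3/4 : ℝ) • a1 + (1/4 : ℝ) • a2 - (1/2 : ℝ) • d)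
      (Sum.elim ((1/2 : ℝ) • a1 + (1/2 : ℝ) • a2 - d)
        ((1/4 : ℝ) • a1 + (3/4 : ℝ) • a2 - (1/2 : ℝ) • d))) with hy
  have hLy' : B1 *ᵥ a1 + B2 *ᵥ a2 - (B1 *ᵥ a2 + B2 *ᵥ a1) = (4/5 : ℝ) • g := by
    rw [← hLy, hL, hD, hA, ha1, ha2]
    simp only [sub_mulVec, add_mulVec, mulVec_mulVec]
  set b : V ⊕ E ⊕ E ⊕ E → ℝ := Pi.single (Sum.inl i) 1 -
    Pi.single (Sum.inr (Sum.inr (Sum.inl f))) 1 with hb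
  have hWy : L_W *ᵥ y = b := by
    have e1 : ((2 : ℝ) • D_G - A_G) *ᵥ yV =
        (2 : ℝ) • (B1 *ᵥ a1 + B2 *ᵥ a2) - (B1 *ᵥ a2 + B2 *ᵥ a1) := by
      rw [hD, hA, ha1, ha2]
      simp only [sub_mulVec, smul_mulVec, add_mulVec, mulVec_mulVec]
    rw [hLW, hy]
    ext k
    rcases k with k | k | k | k
    · have h := congrFun hLy' k
      have h1 := congrFun hB1s k
      have h2 := congrFun hB2s k
      simp only [fromBlocks_mulVec, Sum.elim_inl, fromCols_mulVec, Sum.elim_comp_inl,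
        Sum.elim_comp_inr, e1, neg_mulVec, mulVec_add, mulVec_sub, mulVec_smul, zero_mulVec,
        Pi.add_apply, Pi.sub_apply, Pi.smul_apply, Pi.neg_apply, Pi.zero_apply, smul_eq_mul,
        hb, hg, Pi.single_apply, Sum.inl.injEq, reduceCtorEq, if_false] at h h1 h2 ⊢
      linarith
    all_goals
      simp [fromBlocks_mulVec, fromCols_mulVec, fromRows_mulVec, neg_mulVec, smul_mulVec,
        hb, ← ha1, ← ha2, Pi.single_apply, hd]
    all_goals ring_nf
    all_goals split_ifs <;> norm_num
  have hWsymm : L_Wᵀ = L_W := by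
    have t1 : ((2 : ℝ) • D_G - A_G)ᵀ = (2 : ℝ) • D_G - A_G := by
      rw [hD, hA]
      simp only [transpose_sub, transpose_smul, transpose_add, transpose_mul, transpose_transpose]
      abel
    rw [hLW]
    simp [fromBlocks_transpose, transpose_fromCols, transpose_fromRows, t1,
      -transpose_sub]
  have key : b ⬝ᵥ (X *ᵥ b) = b ⬝ᵥ y := by
    calc b ⬝ᵥ (X *ᵥ b) = (L_W *ᵥ y) ⬝ᵥ (X *ᵥ (L_W *ᵥ y)) := by rw [hWy]
      _ = y ⬝ᵥ ((L_W * X * L_W) *ᵥ y) := by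
        have hv : L_W *ᵥ y = y ᵥ* L_W := by
          rw [← vecMul_transpose, hWsymm]
        have hm : (L_W * X * L_W) *ᵥ y = L_W *ᵥ (X *ᵥ (L_W *ᵥ y)) := by
          simp only [mulVec_mulVec, Matrix.mul_assoc]
        rw [hm, dotProduct_mulVec y L_W, ← hv]
      _ = b ⬝ᵥ y := by rw [hX, hWy, dotProduct_comm]
  have hXs := hXsymm.apply (Sum.inl i) (Sum.inr (Sum.inr (Sum.inl f)))
  have hs1 := hLpsymm.apply i (tail f)
  have hs2 := hLpsymm.apply i (head f)
  have hs3 := hLpsymm.apply (tail f) (head f)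
  have hlhs : b ⬝ᵥ (X *ᵥ b) = X (Sum.inl i) (Sum.inl i) +
        X (Sum.inr (Sum.inr (Sum.inl f))) (Sum.inr (Sum.inr (Sum.inl f))) -
        2 * X (Sum.inl i) (Sum.inr (Sum.inr (Sum.inl f))) := by
    rw [hb]
    simp only [mulVec_sub, sub_dotProduct, single_one_dotProduct, Pi.sub_apply,
      mulVec_single_one, col_apply]
    linarith
  have hrhs : b ⬝ᵥ y = yV i - ((1/2) * yV (tail f) + (1/2) * yV (head f) - 1) := by
    rw [hb, hy]
    simp only [sub_dotProduct, single_one_dotProduct, Sum.elim_inl, Sum.elim_inr, Pi.add_apply,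
      Pi.sub_apply, Pi.smul_apply, smul_eq_mul, ha1, ha2, hB1c, hB2c, hd, Pi.single_eq_same]
  have hyx : ∀ j, yV j = 4/5 * (Lp j i - 1/2 * (Lp j (tail f) + Lp j (head f))) := by
    intro j
    rw [hyV, hg]
    simp only [mulVec_sub, mulVec_smul, mulVec_add, mulVec_single_one, Pi.smul_apply,
      Pi.sub_apply, Pi.add_apply, col_apply, smul_eq_mul]
  have m1 : ∀ (ι : Type) (M : Matrix ι V ℝ) (k : ι), (M * B1) k f = M k (tail f) := by
    intro ι M k; simp [hB1, mul_apply]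
  have m2 : ∀ (ι : Type) (M : Matrix ι V ℝ) (k : ι), (M * B2) k f = M k (head f) := by
    intro ι M k; simp [hB2, mul_apply]
  have m3 : ∀ k, (B1ᵀ * Lp) f k = Lp (tail f) k := by
    intro k; simp [hB1, mul_apply]
  have m4 : ∀ k, (B2ᵀ * Lp) f k = Lp (head f) k := by
    intro k; simp [hB2, mul_apply]
  rw [← hlhs, key, hrhs, hyx, hyx, hyx, hQ2]
  simp only [Matrix.mul_add, Matrix.add_mul, Matrix.mul_smul, Matrix.smul_mul, Matrix.add_apply,
    Matrix.smul_apply, smul_eq_mul, m1, m2, m3, m4]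
  rw [hs1, hs2, hs3]
  ring
end

section
/- For every vertex i ∈ V and every edge f ∈ E, the resistance distance in W(G) between i and the path vertex u_{f3} ∈ V3 satisfies r_{i,u_{f3}}(W(G)) = (4/5)·(L_G^#)_{ii} + 3/4 + (R3)_{ff} − 2·(L_G^#·((1/5)B1 + (3/5)B2))_{if}. -/
open Matrix

theorem pent_resistance_V_V3
    {V E : Type} [Fintype V] [Fintype E] [DecidableEq V] [DecidableEq E]
    [Nonempty V] [Nonempty E]
    (tail head : E → V)
    (hloop : ∀ e, tail e ≠ head e)
    (hsimple : ∀ e f, e ≠ f →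
      ¬(tail e = tail f ∧ head e = head f) ∧ ¬(tail e = head f ∧ head e = tail f))
    (B1 B2 : Matrix V E ℝ)
    (hB1 : B1 = Matrix.of fun i e => if i = tail e then (1 : ℝ) else 0)
    (hB2 : B2 = Matrix.of fun i e => if i = head e then (1 : ℝ) else 0)
    (D_G A_G L_G : Matrix V V ℝ)
    (hD : D_G = B1 * B1ᵀ + B2 * B2ᵀ)
    (hA : A_G = B1 * B2ᵀ + B2 * B1ᵀ)
    (hL : L_G = D_G - A_G)
    (hconn : ∀ x : V → ℝ, L_G.mulVec x = 0 → ∃ c, ∀ i, x i = c)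
    (Lp : Matrix V V ℝ)
    (hLp1 : L_G * Lp * L_G = L_G)
    (hLp2 : Lp * L_G * Lp = Lp)
    (hLp3 : L_G * Lp = Lp * L_G)
    (hLpsymm : Lp.IsSymm)
    (L_W : Matrix (V ⊕ E ⊕ E ⊕ E) (V ⊕ E ⊕ E ⊕ E) ℝ)
    (hLW : L_W = Matrix.fromBlocks ((2 : ℝ) • D_G - A_G)
      (Matrix.fromCols (-B1) (Matrix.fromCols (0 : Matrix V E ℝ) (-B2)))
      (Matrix.fromRows (-B1ᵀ) (Matrix.fromRows (0 : Matrix E V ℝ) (-B2ᵀ)))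
      (Matrix.fromBlocks ((2 : ℝ) • (1 : Matrix E E ℝ))
        (Matrix.fromCols (-(1 : Matrix E E ℝ)) (0 : Matrix E E ℝ))
        (Matrix.fromRows (-(1 : Matrix E E ℝ)) (0 : Matrix E E ℝ))
        (Matrix.fromBlocks ((2 : ℝ) • (1 : Matrix E E ℝ)) (-(1 : Matrix E E ℝ))
          (-(1 : Matrix E E ℝ)) ((2 : ℝ) • (1 : Matrix E E ℝ)))))
    (P1 P2 P3 Q2 Q3 R3 : Matrix E E ℝ)
    (hP1 : P1 = ((3/5 : ℝ) • B1ᵀ + (1/5 : ℝ) • B2ᵀ) * Lp * ((3/4 : ℝ) • B1 + (1/4 : ℝ) • B2))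
    (hP2 : P2 = ((3/5 : ℝ) • B1ᵀ + (1/5 : ℝ) • B2ᵀ) * Lp * ((1/2 : ℝ) • B1 + (1/2 : ℝ) • B2))
    (hP3 : P3 = ((3/5 : ℝ) • B1ᵀ + (1/5 : ℝ) • B2ᵀ) * Lp * ((1/4 : ℝ) • B1 + (3/4 : ℝ) • B2))
    (hQ2 : Q2 = ((2/5 : ℝ) • B1ᵀ + (2/5 : ℝ) • B2ᵀ) * Lp * ((1/2 : ℝ) • B1 + (1/2 : ℝ) • B2))
    (hQ3 : Q3 = ((2/5 : ℝ) • B1ᵀ + (2/5 : ℝ) • B2ᵀ) * Lp * ((1/4 : ℝ) • B1 + (3/4 : ℝ) • B2))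
    (hR3 : R3 = ((1/5 : ℝ) • B1ᵀ + (3/5 : ℝ) • B2ᵀ) * Lp * ((1/4 : ℝ) • B1 + (3/4 : ℝ) • B2))
    (i : V) (f : E)
    (X : Matrix (V ⊕ E ⊕ E ⊕ E) (V ⊕ E ⊕ E ⊕ E) ℝ)
    (hXsymm : X.IsSymm)
    (hX : L_W * X * L_W = L_W)
    :
    X (Sum.inl i) (Sum.inl i) +
        X (Sum.inr (Sum.inr (Sum.inr f))) (Sum.inr (Sum.inr (Sum.inr f))) -
        2 * X (Sum.inl i) (Sum.inr (Sum.inr (Sum.inr f))) =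
      (4/5 : ℝ) * Lp i i + 3/4 + R3 f f -
        2 * (Lp * ((1/5 : ℝ) • B1 + (3/5 : ℝ) • B2)) i f := by
  have hLsymm : L_Gᵀ = L_G := by
    rw [hL, hD, hA]
    simp only [transpose_sub, transpose_add, transpose_mul, transpose_transpose]
    abel
  have hBt1 : ∀ z : V → ℝ, ∀ e, (B1ᵀ *ᵥ z) e = z (tail e) := by
    intro z e
    simp [hB1, mulVec, dotProduct]
  have hBt2 : ∀ z : V → ℝ, ∀ e, (B2ᵀ *ᵥ z) e = z (head e) := by
    intro z e
    simp [hB2, mulVec, dotProduct]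
  have hLone : L_G *ᵥ (fun _ => (1 : ℝ)) = 0 := by
    have h12 : B1ᵀ *ᵥ (fun _ => (1 : ℝ)) = B2ᵀ *ᵥ (fun _ => (1 : ℝ)) := by
      funext e; rw [hBt1, hBt2]
    rw [hL, hD, hA]
    simp only [sub_mulVec, add_mulVec, ← mulVec_mulVec, h12]
    abel
  have hproj : ∀ w : V → ℝ, (∑ v, w v = 0) → L_G *ᵥ (Lp *ᵥ w) = w := by
    intro w hw
    have h0 : L_G *ᵥ (w - L_G *ᵥ (Lp *ᵥ w)) = 0 := by
      have : L_G *ᵥ (L_G *ᵥ (Lp *ᵥ w)) = L_G *ᵥ w := by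
        rw [mulVec_mulVec w L_G Lp, hLp3, mulVec_mulVec, ← Matrix.mul_assoc, hLp1]
      rw [mulVec_sub, this, sub_self]
    obtain ⟨c, hc⟩ := hconn _ h0
    have hs : ∑ v, (w - L_G *ᵥ (Lp *ᵥ w)) v = 0 := by
      have h1 : ∑ v, (L_G *ᵥ (Lp *ᵥ w)) v = (fun _ => (1 : ℝ)) ⬝ᵥ (L_G *ᵥ (Lp *ᵥ w)) := by
        simp [dotProduct]
      have h2 : (fun _ => (1 : ℝ)) ⬝ᵥ (L_G *ᵥ (Lp *ᵥ w)) = 0 := by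
        rw [dotProduct_mulVec, ← mulVec_transpose, hLsymm, hLone, zero_dotProduct]
      simp only [Pi.sub_apply, Finset.sum_sub_distrib]
      rw [hw, h1, h2, sub_zero]
    simp only [hc, Finset.sum_const, nsmul_eq_mul] at hs
    have hc0 : c = 0 := by
      rcases mul_eq_zero.mp hs with h | h
      · simp at h
      · exact h
    funext v
    have := hc v
    rw [hc0, Pi.sub_apply] at this
    linarith
  have hsymm : L_Wᵀ = L_W := by
    have hM : ((2 : ℝ) • D_G - A_G)ᵀ = (2 : ℝ) • D_G - A_G := by
      rw [hD, hA]
      simp only [transpose_sub, transpose_smul, transpose_add, transpose_mul, transpose_transpose]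
      rw [add_comm (B1 * B2ᵀ)]
    rw [hLW]
    simp [fromBlocks_transpose, transpose_fromCols, transpose_fromRows, hM, -transpose_sub]
  let s : E → ℝ := Pi.single f 1
  let t : V → ℝ := Pi.single i 1
  let q : V → ℝ := (1/4 : ℝ) • (B1 *ᵥ s) + (3/4 : ℝ) • (B2 *ᵥ s)
  have hq : ∀ v, q v = 1/4 * B1 v f + 3/4 * B2 v f := by
    intro v
    simp [q, s]
  have hwsum : ∑ v, (t - q) v = 0 := by
    simp only [Pi.sub_apply, Finset.sum_sub_distrib, hq, Finset.sum_add_distrib, ← Finset.mul_sum]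
    simp [t, hB1, hB2]
    norm_num
  let z : V → ℝ := (4/5 : ℝ) • (Lp *ᵥ (t - q))
  have hz : L_G *ᵥ z = (4/5 : ℝ) • (t - q) := by
    simp only [z, mulVec_smul]
    rw [hproj _ hwsum]
  let y1 : E → ℝ := (3/4 : ℝ) • (B1ᵀ *ᵥ z) + (1/4 : ℝ) • (B2ᵀ *ᵥ z) - (1/4 : ℝ) • s
  let y2 : E → ℝ := (1/2 : ℝ) • (B1ᵀ *ᵥ z) + (1/2 : ℝ) • (B2ᵀ *ᵥ z) - (1/2 : ℝ) • s
  let y3 : E → ℝ := (1/4 : ℝ) • (B1ᵀ *ᵥ z) + (3/4 : ℝ) • (B2ᵀ *ᵥ z) - (3/4 : ℝ) • s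
  let y : V ⊕ E ⊕ E ⊕ E → ℝ := Sum.elim z (Sum.elim y1 (Sum.elim y2 y3))
  let b : V ⊕ E ⊕ E ⊕ E → ℝ :=
    Pi.single (Sum.inl i) 1 - Pi.single (Sum.inr (Sum.inr (Sum.inr f))) 1
  have hb : b = Sum.elim t (Sum.elim 0 (Sum.elim 0 (-s))) := by
    funext v
    rcases v with v | v | v | v <;> simp [b, t, s, Pi.single_apply]
  have hy : L_W *ᵥ y = b := by
    rw [hb, hLW]
    simp only [y, fromBlocks_mulVec, fromCols_mulVec, fromRows_mulVec, Sum.elim_comp_inl,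
      Sum.elim_comp_inr, neg_mulVec, zero_mulVec, one_mulVec, smul_mulVec, sub_mulVec]
    funext v
    rcases v with v | v | v | v
    · have hzv := congrFun hz v
      rw [hL, hD, hA] at hzv
      rw [hD, hA]
      simp only [y1, y3, q, sub_mulVec, add_mulVec, ← mulVec_mulVec, mulVec_add, mulVec_sub,
        mulVec_smul, Pi.add_apply, Pi.sub_apply, Pi.smul_apply, smul_eq_mul, Sum.elim_inl,
        Pi.neg_apply, Pi.zero_apply] at hzv ⊢
      linarith
    all_goals
      simp [y1, y2, y3]
      ring
  have key : b ⬝ᵥ (X *ᵥ b) = y ⬝ᵥ b := by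
    have h1 : b ⬝ᵥ (X *ᵥ b) = y ⬝ᵥ (L_W *ᵥ (X *ᵥ b)) := by
      rw [dotProduct_mulVec y, ← mulVec_transpose, hsymm, hy]
    rw [h1, ← hy, mulVec_mulVec, mulVec_mulVec, hX]
  have hl : b ⬝ᵥ (X *ᵥ b) = X (Sum.inl i) (Sum.inl i) +
        X (Sum.inr (Sum.inr (Sum.inr f))) (Sum.inr (Sum.inr (Sum.inr f))) -
        2 * X (Sum.inl i) (Sum.inr (Sum.inr (Sum.inr f))) := by
    have := hXsymm.apply (Sum.inl i) (Sum.inr (Sum.inr (Sum.inr f)))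
    simp [b, sub_dotProduct, mulVec_sub]
    linarith
  have hr : y ⬝ᵥ b = z i - (1/4 * z (tail f) + 3/4 * z (head f) - 3/4) := by
    simp only [b, dotProduct_sub, dotProduct_single, mul_one]
    simp [y, y3, hBt1, hBt2, s]
  have hzv : ∀ v, z v = 4/5 * (Lp v i - (1/4 * Lp v (tail f) + 3/4 * Lp v (head f))) := by
    intro v
    have h1 : (Lp *ᵥ t) v = Lp v i := by simp [t]
    have h2 : (Lp *ᵥ q) v = 1/4 * Lp v (tail f) + 3/4 * Lp v (head f) := by
      simp only [mulVec, dotProduct, hq, mul_add, Finset.sum_add_distrib]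
      simp [hB1, hB2]
      ring
    simp only [z, mulVec_sub, Pi.smul_apply, Pi.sub_apply, h1, h2, smul_eq_mul]
  rw [← hl, key, hr, hzv, hzv, hzv]
  have hC : ∀ v, ∀ a c : ℝ, (Lp * (a • B1 + c • B2)) v f = a * Lp v (tail f) + c * Lp v (head f) := by
    intro v a c
    simp only [Matrix.mul_add, Matrix.add_apply, Matrix.mul_smul, Matrix.smul_apply, smul_eq_mul]
    simp [hB1, hB2, Matrix.mul_apply]
  have hR : R3 f f = 1/5 * (Lp * ((1/4 : ℝ) • B1 + (3/4 : ℝ) • B2)) (tail f) f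
      + 3/5 * (Lp * ((1/4 : ℝ) • B1 + (3/4 : ℝ) • B2)) (head f) f := by
    rw [hR3, Matrix.mul_assoc]
    generalize (Lp * ((1/4 : ℝ) • B1 + (3/4 : ℝ) • B2)) = M
    simp only [Matrix.add_mul, Matrix.add_apply, Matrix.smul_mul, Matrix.smul_apply, smul_eq_mul]
    simp [hB1, hB2, Matrix.mul_apply]
  rw [hR, hC, hC, hC]
  have e1 := hLpsymm.apply i (tail f)
  have e2 := hLpsymm.apply i (head f)
  have e3 := hLpsymm.apply (head f) (tail f)
  rw [e1, e2, e3]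
  ring
end

section
/- For all edges e, f ∈ E, the resistance distance in W(G) between the path vertices u_{e1} ∈ V1 and u_{f2} ∈ V2 satisfies r_{u_{e1},u_{f2}}(W(G)) = 7/4 + (P1)_{ee} + (Q2)_{ff} − 2·((1/2)I_m + P2)_{ef}. -/
open Matrix

theorem pent_resistance_V1_V2
    {V E : Type} [Fintype V] [Fintype E] [DecidableEq V] [DecidableEq E]
    [Nonempty V] [Nonempty E]
    (tail head : E → V)
    (hloop : ∀ e, tail e ≠ head e)
    (hsimple : ∀ e f, e ≠ f →
      ¬(tail e = tail f ∧ head e = head f) ∧ ¬(tail e = head f ∧ head e = tail f))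
    (B1 B2 : Matrix V E ℝ)
    (hB1 : B1 = Matrix.of fun i e => if i = tail e then (1 : ℝ) else 0)
    (hB2 : B2 = Matrix.of fun i e => if i = head e then (1 : ℝ) else 0)
    (D_G A_G L_G : Matrix V V ℝ)
    (hD : D_G = B1 * B1ᵀ + B2 * B2ᵀ)
    (hA : A_G = B1 * B2ᵀ + B2 * B1ᵀ)
    (hL : L_G = D_G - A_G)
    (hconn : ∀ x : V → ℝ, L_G.mulVec x = 0 → ∃ c, ∀ i, x i = c)
    (Lp : Matrix V V ℝ)
    (hLp1 : L_G * Lp * L_G = L_G)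
    (hLp2 : Lp * L_G * Lp = Lp)
    (hLp3 : L_G * Lp = Lp * L_G)
    (hLpsymm : Lp.IsSymm)
    (L_W : Matrix (V ⊕ E ⊕ E ⊕ E) (V ⊕ E ⊕ E ⊕ E) ℝ)
    (hLW : L_W = Matrix.fromBlocks ((2 : ℝ) • D_G - A_G)
      (Matrix.fromCols (-B1) (Matrix.fromCols (0 : Matrix V E ℝ) (-B2)))
      (Matrix.fromRows (-B1ᵀ) (Matrix.fromRows (0 : Matrix E V ℝ) (-B2ᵀ)))
      (Matrix.fromBlocks ((2 : ℝ) • (1 : Matrix E E ℝ))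
        (Matrix.fromCols (-(1 : Matrix E E ℝ)) (0 : Matrix E E ℝ))
        (Matrix.fromRows (-(1 : Matrix E E ℝ)) (0 : Matrix E E ℝ))
        (Matrix.fromBlocks ((2 : ℝ) • (1 : Matrix E E ℝ)) (-(1 : Matrix E E ℝ))
          (-(1 : Matrix E E ℝ)) ((2 : ℝ) • (1 : Matrix E E ℝ)))))
    (P1 P2 P3 Q2 Q3 R3 : Matrix E E ℝ)
    (hP1 : P1 = ((3/5 : ℝ) • B1ᵀ + (1/5 : ℝ) • B2ᵀ) * Lp * ((3/4 : ℝ) • B1 + (1/4 : ℝ) • B2))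
    (hP2 : P2 = ((3/5 : ℝ) • B1ᵀ + (1/5 : ℝ) • B2ᵀ) * Lp * ((1/2 : ℝ) • B1 + (1/2 : ℝ) • B2))
    (hP3 : P3 = ((3/5 : ℝ) • B1ᵀ + (1/5 : ℝ) • B2ᵀ) * Lp * ((1/4 : ℝ) • B1 + (3/4 : ℝ) • B2))
    (hQ2 : Q2 = ((2/5 : ℝ) • B1ᵀ + (2/5 : ℝ) • B2ᵀ) * Lp * ((1/2 : ℝ) • B1 + (1/2 : ℝ) • B2))
    (hQ3 : Q3 = ((2/5 : ℝ) • B1ᵀ + (2/5 : ℝ) • B2ᵀ) * Lp * ((1/4 : ℝ) • B1 + (3/4 : ℝ) • B2))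
    (hR3 : R3 = ((1/5 : ℝ) • B1ᵀ + (3/5 : ℝ) • B2ᵀ) * Lp * ((1/4 : ℝ) • B1 + (3/4 : ℝ) • B2))
    (e f : E)
    (X : Matrix (V ⊕ E ⊕ E ⊕ E) (V ⊕ E ⊕ E ⊕ E) ℝ)
    (hXsymm : X.IsSymm)
    (hX : L_W * X * L_W = L_W)
    :
    X (Sum.inr (Sum.inl e)) (Sum.inr (Sum.inl e)) +
        X (Sum.inr (Sum.inr (Sum.inl f))) (Sum.inr (Sum.inr (Sum.inl f))) -
        2 * X (Sum.inr (Sum.inl e)) (Sum.inr (Sum.inr (Sum.inl f))) =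
      7/4 + P1 e e + Q2 f f - 2 * ((1/2 : ℝ) • (1 : Matrix E E ℝ) + P2) e f := by
  -- the projection 1 - L * Lp is a constant matrix
  have hcc : ∀ v : V → ℝ, ∑ i, v i = 0 → (L_G * Lp) *ᵥ v = v := by
    have hLs : L_Gᵀ = L_G := by
      rw [hL, hD, hA]
      simp only [transpose_sub, transpose_add, transpose_mul, transpose_transpose]
      rw [add_comm (B2 * B1ᵀ)]
    have hKs : (1 - L_G * Lp)ᵀ = 1 - L_G * Lp := by
      rw [transpose_sub, transpose_one, transpose_mul, hLs, hLpsymm.eq, hLp3]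
    have hLK : L_G * (1 - L_G * Lp) = 0 := by
      rw [hLp3, mul_sub, mul_one, ← mul_assoc, hLp1, sub_self]
    set K := 1 - L_G * Lp with hK
    have hcol : ∀ j i i', K i j = K i' j := by
      intro j i i'
      obtain ⟨c, hc⟩ := hconn (fun i => K i j) (by
        ext i
        exact congrFun (congrFun hLK i) j)
      exact (hc i).trans (hc i').symm
    have hKsymm : ∀ i j, K i j = K j i := fun i j => congrFun (congrFun hKs j) i
    intro v hv
    have h0 : K *ᵥ v = 0 := by
      ext i
      have : ∀ j, K i j = K i i := fun j => by rw [hKsymm i j]; exact hcol i j i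
      simp only [mulVec, dotProduct, this, ← Finset.mul_sum, hv, mul_zero, Pi.zero_apply]
    have : L_G * Lp = 1 - K := by rw [hK]; abel
    rw [this, sub_mulVec, h0, one_mulVec, sub_zero]
  let de : E → ℝ := Pi.single e 1
  let df : E → ℝ := Pi.single f 1
  let v : V → ℝ := (3/4 : ℝ) • (B1 *ᵥ de) + (1/4 : ℝ) • (B2 *ᵥ de)
    - (1/2 : ℝ) • (B1 *ᵥ df) - (1/2 : ℝ) • (B2 *ᵥ df)
  have hvsum : ∑ i, v i = 0 := by
    simp only [v, de, df, mulVec_single_one, hB1, hB2, Pi.add_apply, Pi.sub_apply, Pi.smul_apply,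
      Finset.sum_add_distrib, Finset.sum_sub_distrib, ← Finset.mul_sum, col_apply, of_apply,
      Finset.sum_ite_eq', Finset.sum_ite_eq, Finset.mem_univ, if_true, smul_eq_mul]
    norm_num
  have hPv := hcc v hvsum
  let g : V → ℝ := (4/5 : ℝ) • (Lp *ᵥ v)
  have hLg : L_G *ᵥ g = (4/5 : ℝ) • v := by
    simp only [g, mulVec_smul, mulVec_mulVec, hPv]
  let y1 : E → ℝ := (3/4 : ℝ) • (B1ᵀ *ᵥ g) + (1/4 : ℝ) • (B2ᵀ *ᵥ g)
    + (3/4 : ℝ) • de - (1/2 : ℝ) • df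
  let y2 : E → ℝ := (1/2 : ℝ) • (B1ᵀ *ᵥ g) + (1/2 : ℝ) • (B2ᵀ *ᵥ g) + (1/2 : ℝ) • de - df
  let y3 : E → ℝ := (1/4 : ℝ) • (B1ᵀ *ᵥ g) + (3/4 : ℝ) • (B2ᵀ *ᵥ g)
    + (1/4 : ℝ) • de - (1/2 : ℝ) • df
  let y : V ⊕ E ⊕ E ⊕ E → ℝ := Sum.elim g (Sum.elim y1 (Sum.elim y2 y3))
  let z : V ⊕ E ⊕ E ⊕ E → ℝ := Pi.single (Sum.inr (Sum.inl e)) 1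
    - Pi.single (Sum.inr (Sum.inr (Sum.inl f))) 1
  have hz : z = Sum.elim (0 : V → ℝ) (Sum.elim de (Sum.elim (-df) (0 : E → ℝ))) := by
    ext i
    rcases i with i | i | i | i <;> simp [z, de, df, Pi.single_apply]
  have hLy : L_W *ᵥ y = z := by
    have hVg : ((2 : ℝ) • D_G - A_G) *ᵥ g - B1 *ᵥ y1 - B2 *ᵥ y3 = 0 := by
      have h1 : ((2 : ℝ) • D_G - A_G) *ᵥ g - B1 *ᵥ y1 - B2 *ᵥ y3
          = (5/4 : ℝ) • (L_G *ᵥ g) - v := by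
        simp only [y1, y3, v, hL, hD, hA, mulVec_add, mulVec_sub, mulVec_smul, add_mulVec,
          sub_mulVec, smul_mulVec, mulVec_mulVec]
        module
      rw [h1, hLg, smul_smul]
      norm_num
    rw [hz, hLW]
    simp only [y, fromBlocks_mulVec, fromCols_mulVec, fromRows_mulVec, Sum.elim_comp_inl,
      Sum.elim_comp_inr, fromCols_mulVec_sumElim, zero_mulVec, neg_mulVec, one_mulVec, smul_mulVec]
    congr 1
    · refine Eq.trans ?_ hVg
      abel
    ext i
    rcases i with i | i | i <;> simp [y1, y2, y3] <;> ring
  have hLWs : L_Wᵀ = L_W := by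
    have hDs : D_Gᵀ = D_G := by
      rw [hD]; simp
    have hAs : A_Gᵀ = A_G := by
      rw [hA]; simp [add_comm]
    rw [hLW]
    simp [fromBlocks_transpose, transpose_fromCols, transpose_fromRows, hDs, hAs]
  have hmain : z ⬝ᵥ (X *ᵥ z) = y ⬝ᵥ z := by
    calc z ⬝ᵥ (X *ᵥ z) = (L_W *ᵥ y) ⬝ᵥ (X *ᵥ (L_W *ᵥ y)) := by rw [hLy]
      _ = y ⬝ᵥ ((L_W * X * L_W) *ᵥ y) := by
        have ht : L_W *ᵥ y = y ᵥ* L_W := by rw [← vecMul_transpose, hLWs]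
        rw [mul_assoc, ← mulVec_mulVec, ← mulVec_mulVec, dotProduct_mulVec y, ← ht]
      _ = y ⬝ᵥ z := by rw [hX, hLy]
  have hl : z ⬝ᵥ (X *ᵥ z) = X (Sum.inr (Sum.inl e)) (Sum.inr (Sum.inl e)) +
        X (Sum.inr (Sum.inr (Sum.inl f))) (Sum.inr (Sum.inr (Sum.inl f))) -
        2 * X (Sum.inr (Sum.inl e)) (Sum.inr (Sum.inr (Sum.inl f))) := by
    have := hXsymm.apply (Sum.inr (Sum.inl e)) (Sum.inr (Sum.inr (Sum.inl f)))
    simp only [z, mulVec_sub, sub_dotProduct, dotProduct_sub, mulVec_single_one,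
      single_one_dotProduct, col_apply]
    rw [this]; ring
  have hr : y ⬝ᵥ z = y1 e - y2 f := by
    simp [z, y, dotProduct_sub]
  rw [← hl, hmain, hr]
  have hBt1 : ∀ (w : V → ℝ) a, (B1ᵀ *ᵥ w) a = w (tail a) := by
    intro w a; simp [hB1, mulVec, dotProduct]
  have hBt2 : ∀ (w : V → ℝ) a, (B2ᵀ *ᵥ w) a = w (head a) := by
    intro w a; simp [hB2, mulVec, dotProduct]
  have hc1 : ∀ (M : Matrix V V ℝ) a i, (M *ᵥ (B1 *ᵥ Pi.single a 1)) i = M i (tail a) := by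
    intro M a i; rw [mulVec_single_one]; simp [hB1, mulVec, dotProduct]
  have hc2 : ∀ (M : Matrix V V ℝ) a i, (M *ᵥ (B2 *ᵥ Pi.single a 1)) i = M i (head a) := by
    intro M a i; rw [mulVec_single_one]; simp [hB2, mulVec, dotProduct]
  have hq : ∀ (a b c d : ℝ) (k l : E), ((a • B1ᵀ + b • B2ᵀ) * Lp * (c • B1 + d • B2)) k l
      = a * c * Lp (tail k) (tail l) + a * d * Lp (tail k) (head l)
        + b * c * Lp (head k) (tail l) + b * d * Lp (head k) (head l) := by
    intro a b c d k l
    have h : ((a • B1ᵀ + b • B2ᵀ) * Lp * (c • B1 + d • B2)) k l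
        = ((a • B1ᵀ + b • B2ᵀ) *ᵥ (Lp *ᵥ ((c • B1 + d • B2) *ᵥ Pi.single l 1))) k := by
      rw [mulVec_mulVec, mulVec_mulVec, mulVec_single_one, col_apply]
    rw [h]
    simp only [add_mulVec, smul_mulVec, mulVec_add, mulVec_smul, Pi.add_apply, Pi.smul_apply,
      hBt1, hBt2, hc1, hc2, smul_eq_mul]
    ring
  have hs : ∀ i j, Lp i j = Lp j i := fun i j => hLpsymm.apply j i
  have hone : (1 : Matrix E E ℝ) e f = (Pi.single e 1 : E → ℝ) f := by
    simp [Matrix.one_apply, Pi.single_apply, eq_comm]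
  have hone' : (Pi.single f 1 : E → ℝ) e = (Pi.single e 1 : E → ℝ) f := by
    simp [Pi.single_apply, eq_comm]
  rw [Matrix.add_apply, Matrix.smul_apply, hP1, hP2, hQ2, hq, hq, hq, hone]
  simp only [y1, y2, g, v, de, df, Pi.add_apply, Pi.sub_apply, Pi.smul_apply, hBt1, hBt2,
    mulVec_add, mulVec_sub, mulVec_smul, hc1, hc2, smul_eq_mul, hone', Pi.single_eq_same]
  rw [hs (tail f) (tail e), hs (tail f) (head e), hs (head f) (tail e), hs (head f) (head e)]
  ring
end

section
/- For all edges e, f ∈ E, the resistance distance in W(G) between the path vertices u_{e1} ∈ V1 and u_{f3} ∈ V3 satisfies r_{u_{e1},u_{f3}}(W(G)) = 3/2 + (P1)_{ee} + (R3)_{ff} − 2·((1/4)I_m + P3)_{ef}. -/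
open Matrix

theorem pent_resistance_V1_V3
    {V E : Type} [Fintype V] [Fintype E] [DecidableEq V] [DecidableEq E]
    [Nonempty V] [Nonempty E]
    (tail head : E → V)
    (hloop : ∀ e, tail e ≠ head e)
    (hsimple : ∀ e f, e ≠ f →
      ¬(tail e = tail f ∧ head e = head f) ∧ ¬(tail e = head f ∧ head e = tail f))
    (B1 B2 : Matrix V E ℝ)
    (hB1 : B1 = Matrix.of fun i e => if i = tail e then (1 : ℝ) else 0)
    (hB2 : B2 = Matrix.of fun i e => if i = head e then (1 : ℝ) else 0)
    (D_G A_G L_G : Matrix V V ℝ)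
    (hD : D_G = B1 * B1ᵀ + B2 * B2ᵀ)
    (hA : A_G = B1 * B2ᵀ + B2 * B1ᵀ)
    (hL : L_G = D_G - A_G)
    (hconn : ∀ x : V → ℝ, L_G.mulVec x = 0 → ∃ c, ∀ i, x i = c)
    (Lp : Matrix V V ℝ)
    (hLp1 : L_G * Lp * L_G = L_G)
    (hLp2 : Lp * L_G * Lp = Lp)
    (hLp3 : L_G * Lp = Lp * L_G)
    (hLpsymm : Lp.IsSymm)
    (L_W : Matrix (V ⊕ E ⊕ E ⊕ E) (V ⊕ E ⊕ E ⊕ E) ℝ)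
    (hLW : L_W = Matrix.fromBlocks ((2 : ℝ) • D_G - A_G)
      (Matrix.fromCols (-B1) (Matrix.fromCols (0 : Matrix V E ℝ) (-B2)))
      (Matrix.fromRows (-B1ᵀ) (Matrix.fromRows (0 : Matrix E V ℝ) (-B2ᵀ)))
      (Matrix.fromBlocks ((2 : ℝ) • (1 : Matrix E E ℝ))
        (Matrix.fromCols (-(1 : Matrix E E ℝ)) (0 : Matrix E E ℝ))
        (Matrix.fromRows (-(1 : Matrix E E ℝ)) (0 : Matrix E E ℝ))
        (Matrix.fromBlocks ((2 : ℝ) • (1 : Matrix E E ℝ)) (-(1 : Matrix E E ℝ))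
          (-(1 : Matrix E E ℝ)) ((2 : ℝ) • (1 : Matrix E E ℝ)))))
    (P1 P2 P3 Q2 Q3 R3 : Matrix E E ℝ)
    (hP1 : P1 = ((3/5 : ℝ) • B1ᵀ + (1/5 : ℝ) • B2ᵀ) * Lp * ((3/4 : ℝ) • B1 + (1/4 : ℝ) • B2))
    (hP2 : P2 = ((3/5 : ℝ) • B1ᵀ + (1/5 : ℝ) • B2ᵀ) * Lp * ((1/2 : ℝ) • B1 + (1/2 : ℝ) • B2))
    (hP3 : P3 = ((3/5 : ℝ) • B1ᵀ + (1/5 : ℝ) • B2ᵀ) * Lp * ((1/4 : ℝ) • B1 + (3/4 : ℝ) • B2))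
    (hQ2 : Q2 = ((2/5 : ℝ) • B1ᵀ + (2/5 : ℝ) • B2ᵀ) * Lp * ((1/2 : ℝ) • B1 + (1/2 : ℝ) • B2))
    (hQ3 : Q3 = ((2/5 : ℝ) • B1ᵀ + (2/5 : ℝ) • B2ᵀ) * Lp * ((1/4 : ℝ) • B1 + (3/4 : ℝ) • B2))
    (hR3 : R3 = ((1/5 : ℝ) • B1ᵀ + (3/5 : ℝ) • B2ᵀ) * Lp * ((1/4 : ℝ) • B1 + (3/4 : ℝ) • B2))
    (e f : E)
    (X : Matrix (V ⊕ E ⊕ E ⊕ E) (V ⊕ E ⊕ E ⊕ E) ℝ)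
    (hXsymm : X.IsSymm)
    (hX : L_W * X * L_W = L_W)
    :
    X (Sum.inr (Sum.inl e)) (Sum.inr (Sum.inl e)) +
        X (Sum.inr (Sum.inr (Sum.inr f))) (Sum.inr (Sum.inr (Sum.inr f))) -
        2 * X (Sum.inr (Sum.inl e)) (Sum.inr (Sum.inr (Sum.inr f))) =
      3/2 + P1 e e + R3 f f - 2 * ((1/4 : ℝ) • (1 : Matrix E E ℝ) + P3) e f := by
  obtain ⟨M1, hM1⟩ : ∃ M, M = (3/4 : ℝ) • B1 + (1/4 : ℝ) • B2 := ⟨_, rfl⟩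
  obtain ⟨M3, hM3⟩ : ∃ M, M = (1/4 : ℝ) • B1 + (3/4 : ℝ) • B2 := ⟨_, rfl⟩
  obtain ⟨w, hw⟩ : ∃ w, w = M1 *ᵥ Pi.single e 1 - M3 *ᵥ Pi.single f 1 := ⟨_, rfl⟩
  obtain ⟨z, hz⟩ : ∃ z, z = (4/5 : ℝ) • (Lp *ᵥ w) := ⟨_, rfl⟩
  have h1B1 : (1 : V → ℝ) ᵥ* B1 = 1 := by
    ext i; simp [hB1, Matrix.vecMul, dotProduct]
  have h1B2 : (1 : V → ℝ) ᵥ* B2 = 1 := by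
    ext i; simp [hB2, Matrix.vecMul, dotProduct]
  have h1L : (1 : V → ℝ) ᵥ* L_G = 0 := by
    rw [hL, hD, hA]
    simp only [Matrix.vecMul_sub, Matrix.vecMul_add, ← Matrix.vecMul_vecMul, h1B1, h1B2]
    abel
  have h1w : (1 : V → ℝ) ⬝ᵥ w = 0 := by
    rw [hw, dotProduct_sub, Matrix.dotProduct_mulVec, Matrix.dotProduct_mulVec, hM1, hM3]
    simp only [Matrix.vecMul_add, Matrix.vecMul_smul, h1B1, h1B2]
    simp
    norm_num
  have hLLw : L_G *ᵥ (Lp *ᵥ w) = w := by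
    obtain ⟨c, hc⟩ := hconn (w - L_G *ᵥ (Lp *ᵥ w)) (by
      rw [Matrix.mulVec_sub, Matrix.mulVec_mulVec, Matrix.mulVec_mulVec, Matrix.mul_assoc, hLp3,
        ← Matrix.mul_assoc, hLp1, sub_self])
    have hs : (1 : V → ℝ) ⬝ᵥ (w - L_G *ᵥ (Lp *ᵥ w)) = 0 := by
      rw [dotProduct_sub, h1w, Matrix.dotProduct_mulVec, h1L]; simp
    have h0 : w - L_G *ᵥ (Lp *ᵥ w) = fun _ => c := funext hc
    rw [h0] at hs
    have hc0 : c = 0 := by simpa [dotProduct] using hs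
    rw [hc0] at h0
    exact (sub_eq_zero.mp h0).symm
  have hLz : L_G *ᵥ z = (4/5 : ℝ) • w := by rw [hz, Matrix.mulVec_smul, hLLw]
  obtain ⟨de, hde⟩ : ∃ d : E → ℝ, d = Pi.single e 1 := ⟨_, rfl⟩
  obtain ⟨df, hdf⟩ : ∃ d : E → ℝ, d = Pi.single f 1 := ⟨_, rfl⟩
  rw [← hde, ← hdf] at hw
  obtain ⟨a, ha⟩ : ∃ a, a = (3/4 : ℝ) • de - (1/4 : ℝ) • df + M1ᵀ *ᵥ z := ⟨_, rfl⟩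
  obtain ⟨b, hb⟩ : ∃ b, b = (1/2 : ℝ) • de - (1/2 : ℝ) • df
      + ((1/2 : ℝ) • B1ᵀ + (1/2 : ℝ) • B2ᵀ) *ᵥ z := ⟨_, rfl⟩
  obtain ⟨c, hc⟩ : ∃ c, c = (1/4 : ℝ) • de - (3/4 : ℝ) • df + M3ᵀ *ᵥ z := ⟨_, rfl⟩
  obtain ⟨y, hy⟩ : ∃ y : V ⊕ E ⊕ E ⊕ E → ℝ, y = Sum.elim z (Sum.elim a (Sum.elim b c)) :=
    ⟨_, rfl⟩
  obtain ⟨g, hg⟩ : ∃ g : V ⊕ E ⊕ E ⊕ E → ℝ,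
    g = Pi.single (Sum.inr (Sum.inl e)) 1 - Pi.single (Sum.inr (Sum.inr (Sum.inr f))) 1 :=
    ⟨_, rfl⟩
  have hg' : g = Sum.elim (0 : V → ℝ) (Sum.elim de (Sum.elim (0 : E → ℝ) (-df))) := by
    rw [hg, hde, hdf]
    ext i
    rcases i with i | i | i | i <;> simp [Pi.single_apply]
  have hLy : L_W *ᵥ y = g := by
    rw [hg', hLW, hy]
    simp only [Matrix.fromBlocks_mulVec, Sum.elim_comp_inl, Sum.elim_comp_inr,
      Matrix.fromCols_mulVec_sumElim, Matrix.fromRows_mulVec]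
    have hV : ((2 : ℝ) • D_G - A_G) *ᵥ z + (-B1 *ᵥ a + ((0 : Matrix V E ℝ) *ᵥ b + -B2 *ᵥ c)) = 0 := by
      have e1 : L_G *ᵥ z = D_G *ᵥ z - A_G *ᵥ z := by rw [hL, Matrix.sub_mulVec]
      rw [hLz, hw, hD, hA, hM1, hM3] at e1
      rw [ha, hc, hD, hA, hM1, hM3]
      simp only [Matrix.transpose_add, Matrix.transpose_smul, Matrix.add_mulVec,
        Matrix.sub_mulVec, Matrix.smul_mulVec, Matrix.mulVec_add, Matrix.mulVec_sub,
        Matrix.mulVec_smul, Matrix.neg_mulVec, Matrix.zero_mulVec, ← Matrix.mulVec_mulVec] at e1 ⊢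
      ext i
      have e2 := congrFun e1 i
      simp only [Pi.add_apply, Pi.sub_apply, Pi.smul_apply, Pi.neg_apply, Pi.zero_apply,
        smul_eq_mul] at e2 ⊢
      linarith
    rw [hV]
    congr 1
    rw [ha, hb, hc, hM1, hM3]
    ext i
    rcases i with i | i | i <;>
    simp [Matrix.add_mulVec, Matrix.smul_mulVec, Matrix.neg_mulVec] <;> ring
  have hLWs : L_Wᵀ = L_W := by
    rw [hLW, hD, hA]
    ext i j
    rcases i with i | i | i | i <;> rcases j with j | j | j | j <;>
      simp [Matrix.fromBlocks, Matrix.mul_apply, Matrix.one_apply, mul_comm, eq_comm, add_comm]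
  have key : g ⬝ᵥ (X *ᵥ g) = y ⬝ᵥ g := by
    have : g = y ᵥ* L_W := by rw [← hLWs, Matrix.vecMul_transpose, hLy]
    calc g ⬝ᵥ (X *ᵥ g) = (y ᵥ* L_W) ⬝ᵥ (X *ᵥ (L_W *ᵥ y)) := by rw [hLy, ← this]
      _ = y ⬝ᵥ ((L_W * X * L_W) *ᵥ y) := by
        rw [← Matrix.dotProduct_mulVec, Matrix.mulVec_mulVec, Matrix.mulVec_mulVec]
      _ = y ⬝ᵥ g := by rw [hX, hLy]
  have hXs := hXsymm.apply (Sum.inr (Sum.inl e)) (Sum.inr (Sum.inr (Sum.inr f)))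
  have hl : g ⬝ᵥ (X *ᵥ g) = X (Sum.inr (Sum.inl e)) (Sum.inr (Sum.inl e)) +
        X (Sum.inr (Sum.inr (Sum.inr f))) (Sum.inr (Sum.inr (Sum.inr f))) -
        2 * X (Sum.inr (Sum.inl e)) (Sum.inr (Sum.inr (Sum.inr f))) := by
    rw [hg]
    simp [Matrix.mulVec_sub, sub_dotProduct, dotProduct_sub]
    linarith
  have hr : y ⬝ᵥ g = a e - c f := by
    rw [hg, hy]
    simp [dotProduct_sub]
  have q1 : M1ᵀ *ᵥ z = (4/5 : ℝ) • ((M1ᵀ * Lp * M1) *ᵥ de - (M1ᵀ * Lp * M3) *ᵥ df) := by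
    rw [hz, hw]
    simp only [Matrix.mulVec_smul, Matrix.mulVec_sub, Matrix.mulVec_mulVec, Matrix.mul_assoc]
  have q3 : M3ᵀ *ᵥ z = (4/5 : ℝ) • ((M3ᵀ * Lp * M1) *ᵥ de - (M3ᵀ * Lp * M3) *ᵥ df) := by
    rw [hz, hw]
    simp only [Matrix.mulVec_smul, Matrix.mulVec_sub, Matrix.mulVec_mulVec, Matrix.mul_assoc]
  have hsy : (M3ᵀ * Lp * M1) f e = (M1ᵀ * Lp * M3) e f := by
    have : (M1ᵀ * Lp * M3)ᵀ = M3ᵀ * Lp * M1 := by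
      rw [Matrix.transpose_mul, Matrix.transpose_mul, hLpsymm.eq, Matrix.transpose_transpose,
        Matrix.mul_assoc]
    rw [← this, Matrix.transpose_apply]
  have k1 : (3/5 : ℝ) • B1ᵀ + (1/5 : ℝ) • B2ᵀ = (4/5 : ℝ) • M1ᵀ := by
    rw [hM1]; ext i j; simp; ring
  have k3 : (1/5 : ℝ) • B1ᵀ + (3/5 : ℝ) • B2ᵀ = (4/5 : ℝ) • M3ᵀ := by
    rw [hM3]; ext i j; simp; ring
  rw [← hl, key, hr, hP1, hP3, hR3, k1, k3, ← hM1, ← hM3, ha, hc, q1, q3, hde, hdf]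
  simp only [Matrix.smul_mul, Matrix.add_apply, Matrix.smul_apply, Pi.add_apply, Pi.sub_apply,
    Pi.smul_apply, smul_eq_mul, Matrix.mulVec_single_one, Matrix.col_apply, hsy,
    Pi.single_eq_same, Pi.single_apply, Matrix.one_apply, eq_comm (a := f) (b := e)]
  ring
end

section
/- For all edges e, f ∈ E, the resistance distance in W(G) between the path vertices u_{e2} ∈ V2 and u_{f3} ∈ V3 satisfies r_{u_{e2},u_{f3}}(W(G)) = 7/4 + (Q2)_{ee} + (R3)_{ff} − 2·((1/2)I_m + Q3)_{ef}. -/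
open Matrix

theorem pent_resistance_V2_V3
    {V E : Type} [Fintype V] [Fintype E] [DecidableEq V] [DecidableEq E]
    [Nonempty V] [Nonempty E]
    (tail head : E → V)
    (hloop : ∀ e, tail e ≠ head e)
    (hsimple : ∀ e f, e ≠ f →
      ¬(tail e = tail f ∧ head e = head f) ∧ ¬(tail e = head f ∧ head e = tail f))
    (B1 B2 : Matrix V E ℝ)
    (hB1 : B1 = Matrix.of fun i e => if i = tail e then (1 : ℝ) else 0)
    (hB2 : B2 = Matrix.of fun i e => if i = head e then (1 : ℝ) else 0)
    (D_G A_G L_G : Matrix V V ℝ)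
    (hD : D_G = B1 * B1ᵀ + B2 * B2ᵀ)
    (hA : A_G = B1 * B2ᵀ + B2 * B1ᵀ)
    (hL : L_G = D_G - A_G)
    (hconn : ∀ x : V → ℝ, L_G.mulVec x = 0 → ∃ c, ∀ i, x i = c)
    (Lp : Matrix V V ℝ)
    (hLp1 : L_G * Lp * L_G = L_G)
    (hLp2 : Lp * L_G * Lp = Lp)
    (hLp3 : L_G * Lp = Lp * L_G)
    (hLpsymm : Lp.IsSymm)
    (L_W : Matrix (V ⊕ E ⊕ E ⊕ E) (V ⊕ E ⊕ E ⊕ E) ℝ)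
    (hLW : L_W = Matrix.fromBlocks ((2 : ℝ) • D_G - A_G)
      (Matrix.fromCols (-B1) (Matrix.fromCols (0 : Matrix V E ℝ) (-B2)))
      (Matrix.fromRows (-B1ᵀ) (Matrix.fromRows (0 : Matrix E V ℝ) (-B2ᵀ)))
      (Matrix.fromBlocks ((2 : ℝ) • (1 : Matrix E E ℝ))
        (Matrix.fromCols (-(1 : Matrix E E ℝ)) (0 : Matrix E E ℝ))
        (Matrix.fromRows (-(1 : Matrix E E ℝ)) (0 : Matrix E E ℝ))
        (Matrix.fromBlocks ((2 : ℝ) • (1 : Matrix E E ℝ)) (-(1 : Matrix E E ℝ))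
          (-(1 : Matrix E E ℝ)) ((2 : ℝ) • (1 : Matrix E E ℝ)))))
    (P1 P2 P3 Q2 Q3 R3 : Matrix E E ℝ)
    (hP1 : P1 = ((3/5 : ℝ) • B1ᵀ + (1/5 : ℝ) • B2ᵀ) * Lp * ((3/4 : ℝ) • B1 + (1/4 : ℝ) • B2))
    (hP2 : P2 = ((3/5 : ℝ) • B1ᵀ + (1/5 : ℝ) • B2ᵀ) * Lp * ((1/2 : ℝ) • B1 + (1/2 : ℝ) • B2))
    (hP3 : P3 = ((3/5 : ℝ) • B1ᵀ + (1/5 : ℝ) • B2ᵀ) * Lp * ((1/4 : ℝ) • B1 + (3/4 : ℝ) • B2))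
    (hQ2 : Q2 = ((2/5 : ℝ) • B1ᵀ + (2/5 : ℝ) • B2ᵀ) * Lp * ((1/2 : ℝ) • B1 + (1/2 : ℝ) • B2))
    (hQ3 : Q3 = ((2/5 : ℝ) • B1ᵀ + (2/5 : ℝ) • B2ᵀ) * Lp * ((1/4 : ℝ) • B1 + (3/4 : ℝ) • B2))
    (hR3 : R3 = ((1/5 : ℝ) • B1ᵀ + (3/5 : ℝ) • B2ᵀ) * Lp * ((1/4 : ℝ) • B1 + (3/4 : ℝ) • B2))
    (e f : E)
    (X : Matrix (V ⊕ E ⊕ E ⊕ E) (V ⊕ E ⊕ E ⊕ E) ℝ)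
    (hXsymm : X.IsSymm)
    (hX : L_W * X * L_W = L_W)
    :
    X (Sum.inr (Sum.inr (Sum.inl e))) (Sum.inr (Sum.inr (Sum.inl e))) +
        X (Sum.inr (Sum.inr (Sum.inr f))) (Sum.inr (Sum.inr (Sum.inr f))) -
        2 * X (Sum.inr (Sum.inr (Sum.inl e))) (Sum.inr (Sum.inr (Sum.inr f))) =
      7/4 + Q2 e e + R3 f f - 2 * ((1/2 : ℝ) • (1 : Matrix E E ℝ) + Q3) e f := by
  -- `M = 1 - L Lp` is a constant matrix
  have hLsymm : L_Gᵀ = L_G := by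
    rw [hL, hD, hA]
    simp only [transpose_sub, transpose_add, transpose_mul, transpose_transpose]
    rw [add_comm (B2 * B1ᵀ)]
  have hMc : ∃ c : ℝ, ∀ i j, (1 - L_G * Lp) i j = c := by
    have hcol : ∀ j, ∃ c, ∀ i, (1 - L_G * Lp) i j = c := by
      intro j
      have h0 : L_G * (1 - L_G * Lp) = 0 := by
        rw [hLp3, mul_sub, ← mul_assoc, hLp1, mul_one, sub_self]
      apply hconn (fun i => (1 - L_G * Lp) i j)
      ext i
      exact congrFun (congrFun h0 i) j
    have hsym : (1 - L_G * Lp)ᵀ = 1 - L_G * Lp := by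
      rw [transpose_sub, transpose_mul, hLpsymm.eq, hLsymm, transpose_one, hLp3]
    choose c hc using hcol
    obtain ⟨k⟩ := (inferInstance : Nonempty V)
    refine ⟨c k, fun i j => ?_⟩
    rw [hc j i, ← hc j k, ← hc k j]
    exact congrFun (congrFun hsym j) k
  obtain ⟨c, hc⟩ := hMc
  set de : E → ℝ := Pi.single e 1 with hde
  set df : E → ℝ := Pi.single f 1 with hdf
  set w : V → ℝ := (1/2 : ℝ) • (B1 *ᵥ de) + (1/2 : ℝ) • (B2 *ᵥ de)
    - (1/4 : ℝ) • (B1 *ᵥ df) - (3/4 : ℝ) • (B2 *ᵥ df) with hw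
  have hsum : ∑ i, w i = 0 := by
    simp only [hw, hde, hdf, hB1, hB2, mulVec_single_one, Pi.sub_apply, Pi.add_apply,
      Pi.smul_apply, col_apply, of_apply, Finset.sum_sub_distrib, Finset.sum_add_distrib,
      smul_eq_mul, ← Finset.mul_sum, Finset.sum_ite_eq', Finset.mem_univ, if_true,
      Finset.sum_ite_eq]
    norm_num
  have hproj : L_G *ᵥ (Lp *ᵥ w) = w := by
    have h0 : (1 - L_G * Lp) *ᵥ w = 0 := by
      ext i
      simp only [mulVec, dotProduct, hc, ← Finset.mul_sum, hsum, mul_zero, Pi.zero_apply]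
    rw [sub_mulVec, one_mulVec, sub_eq_zero] at h0
    rw [mulVec_mulVec]
    exact h0.symm
  set z : V → ℝ := (4/5 : ℝ) • (Lp *ᵥ w) with hz
  have hLz : (5/4 : ℝ) • (L_G *ᵥ z) = w := by
    rw [hz, mulVec_smul, hproj, smul_smul]; norm_num
  set y1 : E → ℝ := (3/4 : ℝ) • (B1ᵀ *ᵥ z) + (1/4 : ℝ) • (B2ᵀ *ᵥ z)
    + (1/2 : ℝ) • de - (1/4 : ℝ) • df with hy1
  set y2 : E → ℝ := (1/2 : ℝ) • (B1ᵀ *ᵥ z) + (1/2 : ℝ) • (B2ᵀ *ᵥ z)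
    + de - (1/2 : ℝ) • df with hy2
  set y3 : E → ℝ := (1/4 : ℝ) • (B1ᵀ *ᵥ z) + (3/4 : ℝ) • (B2ᵀ *ᵥ z)
    + (1/2 : ℝ) • de - (3/4 : ℝ) • df with hy3
  set y : V ⊕ E ⊕ E ⊕ E → ℝ := Sum.elim z (Sum.elim y1 (Sum.elim y2 y3)) with hy
  set b : V ⊕ E ⊕ E ⊕ E → ℝ := Sum.elim 0 (Sum.elim 0 (Sum.elim de (-df))) with hb
  have hV : ((2 : ℝ) • D_G - A_G) *ᵥ z - B1 *ᵥ y1 - B2 *ᵥ y3 = 0 := by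
    have h1 := hLz
    rw [hL, hD, hA, hw] at h1
    rw [hD, hA, hy1, hy3]
    simp only [sub_mulVec, add_mulVec, smul_mulVec, mulVec_add, mulVec_sub, mulVec_smul,
      ← mulVec_mulVec] at h1 ⊢
    ext i
    have h2 := congrFun h1 i
    simp only [Pi.sub_apply, Pi.add_apply, Pi.smul_apply, smul_eq_mul, Pi.zero_apply] at h2 ⊢
    linarith
  have hLy : L_W *ᵥ y = b := by
    rw [hLW, hy, hb]
    simp only [fromBlocks_mulVec, fromCols_mulVec_sumElim, fromRows_mulVec, Sum.elim_comp_inl,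
      Sum.elim_comp_inr, smul_mulVec, one_mulVec, neg_mulVec, zero_mulVec]
    ext i
    rcases i with i | i | i | i
    · have h2 := congrFun hV i
      simp only [sub_mulVec, smul_mulVec, Sum.elim_inl, Pi.sub_apply, Pi.add_apply, Pi.smul_apply, smul_eq_mul, Pi.zero_apply,
        Pi.neg_apply] at h2 ⊢
      linarith
    all_goals
      simp only [Sum.elim_inl, Sum.elim_inr, Pi.sub_apply, Pi.add_apply, Pi.smul_apply,
        smul_eq_mul, Pi.zero_apply, Pi.neg_apply, hy1, hy2, hy3]
      ring
  have hLWsymm : L_Wᵀ = L_W := by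
    have hDs : D_Gᵀ = D_G := by
      rw [hD]; simp only [transpose_add, transpose_mul, transpose_transpose]
    have hAs : A_Gᵀ = A_G := by
      rw [hA]; simp only [transpose_add, transpose_mul, transpose_transpose, add_comm]
    rw [hLW]
    simp [fromBlocks_transpose, transpose_fromCols, transpose_fromRows, hDs, hAs]
  have hquad : b ⬝ᵥ (X *ᵥ b) = y ⬝ᵥ b := by
    have h1 : b = y ᵥ* L_W := by rw [← hLy, ← mulVec_transpose, hLWsymm]
    calc b ⬝ᵥ (X *ᵥ b) = (y ᵥ* L_W) ⬝ᵥ (X *ᵥ (L_W *ᵥ y)) := by rw [← h1, hLy]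
      _ = y ⬝ᵥ ((L_W * X * L_W) *ᵥ y) := by
        rw [← dotProduct_mulVec, mulVec_mulVec, mulVec_mulVec, mul_assoc]
      _ = y ⬝ᵥ b := by rw [hX, hLy]
  have hbs : b = Pi.single (Sum.inr (Sum.inr (Sum.inl e))) 1
      - Pi.single (Sum.inr (Sum.inr (Sum.inr f))) 1 := by
    ext i
    rcases i with i | i | i | i <;> simp [hb, hde, hdf, Pi.single_apply]
  have hXs := hXsymm.apply (Sum.inr (Sum.inr (Sum.inl e))) (Sum.inr (Sum.inr (Sum.inr f)))
  have hl : b ⬝ᵥ (X *ᵥ b) = X (Sum.inr (Sum.inr (Sum.inl e))) (Sum.inr (Sum.inr (Sum.inl e))) +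
        X (Sum.inr (Sum.inr (Sum.inr f))) (Sum.inr (Sum.inr (Sum.inr f))) -
        2 * X (Sum.inr (Sum.inr (Sum.inl e))) (Sum.inr (Sum.inr (Sum.inr f))) := by
    rw [hbs]
    simp only [mulVec_sub, sub_dotProduct, dotProduct_sub, single_one_dotProduct,
      mulVec_single_one, col_apply, hXs]
    ring
  have hr : y ⬝ᵥ b = y2 e - y3 f := by
    rw [hbs, dotProduct_sub, dotProduct_single_one, dotProduct_single_one]
    rfl
  rw [← hl, hquad, hr]
  have hb1 : ∀ g (v : V → ℝ), (B1ᵀ *ᵥ v) g = v (tail g) := by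
    intro g v; rw [hB1]; simp [mulVec, dotProduct]
  have hb2 : ∀ g (v : V → ℝ), (B2ᵀ *ᵥ v) g = v (head g) := by
    intro g v; rw [hB2]; simp [mulVec, dotProduct]
  have hc1 : ∀ g, B1 *ᵥ Pi.single g 1 = Pi.single (tail g) 1 := by
    intro g; ext i; rw [hB1]; simp [Pi.single_apply]
  have hc2 : ∀ g, B2 *ᵥ Pi.single g 1 = Pi.single (head g) 1 := by
    intro g; ext i; rw [hB2]; simp [Pi.single_apply]
  have hent : ∀ (N : Matrix E E ℝ) g h, N g h = (N *ᵥ Pi.single h 1) g := by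
    intro N g h; simp
  rw [Matrix.add_apply, hent Q2, hent R3, hent Q3, hQ2, hQ3, hR3, hy2, hy3, hz, hw, hde, hdf]
  simp only [← mulVec_mulVec, add_mulVec, smul_mulVec, mulVec_add, mulVec_sub, mulVec_smul,
    hc1, hc2, Pi.sub_apply, Pi.add_apply, Pi.smul_apply, smul_eq_mul, hb1, hb2]
  simp only [mulVec_single_one, col_apply, Pi.single_apply, Matrix.smul_apply, Matrix.one_apply, smul_eq_mul,
    eq_comm (a := f) (b := e), if_true]
  have s1 := hLpsymm.apply (tail e) (tail f)
  have s2 := hLpsymm.apply (tail e) (head f)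
  have s3 := hLpsymm.apply (head e) (tail f)
  have s4 := hLpsymm.apply (head e) (head f)
  rw [s1, s2, s3, s4]
  ring
end
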